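/- Let N ≥ 2 and let φ ∈ Out(F_N) be a fully irreducible outer automorphism of the free group F_N of rank N. Then there exists a real number λ > 1 such that for every free basis X of F_N and every conjugacy class α of F_N that is not φ-periodic, the sequence n ↦ (‖φ^n(α)‖_X)^{1/n} converges to λ. In particular the stretch factor λ(φ) is well defined, independent of the choice of α and X, and satisfies λ(φ) > 1. -/

import Mathlib

/-- The free group of rank `N`. -/
abbrev FreeGroupN (N : ℕ) := FreeGroup (Fin N)

/-- The subgroup of inner automorphisms of a group `G`. -/
def Inn (G : Type*) [Group G] : Subgroup (MulAut G) :=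
  (MulAut.conj : G →* MulAut G).range

instance Inn.normal (G : Type*) [Group G] : (Inn G).Normal := by
  constructor
  rintro _ ⟨g, rfl⟩ f
  refine ⟨f g, ?_⟩
  ext x
  simp [MulAut.conj, mul_assoc]

/-- The outer automorphism group `Out(G) = Aut(G)/Inn(G)`. -/
def Out (G : Type*) [Group G] := MulAut G ⧸ Inn G

instance (G : Type*) [Group G] : Group (Out G) :=
  inferInstanceAs (Group (MulAut G ⧸ Inn G))

/-- A subgroup `A ≤ G` is a free factor if there is a subgroup `B ≤ G` such that
`G` is the internal free product `A * B`, i.e. the natural map from the (external)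
free product `A ∗ B` to `G` is an isomorphism. -/
def IsFreeFactor {G : Type*} [Group G] (A : Subgroup G) : Prop :=
  ∃ B : Subgroup G, Function.Bijective (Monoid.Coprod.lift A.subtype B.subtype)

/-- An outer automorphism is fully irreducible if no positive power preserves the
conjugacy class of a proper nontrivial free factor. -/
def FullyIrreducible {N : ℕ} (φ : Out (FreeGroupN N)) : Prop :=
  ∀ k : ℕ, 0 < k →
    ∀ f : MulAut (FreeGroupN N), (QuotientGroup.mk f : Out (FreeGroupN N)) = φ ^ k →
      ∀ A : Subgroup (FreeGroupN N), IsFreeFactor A → A ≠ ⊥ → A ≠ ⊤ →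
        ∀ g : FreeGroupN N,
          A.map (f : FreeGroupN N →* FreeGroupN N) ≠
            A.map ((MulAut.conj g : MulAut (FreeGroupN N)) : FreeGroupN N →* FreeGroupN N)

/-- The cyclically reduced length of a conjugacy class `α` with respect to a
free basis of `F_N` (encoded as a group isomorphism `β` with the standard free
group of rank `N`): the minimal word length among representatives of `α`. -/
noncomputable def cycLength {N : ℕ} (β : FreeGroupN N ≃* FreeGroup (Fin N))
    (α : ConjClasses (FreeGroupN N)) : ℕ :=
  sInf ((fun g => (β g).norm) '' {g : FreeGroupN N | ConjClasses.mk g = α})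

/-- A conjugacy class `α` is periodic for an automorphism `f` if some positive power
of `f` fixes `α`. -/
def IsPeriodicClass {N : ℕ} (f : MulAut (FreeGroupN N)) (α : ConjClasses (FreeGroupN N)) : Prop :=
  ∃ k : ℕ, 0 < k ∧ ConjClasses.map ((f ^ k : MulAut (FreeGroupN N)) : FreeGroupN N →* FreeGroupN N) α = α

/-- `lam` is the stretch factor of the outer automorphism `φ`: for every automorphism `f`
representing `φ`, every free basis of `F_N` and every non-`φ`-periodic conjugacy class `α`,
the sequence `n ↦ ‖φ^n(α)‖_X^(1/n)` converges to `lam`. -/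
def HasStretchFactor {N : ℕ} (φ : Out (FreeGroupN N)) (lam : ℝ) : Prop :=
  ∀ f : MulAut (FreeGroupN N), (QuotientGroup.mk f : Out (FreeGroupN N)) = φ →
    ∀ β : FreeGroupN N ≃* FreeGroup (Fin N),
      ∀ α : ConjClasses (FreeGroupN N), ¬ IsPeriodicClass f α →
        Filter.Tendsto
          (fun n : ℕ =>
            ((cycLength β (ConjClasses.map ((f ^ n : MulAut (FreeGroupN N)) : FreeGroupN N →* FreeGroupN N) α) : ℝ)) ^ (1 / (n : ℝ)))
          Filter.atTop (nhds lam)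

namespace TrainTrack

open FreeGroup (invRev invRev_invRev isReduced_iff_reduce_eq isReduced_iff_not_step)

/-! ### Words, substitutions and labels -/

/-- The inverse letter. -/
def bar {E : Type*} (a : E × Bool) : E × Bool := (a.1, !a.2)

@[simp] lemma bar_bar {E : Type*} (a : E × Bool) : bar (bar a) = a := by
  simp [bar]

@[simp] lemma bar_fst {E : Type*} (a : E × Bool) : (bar a).1 = a.1 := rfl

@[simp] lemma bar_mk {E : Type*} (e : E) (b : Bool) : bar (e, b) = (e, !b) := rfl

lemma bar_ne {E : Type*} (a : E × Bool) : bar a ≠ a := by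
  rcases a with ⟨e, _ | _⟩ <;> simp [bar]

lemma eq_or_eq_bar {E : Type*} {a b : E × Bool} (h : a.1 = b.1) : a = b ∨ a = bar b := by
  rcases a with ⟨e, _ | _⟩ <;> rcases b with ⟨e', _ | _⟩ <;> simp_all [bar]

lemma invRev_append {E : Type*} (L M : List (E × Bool)) :
    invRev (L ++ M) = invRev M ++ invRev L := by
  simp [invRev]

lemma invRev_cons {E : Type*} (a : E × Bool) (M : List (E × Bool)) :
    invRev (a :: M) = invRev M ++ [bar a] := by
  simp [invRev, bar]

@[simp] lemma invRev_nil {E : Type*} : invRev ([] : List (E × Bool)) = [] := rfl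

@[simp] lemma invRev_singleton {E : Type*} (a : E × Bool) : invRev [a] = [bar a] := rfl

lemma invRev_eq_nil {E : Type*} {L : List (E × Bool)} : invRev L = [] ↔ L = [] := by
  simp [invRev]

lemma mem_invRev {E : Type*} {a : E × Bool} {L : List (E × Bool)} :
    a ∈ invRev L ↔ bar a ∈ L := by
  simp only [invRev, List.mem_reverse, List.mem_map]
  constructor
  · rintro ⟨b, hb, rfl⟩
    simpa [bar] using hb
  · intro h
    exact ⟨_, h, by simp [bar]⟩

lemma mk_invRev {E : Type*} (L : List (E × Bool)) :
    FreeGroup.mk (invRev L) = (FreeGroup.mk L)⁻¹ := FreeGroup.inv_mk.symm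

/-- The image of a letter under a substitution. -/
def sub1 {E E' : Type*} (f : E → List (E' × Bool)) (a : E × Bool) : List (E' × Bool) :=
  if a.2 then f a.1 else invRev (f a.1)

/-- The image of a word under a substitution. -/
def sub {E E' : Type*} (f : E → List (E' × Bool)) (L : List (E × Bool)) : List (E' × Bool) :=
  L.flatMap (sub1 f)

section Sub

variable {E E' E'' : Type*} (f : E → List (E' × Bool))

@[simp] lemma sub1_true (e : E) : sub1 f (e, true) = f e := by simp [sub1]

@[simp] lemma sub1_false (e : E) : sub1 f (e, false) = invRev (f e) := by simp [sub1]

@[simp] lemma sub1_bar (a : E × Bool) : sub1 f (bar a) = invRev (sub1 f a) := by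
  rcases a with ⟨e, _ | _⟩ <;> simp [invRev_invRev]

@[simp] lemma sub_nil : sub f [] = [] := rfl

@[simp] lemma sub_cons (a : E × Bool) (L : List (E × Bool)) :
    sub f (a :: L) = sub1 f a ++ sub f L := by simp [sub]

@[simp] lemma sub_append (L M : List (E × Bool)) : sub f (L ++ M) = sub f L ++ sub f M := by
  simp [sub]

lemma sub_singleton (a : E × Bool) : sub f [a] = sub1 f a := by simp [sub]

lemma sub_invRev (L : List (E × Bool)) : sub f (invRev L) = invRev (sub f L) := by
  induction L with
  | nil => rfl
  | cons a L ih => simp [invRev_cons, ih]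

lemma sub1_sub (g : E' → List (E'' × Bool)) (a : E × Bool) :
    sub1 (fun e => sub g (f e)) a = sub g (sub1 f a) := by
  rcases a with ⟨e, _ | _⟩ <;> simp [sub_invRev]

lemma sub_sub (g : E' → List (E'' × Bool)) (L : List (E × Bool)) :
    sub g (sub f L) = sub (fun e => sub g (f e)) L := by
  induction L with
  | nil => rfl
  | cons a L ih => simp [ih, sub1_sub]

lemma sub1_letter (a : E × Bool) : sub1 (fun e => [(e, true)]) a = [a] := by
  rcases a with ⟨e, _ | _⟩ <;> simp

lemma sub_letter (L : List (E × Bool)) : sub (fun e => [(e, true)]) L = L := by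
  induction L with
  | nil => rfl
  | cons a L ih => simp [ih, sub1_letter]

lemma sub_congr {f g : E → List (E' × Bool)} {L : List (E × Bool)}
    (h : ∀ a ∈ L, f a.1 = g a.1) : sub f L = sub g L := by
  induction L with
  | nil => rfl
  | cons a L ih =>
    simp only [List.mem_cons, forall_eq_or_imp] at h
    simp [ih h.2, sub1, h.1]

lemma mem_sub {b : E' × Bool} {L : List (E × Bool)} :
    b ∈ sub f L ↔ ∃ a ∈ L, b ∈ sub1 f a := by simp [sub]

end Sub

/-- The value of a word under an assignment of group elements to the letters. -/
def lab {E Γ : Type*} [Group Γ] (r : E → Γ) (L : List (E × Bool)) : Γ :=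
  FreeGroup.lift r (FreeGroup.mk L)

section Lab

variable {E E' Γ Γ' : Type*} [Group Γ] [Group Γ'] (r : E → Γ)

@[simp] lemma lab_nil : lab r [] = 1 := by simp [lab, FreeGroup.lift_mk]

lemma lab_append (L M : List (E × Bool)) : lab r (L ++ M) = lab r L * lab r M := by
  rw [lab, ← FreeGroup.mul_mk, _root_.map_mul]; rfl

lemma lab_cons (a : E × Bool) (L : List (E × Bool)) :
    lab r (a :: L) = lab r [a] * lab r L := lab_append r [a] L

lemma lab_invRev (L : List (E × Bool)) : lab r (invRev L) = (lab r L)⁻¹ := by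
  rw [lab, mk_invRev, _root_.map_inv]; rfl

@[simp] lemma lab_true (e : E) : lab r [(e, true)] = r e := by simp [lab, FreeGroup.lift_mk]

@[simp] lemma lab_false (e : E) : lab r [(e, false)] = (r e)⁻¹ := by
  simp [lab, FreeGroup.lift_mk]

lemma lab_bar (a : E × Bool) : lab r [bar a] = (lab r [a])⁻¹ := by
  rw [← invRev_singleton, lab_invRev]

lemma lab_sub (s : E' → List (E × Bool)) (L : List (E' × Bool)) :
    lab r (sub s L) = lab (fun e => lab r (s e)) L := by
  induction L with
  | nil => simp
  | cons a L ih =>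
    rw [sub_cons, lab_append, ih, lab_cons _ a]
    rcases a with ⟨e, _ | _⟩ <;> simp [lab_invRev]

lemma map_lab (φ : Γ →* Γ') (L : List (E × Bool)) :
    φ (lab r L) = lab (fun e => φ (r e)) L := by
  induction L with
  | nil => simp
  | cons a L ih =>
    rw [lab_cons, _root_.map_mul, ih, lab_cons (fun e => φ (r e)) a]
    rcases a with ⟨e, _ | _⟩ <;> simp

lemma lab_of (L : List (E × Bool)) : lab FreeGroup.of L = FreeGroup.mk L := FreeGroup.lift_of_apply _

lemma lab_eq_of_mk {L M : List (E × Bool)} (h : FreeGroup.mk L = FreeGroup.mk M) :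
    lab r L = lab r M := by rw [lab, h]; rfl

lemma mk_sub (f : E → List (E' × Bool)) (L : List (E × Bool)) :
    FreeGroup.mk (sub f L) = lab (fun e => FreeGroup.mk (f e)) L := by
  rw [← lab_of, lab_sub]; simp [lab_of]

lemma mk_sub_congr (f : E → List (E' × Bool)) {L M : List (E × Bool)}
    (h : FreeGroup.mk L = FreeGroup.mk M) : FreeGroup.mk (sub f L) = FreeGroup.mk (sub f M) := by
  rw [mk_sub, mk_sub]; exact lab_eq_of_mk _ h

end Lab

/-! ### Reduced words -/

open Classical in
/-- The reduced form of a word. -/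
noncomputable def red {E : Type*} (L : List (E × Bool)) : List (E × Bool) := FreeGroup.reduce L

section Red

variable {E : Type*} {L M : List (E × Bool)}

lemma red_red (L : List (E × Bool)) : FreeGroup.Red L (red L) := by
  classical exact FreeGroup.reduce.red

lemma mk_red (L : List (E × Bool)) : FreeGroup.mk (red L) = FreeGroup.mk L := by
  classical exact FreeGroup.reduce.self

lemma red_eq_iff : red L = red M ↔ FreeGroup.mk L = FreeGroup.mk M := by
  classical exact ⟨FreeGroup.reduce.exact, FreeGroup.reduce.sound⟩

lemma isReduced_red (L : List (E × Bool)) : FreeGroup.IsReduced (red L) := by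
  classical exact isReduced_iff_reduce_eq.2 FreeGroup.reduce.idem

lemma red_eq_self : red L = L ↔ FreeGroup.IsReduced L := by
  classical exact isReduced_iff_reduce_eq.symm

lemma _root_.FreeGroup.IsReduced.subword (h : FreeGroup.IsReduced L) (h' : M <:+: L) :
    FreeGroup.IsReduced M := List.IsChain.infix h h'

lemma eq_of_mk_eq (hL : FreeGroup.IsReduced L) (hM : FreeGroup.IsReduced M)
    (h : FreeGroup.mk L = FreeGroup.mk M) : L = M := by
  rw [← red_eq_self.2 hL, ← red_eq_self.2 hM, red_eq_iff.2 h]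

lemma mk_eq_one_iff : FreeGroup.mk L = 1 ↔ red L = [] := by
  rw [FreeGroup.one_eq_mk, ← red_eq_iff]
  simp [red]

lemma length_red_le (L : List (E × Bool)) : (red L).length ≤ L.length :=
  (red_red L).length_le

lemma isReduced_invRev (h : FreeGroup.IsReduced L) : FreeGroup.IsReduced (invRev L) := by
  classical
  rw [isReduced_iff_reduce_eq] at *
  rw [FreeGroup.reduce_invRev, h]

lemma red_of_mk_eq (h : FreeGroup.mk L = FreeGroup.mk M) (hM : FreeGroup.IsReduced M) :
    red L = M := eq_of_mk_eq (isReduced_red L) hM (by rw [mk_red, h])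

lemma isReduced_append_iff {L M : List (E × Bool)} : FreeGroup.IsReduced (L ++ M) ↔
    FreeGroup.IsReduced L ∧ FreeGroup.IsReduced M ∧ ∀ a ∈ L.getLast?, ∀ b ∈ M.head?, b ≠ bar a := by
  unfold FreeGroup.IsReduced
  rw [List.isChain_append]
  refine and_congr_right fun _ => and_congr_right fun _ => ?_
  refine forall₂_congr fun a _ => forall₂_congr fun b _ => ?_
  rcases a with ⟨a, _ | _⟩ <;> rcases b with ⟨b, _ | _⟩ <;> simp [bar, eq_comm]

lemma isReduced_cons_cons {a b : E × Bool} :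
    FreeGroup.IsReduced (a :: b :: L) ↔ b ≠ bar a ∧ FreeGroup.IsReduced (b :: L) := by
  rw [show a :: b :: L = [a] ++ (b :: L) from rfl, isReduced_append_iff]
  simp [FreeGroup.IsReduced.singleton, and_comm]

end Red

/-! ### Edge paths -/

/-- `IsPath o u L v`: the word `L` is an edge path from `u` to `v`, where `o a` is the origin of
the oriented edge `a`. -/
def IsPath {E V : Type*} (o : E × Bool → V) : V → List (E × Bool) → V → Prop
  | u, [], v => u = v
  | u, a :: L, v => o a = u ∧ IsPath o (o (bar a)) L v

section Path

variable {E V E' V' : Type*} {o : E × Bool → V}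

@[simp] lemma isPath_nil {u v : V} : IsPath o u [] v ↔ u = v := Iff.rfl

@[simp] lemma isPath_cons {u v : V} {a : E × Bool} {L : List (E × Bool)} :
    IsPath o u (a :: L) v ↔ o a = u ∧ IsPath o (o (bar a)) L v := Iff.rfl

lemma isPath_append {u v : V} {L M : List (E × Bool)} :
    IsPath o u (L ++ M) v ↔ ∃ w, IsPath o u L w ∧ IsPath o w M v := by
  induction L generalizing u with
  | nil => simp
  | cons a L ih => simp [ih, and_assoc]

lemma IsPath.append {u v w : V} {L M : List (E × Bool)} (h : IsPath o u L v)
    (h' : IsPath o v M w) : IsPath o u (L ++ M) w := isPath_append.2 ⟨v, h, h'⟩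

lemma isPath_letter (a : E × Bool) : IsPath o (o a) [a] (o (bar a)) := by simp

lemma IsPath.invRev {u v : V} {L : List (E × Bool)} (h : IsPath o u L v) :
    IsPath o v (invRev L) u := by
  induction L generalizing u with
  | nil => simpa using h.symm
  | cons a L ih =>
    rw [invRev_cons]
    refine (ih h.2).append ?_
    simp [h.1]

lemma IsPath.end_unique {u v w : V} {L : List (E × Bool)} (h : IsPath o u L v)
    (h' : IsPath o u L w) : v = w := by
  induction L generalizing u with
  | nil => exact h.symm.trans h'
  | cons a L ih => exact ih h.2 h'.2

lemma IsPath.step {u v : V} {L M : List (E × Bool)} (h : IsPath o u L v)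
    (hs : FreeGroup.Red.Step L M) : IsPath o u M v := by
  cases hs with
  | @not L₁ L₂ x b =>
    obtain ⟨w, h₁, h₂, h₃, h₄⟩ := isPath_append.1 h
    refine h₁.append ?_
    simp only [bar_mk, Bool.not_not] at h₄
    rwa [h₂] at h₄

lemma IsPath.of_red {u v : V} {L M : List (E × Bool)} (h : IsPath o u L v)
    (hs : FreeGroup.Red L M) : IsPath o u M v := by
  induction hs with
  | refl => exact h
  | tail _ hs ih => exact ih.step hs

lemma IsPath.red {u v : V} {L : List (E × Bool)} (h : IsPath o u L v) :
    IsPath o u (red L) v := h.of_red (red_red L)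

/-- Two paths starting at the same point and representing the same element of the free group
end at the same point. -/
lemma IsPath.end_unique_of_mk {u v w : V} {L M : List (E × Bool)} (h : IsPath o u L v)
    (h' : IsPath o u M w) (hm : FreeGroup.mk L = FreeGroup.mk M) : v = w := by
  have h1 := h.red
  rw [red_eq_iff.2 hm] at h1
  exact h1.end_unique h'.red

lemma IsPath.sub {o' : E' × Bool → V'} {π : V → V'} {f : E → List (E' × Bool)}
    (hf : ∀ e, IsPath o' (π (o (e, true))) (f e) (π (o (e, false)))) {u v : V}
    {L : List (E × Bool)} (h : IsPath o u L v) : IsPath o' (π u) (sub f L) (π v) := by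
  induction L generalizing u with
  | nil => simpa using congrArg π h
  | cons a L ih =>
    rw [sub_cons]
    refine IsPath.append ?_ (ih h.2)
    rcases a with ⟨e, _ | _⟩
    · rw [sub1_false, ← h.1]; exact (hf e).invRev
    · rw [sub1_true, ← h.1]; exact hf e

/-- Change of gauge along a path. -/
lemma IsPath.lab_gauge {Γ : Type*} [Group Γ] {G H : E → Γ} {k : V → Γ} {u v : V}
    {L : List (E × Bool)} (h : IsPath o u L v)
    (hg : ∀ a ∈ L, G a.1 = (k (o (a.1, true)))⁻¹ * H a.1 * k (o (a.1, false))) :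
    lab G L = (k u)⁻¹ * lab H L * k v := by
  induction L generalizing u with
  | nil => simp [show u = v from h]
  | cons a L ih =>
    simp only [List.mem_cons, forall_eq_or_imp] at hg
    rw [lab_cons, ih h.2 hg.2, lab_cons H a, ← h.1]
    have := hg.1
    rcases a with ⟨e, _ | _⟩ <;> simp at this ⊢ <;> rw [this] <;> group

end Path

/-! ### Marked graphs -/

/-- The graph with origin map `o` is marked by the edge labels `r`: the labels identify homotopy
classes of paths between any two vertices with elements of the group. -/
structure Marked {E V F : Type*} [Group F] (o : E × Bool → V) (r : E → F) : Prop where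
  surj : ∀ u v g, ∃ p, IsPath o u p v ∧ lab r p = g
  inj : ∀ u p, IsPath o u p u → lab r p = 1 → FreeGroup.mk p = 1

section Marked

variable {E V E' V' F : Type*} [Group F] {o : E × Bool → V} {r : E → F}

lemma Marked.exists_reduced (h : Marked o r) (u v : V) (g : F) :
    ∃ p, IsPath o u p v ∧ lab r p = g ∧ FreeGroup.IsReduced p := by
  obtain ⟨p, hp, hg⟩ := h.surj u v g
  exact ⟨red p, hp.red, by rw [← hg]; exact lab_eq_of_mk _ (mk_red p), isReduced_red p⟩

lemma Marked.mk_eq (h : Marked o r) {u v : V} {p q : List (E × Bool)} (hp : IsPath o u p v)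
    (hq : IsPath o u q v) (hl : lab r p = lab r q) : FreeGroup.mk p = FreeGroup.mk q := by
  have := h.inj u (p ++ invRev q) (hp.append hq.invRev) (by rw [lab_append, lab_invRev, hl]; group)
  rw [← FreeGroup.mul_mk, mk_invRev] at this
  exact mul_inv_eq_one.1 this

lemma Marked.eq_of_reduced (h : Marked o r) {u v : V} {p q : List (E × Bool)}
    (hp : IsPath o u p v) (hq : IsPath o u q v) (hl : lab r p = lab r q)
    (hpr : FreeGroup.IsReduced p) (hqr : FreeGroup.IsReduced q) : p = q :=
  eq_of_mk_eq hpr hqr (h.mk_eq hp hq hl)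

/-- Transfer of a marking along a homotopy equivalence. -/
lemma Marked.transfer {o' : E' × Bool → V'} (h : Marked o r)
    {π : E → List (E' × Bool)} {πV : V → V'} {s : E' → List (E × Bool)} {sV : V' → V}
    (hπ : ∀ e, IsPath o' (πV (o (e, true))) (π e) (πV (o (e, false))))
    (hs : ∀ e, IsPath o (sV (o' (e, true))) (s e) (sV (o' (e, false))))
    (hc : ∀ u, ∃ p, IsPath o' u p (πV (sV u)))
    (k : V' → FreeGroup E')
    (hk : ∀ e, FreeGroup.mk (sub π (s e)) =
      (k (o' (e, true)))⁻¹ * FreeGroup.of e * k (o' (e, false)))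
    (j : V → F)
    (hj : ∀ e, lab r (sub s (π e)) = (j (o (e, true)))⁻¹ * r e * j (o (e, false))) :
    Marked o' (fun e => lab r (s e)) := by
  constructor
  · intro u v g
    obtain ⟨p, hp⟩ := hc u
    obtain ⟨q, hq⟩ := hc v
    set r' : E' → F := fun e => lab r (s e) with hr'
    -- the loop at `sV u` with the right label
    obtain ⟨w, hw, hwg⟩ := h.surj (sV u) (sV v)
      (j (sV u) * ((lab r' p)⁻¹ * g * lab r' q) * (j (sV v))⁻¹)
    refine ⟨p ++ sub π w ++ invRev q, (hp.append (hw.sub hπ)).append hq.invRev, ?_⟩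
    have : lab r' (sub π w) = (j (sV u))⁻¹ * lab r w * j (sV v) := by
      rw [lab_sub]
      refine hw.lab_gauge fun a _ => ?_
      rw [hr', ← lab_sub, hj]
    rw [lab_append, lab_append, lab_invRev, this, hwg]
    group
  · intro u p hp hl
    have h1 : lab r (sub s p) = 1 := by rw [lab_sub]; exact hl
    have h2 := h.inj _ _ (hp.sub hs) h1
    have h3 : FreeGroup.mk (sub π (sub s p)) = 1 := by
      rw [mk_sub_congr π (h2.trans FreeGroup.one_eq_mk)]; rfl
    rw [sub_sub, mk_sub, hp.lab_gauge (H := FreeGroup.of) (k := k) (fun a _ => hk a.1), lab_of] at h3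
    rw [mul_eq_one_iff_eq_inv, inv_mul_eq_iff_eq_mul, mul_inv_cancel] at h3
    exact h3

end Marked

/-! ### Letter counts -/

open Classical in
/-- The number of occurrences of the edge `b`, in either orientation, in a word. -/
noncomputable def cnt {E : Type*} (b : E) (L : List (E × Bool)) : ℕ :=
  (L.map Prod.fst).count b

section Cnt

variable {E E' : Type*} (b : E)

@[simp] lemma cnt_nil : cnt b ([] : List (E × Bool)) = 0 := by simp [cnt]

@[simp] lemma cnt_append (L M : List (E × Bool)) : cnt b (L ++ M) = cnt b L + cnt b M := by
  simp [cnt]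

lemma cnt_cons (a : E × Bool) (L : List (E × Bool)) :
    cnt b (a :: L) = cnt b [a] + cnt b L := cnt_append b [a] L

@[simp] lemma cnt_singleton_self (s : Bool) : cnt b [(b, s)] = 1 := by simp [cnt]

lemma cnt_singleton_of_eq {a : E × Bool} (h : a.1 = b) : cnt b [a] = 1 := by simp [cnt, h]

lemma cnt_singleton_of_ne {a : E × Bool} (h : a.1 ≠ b) : cnt b [a] = 0 := by
  simp [cnt, h]

lemma cnt_singleton (a : E × Bool) [Decidable (a.1 = b)] : cnt b [a] = if a.1 = b then 1 else 0 := by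
  split_ifs with h
  · exact cnt_singleton_of_eq b h
  · exact cnt_singleton_of_ne b h

@[simp] lemma cnt_invRev (L : List (E × Bool)) : cnt b (invRev L) = cnt b L := by
  simp [cnt, invRev, Function.comp_def]

lemma cnt_pos {L : List (E × Bool)} : 0 < cnt b L ↔ ∃ a ∈ L, a.1 = b := by
  simp [cnt, List.count_pos_iff]

lemma cnt_sub1 (f : E' → List (E × Bool)) (a : E' × Bool) : cnt b (sub1 f a) = cnt b (f a.1) := by
  rcases a with ⟨e, _ | _⟩ <;> simp

lemma cnt_sub [Fintype E'] (f : E' → List (E × Bool)) (L : List (E' × Bool)) :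
    cnt b (sub f L) = ∑ a, cnt a L * cnt b (f a) := by
  classical
  induction L with
  | nil => simp
  | cons a L ih =>
    rw [sub_cons, cnt_append, ih, cnt_sub1]
    simp_rw [cnt_cons _ a L, add_mul, Finset.sum_add_distrib, cnt_singleton]
    simp

lemma cnt_le_of_red {L M : List (E × Bool)} (h : FreeGroup.Red L M) : cnt b M ≤ cnt b L := by
  classical
  unfold cnt
  exact List.Sublist.count_le _ (h.sublist.map _)

lemma sum_cnt [Fintype E] (L : List (E × Bool)) : ∑ b, cnt b L = L.length := by
  classical
  induction L with
  | nil => simp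
  | cons a L ih =>
    simp_rw [cnt_cons _ a L, Finset.sum_add_distrib, ih, cnt_singleton]
    simp [add_comm]

end Cnt

/-! ### Topological representatives -/

/-- A combinatorial topological representative of the automorphism `φ`: a marked graph with
origin map `o` and labels `r`, and a graph self-map given by `fV` on vertices and by the edge
paths `f` on edges, which induces `φ` up to the change of gauge `h`. -/
structure Rep {F : Type*} [Group F] (φ : MulAut F) (V E : Type*) where
  o : E × Bool → V
  r : E → F
  marked : Marked o r
  f : E → List (E × Bool)
  fV : V → V
  path : ∀ e, IsPath o (fV (o (e, true))) (f e) (fV (o (e, false)))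
  h : V → F
  rep : ∀ e, lab r (f e) = (h (o (e, true)))⁻¹ * φ (r e) * h (o (e, false))

namespace Rep

variable {F V E V' E' : Type*} [Group F] {φ : MulAut F} (R : Rep φ V E)

lemma isPath_sub {u v : V} {L : List (E × Bool)} (hL : IsPath R.o u L v) :
    IsPath R.o (R.fV u) (sub R.f L) (R.fV v) := hL.sub R.path

lemma lab_map {u v : V} {L : List (E × Bool)} (hL : IsPath R.o u L v) :
    lab R.r (sub R.f L) = (R.h u)⁻¹ * φ (lab R.r L) * R.h v := by
  rw [lab_sub, hL.lab_gauge (H := fun e => φ (R.r e)) (k := R.h) (fun a _ => R.rep a.1)]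
  congr 2
  exact (map_lab R.r φ.toMonoidHom L).symm

lemma isPath_sub1 (a : E × Bool) :
    IsPath R.o (R.fV (R.o a)) (sub1 R.f a) (R.fV (R.o (bar a))) := by
  rw [← sub_singleton]; exact R.isPath_sub (isPath_letter a)

/-- Replace a representative by another one along a homotopy equivalence of graphs. -/
def move (o' : E' × Bool → V')
    (π : E → List (E' × Bool)) (πV : V → V') (s : E' → List (E × Bool)) (sV : V' → V)
    (hπ : ∀ e, IsPath o' (πV (R.o (e, true))) (π e) (πV (R.o (e, false))))
    (hs : ∀ e, IsPath R.o (sV (o' (e, true))) (s e) (sV (o' (e, false))))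
    (hc : ∀ u, ∃ p, IsPath o' u p (πV (sV u)))
    (k : V' → FreeGroup E')
    (hk : ∀ e, FreeGroup.mk (sub π (s e)) =
      (k (o' (e, true)))⁻¹ * FreeGroup.of e * k (o' (e, false)))
    (j : V → F)
    (hj : ∀ e, lab R.r (sub s (π e)) = (j (R.o (e, true)))⁻¹ * R.r e * j (R.o (e, false)))
    (f' : E' → List (E' × Bool)) (fV' : V' → V')
    (hf' : ∀ e, IsPath o' (fV' (o' (e, true))) (f' e) (fV' (o' (e, false))))
    (m : V' → FreeGroup E')
    (hm : ∀ e, FreeGroup.mk (f' e) =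
      (m (o' (e, true)))⁻¹ * FreeGroup.mk (sub π (sub R.f (s e))) * m (o' (e, false))) :
    Rep φ V' E' where
  o := o'
  r := fun e => lab R.r (s e)
  marked := R.marked.transfer hπ hs hc k hk j hj
  f := f'
  fV := fV'
  path := hf'
  h := fun u => R.h (sV u) * j (R.fV (sV u)) * FreeGroup.lift (fun e => lab R.r (s e)) (m u)
  rep := by
    intro e
    have h1 := R.lab_map (hs e)
    have h2 : lab R.r (sub s (sub π (sub R.f (s e)))) =
        (j (R.fV (sV (o' (e, true)))))⁻¹ * lab R.r (sub R.f (s e)) *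
          j (R.fV (sV (o' (e, false)))) := by
      rw [sub_sub, lab_sub]
      exact (R.isPath_sub (hs e)).lab_gauge (H := R.r) (k := j) (fun a _ => hj a.1)
    rw [lab, hm, _root_.map_mul, _root_.map_mul, _root_.map_inv]
    change _ * lab _ _ * _ = _
    rw [← lab_sub, h2, h1]
    group

/-- Slide the vertices of a graph along paths `g x`, removing the edges in `S`. -/
def slide (S : Set E) (πV : V → V') (sV : V' → V) (hsec : ∀ u, πV (sV u) = u)
    (g : V → List (E × Bool)) (π : E → List ({e // e ∉ S} × Bool))
    (hg : ∀ x, IsPath R.o x (g x) (sV (πV x)))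
    (hgπ : ∀ x, FreeGroup.mk (sub π (g x)) = 1)
    (hπ1 : ∀ e (he : e ∉ S), π e = [(⟨e, he⟩, true)])
    (hπ : ∀ e ∈ S, IsPath (fun a : {e // e ∉ S} × Bool => πV (R.o (a.1, a.2)))
      (πV (R.o (e, true))) (π e) (πV (R.o (e, false))))
    (hj : ∀ e ∈ S, lab R.r (sub (fun e' : {e // e ∉ S} =>
        invRev (g (R.o (e', true))) ++ [(e'.1, true)] ++ g (R.o (e', false))) (π e)) =
      (lab R.r (g (R.o (e, true))))⁻¹ * R.r e * lab R.r (g (R.o (e, false))))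
    (f' : {e // e ∉ S} → List ({e // e ∉ S} × Bool))
    (hf' : ∀ e, IsPath (fun a : {e // e ∉ S} × Bool => πV (R.o (a.1, a.2)))
      (πV (R.fV (sV (πV (R.o (e.1, true)))))) (f' e) (πV (R.fV (sV (πV (R.o (e.1, false)))))))
    (hm : ∀ e, FreeGroup.mk (f' e) = FreeGroup.mk (sub π (sub R.f
        (invRev (g (R.o (e.1, true))) ++ [(e.1, true)] ++ g (R.o (e.1, false)))))) :
    Rep φ V' {e // e ∉ S} :=
  R.move (fun a => πV (R.o (a.1, a.2))) π πV
    (fun e' => invRev (g (R.o (e', true))) ++ [(e'.1, true)] ++ g (R.o (e', false))) sV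
    (by
      intro e
      by_cases he : e ∈ S
      · exact hπ e he
      · rw [hπ1 e he]; simp)
    (by
      intro e
      refine ((hg _).invRev.append ?_).append (hg _)
      simp)
    (fun u => ⟨[], (hsec u).symm⟩) (fun _ => 1)
    (by
      intro e
      rw [sub_append, sub_append, ← FreeGroup.mul_mk, ← FreeGroup.mul_mk, hgπ, sub_invRev,
        mk_invRev, hgπ, sub_singleton, sub1_true, hπ1 _ e.2]
      simp; rfl)
    (fun v => lab R.r (g v))
    (by
      intro e
      by_cases he : e ∈ S
      · exact hj e he
      · rw [hπ1 e he, sub_singleton, sub1_true, lab_append, lab_append, lab_invRev, lab_true])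
    f' (fun u => πV (R.fV (sV u))) hf' (fun _ => 1)
    (by intro e; simpa using hm e)

/-- Tightening: replace every edge image by its reduced form. -/
noncomputable def tighten : Rep φ V E where
  __ := R
  f := fun e => red (R.f e)
  path := fun e => (R.path e).red
  rep := fun e => by rw [← R.rep e]; exact lab_eq_of_mk _ (mk_red _)

/-! ### Iteration -/

/-- The `n`-th iterate of the graph map on edge words. -/
def it (n : ℕ) (L : List (E × Bool)) : List (E × Bool) := (sub R.f)^[n] L

@[simp] lemma it_zero (L : List (E × Bool)) : R.it 0 L = L := rfl

lemma it_succ (n : ℕ) (L : List (E × Bool)) : R.it (n + 1) L = sub R.f (R.it n L) :=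
  Function.iterate_succ_apply' _ _ _

lemma it_succ' (n : ℕ) (L : List (E × Bool)) : R.it (n + 1) L = R.it n (sub R.f L) :=
  Function.iterate_succ_apply _ _ _

lemma it_add (m n : ℕ) (L : List (E × Bool)) : R.it (m + n) L = R.it m (R.it n L) :=
  Function.iterate_add_apply _ _ _ _

@[simp] lemma it_nil (n : ℕ) : R.it n [] = [] := by
  induction n with
  | zero => rfl
  | succ n ih => rw [it_succ, ih]; rfl

@[simp] lemma it_append (n : ℕ) (L M : List (E × Bool)) : R.it n (L ++ M) = R.it n L ++ R.it n M := by
  induction n with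
  | zero => rfl
  | succ n ih => simp [it_succ, ih]

lemma it_invRev (n : ℕ) (L : List (E × Bool)) : R.it n (invRev L) = invRev (R.it n L) := by
  induction n with
  | zero => rfl
  | succ n ih => simp [it_succ, ih, sub_invRev]

lemma it_cons (n : ℕ) (a : E × Bool) (L : List (E × Bool)) :
    R.it n (a :: L) = R.it n [a] ++ R.it n L := R.it_append n [a] L

lemma it_eq_sub (n : ℕ) (L : List (E × Bool)) :
    R.it n L = sub (fun e => R.it n [(e, true)]) L := by
  induction n with
  | zero => exact (sub_letter L).symm
  | succ n ih =>
    rw [it_succ, ih, sub_sub]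
    refine sub_congr fun a _ => (R.it_succ _ _).symm

lemma it_bar (n : ℕ) (a : E × Bool) : R.it n [bar a] = invRev (R.it n [a]) := by
  rw [← it_invRev]; rfl

lemma length_it (n : ℕ) (a : E × Bool) : (R.it n [a]).length = (R.it n [(a.1, true)]).length := by
  rcases a with ⟨e, _ | _⟩
  · rw [show (e, false) = bar (e, true) from rfl, it_bar, FreeGroup.invRev_length]
    rfl
  · rfl

lemma isPath_it (n : ℕ) {u v : V} {L : List (E × Bool)} (hL : IsPath R.o u L v) :
    IsPath R.o (R.fV^[n] u) (R.it n L) (R.fV^[n] v) := by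
  induction n with
  | zero => exact hL
  | succ n ih =>
    rw [it_succ, Function.iterate_succ_apply', Function.iterate_succ_apply']
    exact R.isPath_sub ih

lemma mk_it_congr (n : ℕ) {L M : List (E × Bool)} (h : FreeGroup.mk L = FreeGroup.mk M) :
    FreeGroup.mk (R.it n L) = FreeGroup.mk (R.it n M) := by
  rw [it_eq_sub, R.it_eq_sub n M]; exact mk_sub_congr _ h

lemma exists_gauge (n : ℕ) : ∃ H : V → F, ∀ u v L, IsPath R.o u L v →
    lab R.r (R.it n L) = (H u)⁻¹ * (φ ^ n) (lab R.r L) * H v := by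
  induction n with
  | zero => exact ⟨fun _ => 1, by simp⟩
  | succ n ih =>
    obtain ⟨H, hH⟩ := ih
    refine ⟨fun u => φ (H u) * R.h (R.fV^[n] u), fun u v L hL => ?_⟩
    rw [it_succ, R.lab_map (R.isPath_it n hL), hH u v L hL, pow_succ', MulAut.mul_apply,
      _root_.map_mul, _root_.map_mul, _root_.map_inv]
    group

/-- Nonnegative sub-invariant weights. -/
def Wt [Fintype E] (u : E → ℝ) (μ : ℝ) : Prop :=
  (∀ e, 0 < u e) ∧ ∀ b, ∑ a, (cnt b (R.f a) : ℝ) * u a ≤ μ * u b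

/-- A set of edges which is mapped into itself. -/
def Inv (S : Set E) : Prop := ∀ e ∈ S, ∀ a ∈ R.f e, a.1 ∈ S

/-- The transition matrix of the graph map is irreducible. -/
def Irred : Prop := ∀ S : Set E, S.Nonempty → R.Inv S → S = Set.univ

end Rep

/-! ### Subdivision -/

open Classical in
/-- The edge path in the subdivided graph: the edge `e₀` is cut into `some e₀` and `none`. -/
noncomputable def cut {E : Type*} (e₀ : E) (e : E) : List (Option E × Bool) :=
  if e = e₀ then [(some e₀, true), (none, true)] else [(some e, true)]

/-- The edge of the original graph containing an edge of the subdivided graph. -/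
def uncut {E : Type*} (e₀ : E) (e : Option E) : E := e.getD e₀

/-- The words of the original graph read off in the subdivided graph. -/
def glue {E : Type*} (e : Option E) : List (E × Bool) :=
  match e with
  | some e => [(e, true)]
  | none => []

open Classical in
/-- Origins in the subdivided graph. -/
noncomputable def cutO {E V : Type*} (e₀ : E) (o : E × Bool → V) : Option E × Bool → Option V
  | (some e, true) => some (o (e, true))
  | (some e, false) => if e = e₀ then none else some (o (e, false))
  | (none, true) => none
  | (none, false) => some (o (e₀, false))

open Classical in
/-- The first piece of an oriented edge after subdivision. -/
noncomputable def cutD {E : Type*} (e₀ : E) : E × Bool → Option E × Bool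
  | (e, true) => (some e, true)
  | (e, false) => if e = e₀ then (none, false) else (some e, false)

section Cut

variable {E V : Type*} (e₀ : E) (o : E × Bool → V)

lemma cut_self : cut e₀ e₀ = [(some e₀, true), (none, true)] := by simp [cut]

lemma cut_of_ne {e : E} (h : e ≠ e₀) : cut e₀ e = [(some e, true)] := by simp [cut, h]

lemma cutO_cutD (a : E × Bool) : cutO e₀ o (cutD e₀ a) = some (o a) := by
  rcases a with ⟨e, _ | _⟩
  · by_cases h : e = e₀ <;> simp [cutD, cutO, h]
  · simp [cutD, cutO]

lemma cutO_bar_cutD_of_ne {a : E × Bool} (h : a.1 ≠ e₀) :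
    cutO e₀ o (bar (cutD e₀ a)) = some (o (bar a)) := by
  rcases a with ⟨e, _ | _⟩
  · simp only at h
    simp [cutD, cutO, h]
  · simp only at h
    simp [cutD, cutO, h]

lemma cutO_bar_cutD_of_eq {a : E × Bool} (h : a.1 = e₀) :
    cutO e₀ o (bar (cutD e₀ a)) = none := by
  rcases a with ⟨e, _ | _⟩ <;> simp only at h <;> simp [cutD, cutO, h]

lemma cutD_injective : Function.Injective (cutD e₀) := by
  rintro ⟨e, _ | _⟩ ⟨e', _ | _⟩ h
  · by_cases h1 : e = e₀ <;> by_cases h2 : e' = e₀ <;> simp_all [cutD]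
  · by_cases h1 : e = e₀ <;> simp_all [cutD]
  · by_cases h2 : e' = e₀ <;> simp_all [cutD]
  · simp_all [cutD]

lemma cutO_eq_some {x : Option E × Bool} {v : V} (h : cutO e₀ o x = some v) :
    ∃ a, x = cutD e₀ a ∧ o a = v := by
  rcases x with ⟨_ | e, _ | _⟩
  · exact ⟨(e₀, false), by simp [cutD], by simpa [cutO] using h⟩
  · simp [cutO] at h
  · by_cases h1 : e = e₀
    · simp [cutO, h1] at h
    · exact ⟨(e, false), by simp [cutD, h1], by simpa [cutO, h1] using h⟩
  · exact ⟨(e, true), by simp [cutD], by simpa [cutO] using h⟩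

lemma cutO_eq_none {x : Option E × Bool} :
    cutO e₀ o x = none ↔ x = (some e₀, false) ∨ x = (none, true) := by
  rcases x with ⟨_ | e, _ | _⟩ <;> simp [cutO]

lemma sub1_cut (a : E × Bool) : ∃ L, sub1 (cut e₀) a = cutD e₀ a :: L := by
  rcases a with ⟨e, _ | _⟩ <;> by_cases h : e = e₀ <;> simp [cutD, cut, h, invRev]

lemma sub1_cut_of_ne {a : E × Bool} (h : a.1 ≠ e₀) : sub1 (cut e₀) a = [cutD e₀ a] := by
  rcases a with ⟨e, _ | _⟩ <;> simp only at h <;> simp [cutD, cut, h, invRev]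

lemma sub1_cut_of_eq {a : E × Bool} (h : a.1 = e₀) :
    sub1 (cut e₀) a = [cutD e₀ a, bar (cutD e₀ (bar a))] := by
  rcases a with ⟨e, _ | _⟩ <;> simp only at h <;> simp [cutD, cut, h, invRev, bar]

lemma head?_sub_cut (L : List (E × Bool)) : (sub (cut e₀) L).head? = L.head?.map (cutD e₀) := by
  cases L with
  | nil => rfl
  | cons a L =>
    obtain ⟨M, hM⟩ := sub1_cut e₀ a
    simp [hM]

lemma cnt_sub_cut (b : Option E) (L : List (E × Bool)) :
    cnt b (sub (cut e₀) L) = cnt (uncut e₀ b) L := by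
  induction L with
  | nil => simp
  | cons a L ih =>
    rw [sub_cons, cnt_append, ih, cnt_cons _ a, cnt_sub1]
    congr 1
    classical
    by_cases h : a.1 = e₀
    · rw [h, cut_self, cnt_cons, cnt_singleton, cnt_singleton, cnt_singleton, h]
      rcases b with _ | b <;> simp only [uncut] <;> split_ifs <;> grind
    · rw [cut_of_ne e₀ h, cnt_singleton, cnt_singleton]
      rcases b with _ | b <;> simp only [uncut] <;> split_ifs <;> simp_all

end Cut

namespace Rep

variable {F V E : Type*} [Group F] {φ : MulAut F} (R : Rep φ V E)

section Subdivide

variable (e₀ : E) (w₁ w₂ : List (E × Bool)) (hw : R.f e₀ = w₁ ++ w₂)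

open Classical in
/-- The edge images after subdivision. -/
noncomputable def cutF : Option E → List (Option E × Bool)
  | some e => if e = e₀ then sub (cut e₀) w₁ else sub (cut e₀) (R.f e)
  | none => sub (cut e₀) w₂

lemma exists_mid (hw : R.f e₀ = w₁ ++ w₂) : ∃ v, IsPath R.o (R.fV (R.o (e₀, true))) w₁ v ∧
    IsPath R.o v w₂ (R.fV (R.o (e₀, false))) := by
  have := R.path e₀
  rw [hw] at this
  exact isPath_append.1 this

lemma isPath_cut (e : E) : IsPath (cutO e₀ R.o) (some (R.o (e, true))) (cut e₀ e)
    (some (R.o (e, false))) := by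
  by_cases h : e = e₀
  · subst h; simp [cut_self, cutO]
  · simp [cut_of_ne e₀ h, cutO, h]

/-- Subdivide the edge `e₀` at the point of its image between `w₁` and `w₂`. -/
noncomputable def subdivide : Rep φ (Option V) (Option E) :=
  R.move (cutO e₀ R.o) (cut e₀) some glue (fun x => x.getD (R.o (e₀, false)))
    (R.isPath_cut e₀)
    (by
      rintro (_ | e)
      · simp [cutO, glue]
      · by_cases h : e = e₀ <;> simp [cutO, glue, h])
    (by
      rintro (_ | v)
      · exact ⟨[(none, true)], by simp [cutO]⟩
      · exact ⟨[], by simp⟩)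
    (fun v => if v = none then FreeGroup.of none else 1)
    (by
      rintro (_ | e)
      · simp [cutO, glue, ← FreeGroup.one_eq_mk]
      · by_cases h : e = e₀
        · subst h
          rw [glue, sub_singleton, sub1_true, cut_self]
          simp only [cutO, if_true]
          rfl
        · rw [glue, sub_singleton, sub1_true, cut_of_ne e₀ h]
          simp only [cutO, if_neg h]
          simp
          rfl)
    (fun _ => 1)
    (by
      intro e
      by_cases h : e = e₀
      · subst h
        simp [cut_self, glue]
      · simp [cut_of_ne e₀ h, glue])
    (R.cutF e₀ w₁ w₂)
    (fun x => x.elim (some (R.exists_mid e₀ w₁ w₂ hw).choose) (fun v => some (R.fV v)))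
    (by
      have hm := (R.exists_mid e₀ w₁ w₂ hw).choose_spec
      rintro (_ | e)
      · exact hm.2.sub (R.isPath_cut e₀)
      · by_cases h : e = e₀
        · subst h
          simpa [cutO, cutF] using hm.1.sub (R.isPath_cut e)
        · simpa [cutO, cutF, h] using (R.path e).sub (R.isPath_cut e₀))
    (fun v => if v = none then (FreeGroup.mk (sub (cut e₀) w₂))⁻¹ else 1)
    (by
      rintro (_ | e)
      · simp [cutO, cutF, glue, ← FreeGroup.one_eq_mk]
      · by_cases h : e = e₀
        · subst h
          simp only [cutO, cutF, glue, if_true, sub_singleton, sub1_true, hw, sub_append,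
            ← FreeGroup.mul_mk]
          simp only [reduceCtorEq, if_false]
          group
        · simp [cutO, cutF, glue, h])

lemma subdivide_o : (R.subdivide e₀ w₁ w₂ hw).o = cutO e₀ R.o := rfl

lemma subdivide_f : (R.subdivide e₀ w₁ w₂ hw).f = R.cutF e₀ w₁ w₂ := rfl

lemma subdivide_fV_some (v : V) : (R.subdivide e₀ w₁ w₂ hw).fV (some v) = some (R.fV v) := rfl

lemma sub_cutF (hw : R.f e₀ = w₁ ++ w₂) (L : List (E × Bool)) :
    sub (R.cutF e₀ w₁ w₂) (sub (cut e₀) L) = sub (cut e₀) (sub R.f L) := by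
  rw [sub_sub, sub_sub]
  congr 1
  funext e
  by_cases h : e = e₀
  · subst h
    simp [cut_self, cutF, hw]
  · simp [cut_of_ne e₀ h, cutF, h]

lemma it_subdivide (n : ℕ) (L : List (E × Bool)) :
    (R.subdivide e₀ w₁ w₂ hw).it n (sub (cut e₀) L) = sub (cut e₀) (R.it n L) := by
  induction n with
  | zero => rfl
  | succ n ih => rw [it_succ, ih, it_succ, subdivide_f, sub_cutF _ _ _ _ hw]

lemma subdivide_ne_nil (hne : ∀ e, R.f e ≠ []) (h₁ : w₁ ≠ []) (h₂ : w₂ ≠ []) (x : Option E) :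
    ∃ w, w ≠ [] ∧ (R.subdivide e₀ w₁ w₂ hw).f x = sub (cut e₀) w := by
  rcases x with _ | e
  · exact ⟨w₂, h₂, rfl⟩
  · by_cases h : e = e₀
    · exact ⟨w₁, h₁, by simp [subdivide_f, cutF, h]⟩
    · exact ⟨R.f e, hne e, by simp [subdivide_f, cutF, h]⟩

lemma sub_cut_ne_nil {L : List (E × Bool)} (h : L ≠ []) : sub (cut e₀) L ≠ [] := by
  intro h'
  have := head?_sub_cut e₀ L
  rw [h'] at this
  cases L <;> simp_all

lemma subdivide_f_ne_nil (hne : ∀ e, R.f e ≠ []) (h₁ : w₁ ≠ []) (h₂ : w₂ ≠ []) (x : Option E) :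
    (R.subdivide e₀ w₁ w₂ hw).f x ≠ [] := by
  obtain ⟨w, hw', h⟩ := R.subdivide_ne_nil e₀ w₁ w₂ hw hne h₁ h₂ x
  rw [h]
  exact sub_cut_ne_nil e₀ hw'

lemma subdivide_irred (hi : R.Irred) (hne : ∀ e, R.f e ≠ []) (h₁ : w₁ ≠ []) (h₂ : w₂ ≠ []) :
    (R.subdivide e₀ w₁ w₂ hw).Irred := by
  intro S hS hinv
  set R' := R.subdivide e₀ w₁ w₂ hw
  have key : ∀ L, (∀ a ∈ sub (cut e₀) L, a.1 ∈ S) → ∀ a ∈ L, ∀ b ∈ cut e₀ a.1, b.1 ∈ S := by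
    intro L hL a ha b hb
    by_cases h : b ∈ sub1 (cut e₀) a
    · exact hL b (by rw [mem_sub]; exact ⟨a, ha, h⟩)
    · have : bar b ∈ sub1 (cut e₀) a := by
        rcases a with ⟨e, _ | _⟩
        · rw [sub1_false, mem_invRev, bar_bar]; exact hb
        · exact (h (by simpa using hb)).elim
      exact hL (bar b) (by rw [mem_sub]; exact ⟨a, ha, this⟩)
  let T : Set E := {e | ∀ b ∈ cut e₀ e, b.1 ∈ S}
  have hT : T = Set.univ := by
    apply hi
    · obtain ⟨x, hx⟩ := hS
      obtain ⟨w, hw0, hwf⟩ := R.subdivide_ne_nil e₀ w₁ w₂ hw hne h₁ h₂ x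
      obtain ⟨a, ha⟩ := List.exists_mem_of_ne_nil _ hw0
      refine ⟨a.1, key w ?_ a ha⟩
      rw [← hwf]
      exact hinv x hx
    · intro e he
      apply key
      have : sub (cut e₀) (R.f e) = sub R'.f (cut e₀ e) := by
        have := R.sub_cutF e₀ w₁ w₂ hw [(e, true)]
        rw [sub_singleton, sub_singleton, sub1_true, sub1_true] at this
        exact this.symm
      rw [this]
      intro a ha
      obtain ⟨b, hb, hab⟩ := (mem_sub _).1 ha
      have := hinv b.1 (he b hb)
      rcases b with ⟨b, _ | _⟩
      · simp only [sub1_false] at hab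
        exact this (bar a) (mem_invRev.1 hab)
      · simp only [sub1_true] at hab
        exact this a hab
  have hT' : ∀ e, ∀ b ∈ cut e₀ e, b.1 ∈ S := fun e => by
    have : e ∈ T := hT ▸ Set.mem_univ e
    exact this
  ext x
  simp only [Set.mem_univ, iff_true]
  rcases x with _ | e
  · exact hT' e₀ (none, true) (by simp [cut_self])
  · by_cases h : e = e₀
    · subst h; exact hT' e (some e, true) (by simp [cut_self])
    · exact hT' e (some e, true) (by simp [cut_of_ne e₀ h])

lemma subdivide_wt [Fintype E] {u : E → ℝ} {μ : ℝ} (hu : R.Wt u μ) :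
    (R.subdivide e₀ w₁ w₂ hw).Wt (fun x => u (uncut e₀ x)) μ := by
  classical
  refine ⟨fun e => hu.1 _, fun b => ?_⟩
  rw [Fintype.sum_option]
  refine le_trans (le_of_eq ?_) (hu.2 (uncut e₀ b))
  simp only [subdivide_f, cutF, cnt_sub_cut]
  have h2 : ∀ e, (cnt b (if e = e₀ then sub (cut e₀) w₁ else sub (cut e₀) (R.f e)) : ℝ) *
      u (uncut e₀ (some e)) = (cnt (uncut e₀ b) (R.f e) : ℝ) * u e -
        if e = e₀ then (cnt (uncut e₀ b) w₂ : ℝ) * u e₀ else 0 := by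
    intro e
    by_cases h : e = e₀
    · subst h
      simp [cnt_sub_cut, hw, uncut]
      ring
    · simp [h, cnt_sub_cut, uncut]
  rw [Finset.sum_congr rfl fun e _ => h2 e]
  rw [Finset.sum_sub_distrib]
  simp [uncut]

end Subdivide

end Rep

/-! ### Identifications and collapses -/

lemma mk_invRev_append {E : Type*} (L : List (E × Bool)) :
    FreeGroup.mk (invRev L ++ L) = 1 := by
  rw [← FreeGroup.mul_mk, mk_invRev, inv_mul_cancel]

lemma mk_sub_cancel {E E' : Type*} (f : E → List (E' × Bool)) {A B C : List (E × Bool)}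
    (hA : FreeGroup.mk (sub f A) = 1) (hC : FreeGroup.mk (sub f C) = 1) :
    FreeGroup.mk (sub f (invRev A ++ B ++ C)) = FreeGroup.mk (sub f B) := by
  rw [sub_append, sub_append, ← FreeGroup.mul_mk, ← FreeGroup.mul_mk, sub_invRev, mk_invRev, hA,
    hC]
  simp

namespace Rep

variable {F V E V' : Type*} [Group F] {φ : MulAut F} (R : Rep φ V E)

/-- The data of a slide move. -/
structure Slide (S : Set E) (V' : Type*) where
  πV : V → V'
  sV : V' → V
  hsec : ∀ u, πV (sV u) = u
  g : V → List (E × Bool)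
  π : E → List ({e // e ∉ S} × Bool)
  hg : ∀ x, IsPath R.o x (g x) (sV (πV x))
  hgπ : ∀ x, FreeGroup.mk (sub π (g x)) = 1
  hπ1 : ∀ e (he : e ∉ S), π e = [(⟨e, he⟩, true)]
  hπ : ∀ e ∈ S, IsPath (fun a : {e // e ∉ S} × Bool => πV (R.o (a.1, a.2)))
      (πV (R.o (e, true))) (π e) (πV (R.o (e, false)))
  hj : ∀ e ∈ S, lab R.r (sub (fun e' : {e // e ∉ S} =>
        invRev (g (R.o (e', true))) ++ [(e'.1, true)] ++ g (R.o (e', false))) (π e)) =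
      (lab R.r (g (R.o (e, true))))⁻¹ * R.r e * lab R.r (g (R.o (e, false)))

variable {R} {S : Set E} (D : R.Slide S V')

lemma Slide.isPath_π (e : E) : IsPath (fun a : {e // e ∉ S} × Bool => D.πV (R.o (a.1, a.2)))
    (D.πV (R.o (e, true))) (D.π e) (D.πV (R.o (e, false))) := by
  by_cases he : e ∈ S
  · exact D.hπ e he
  · rw [D.hπ1 e he]; simp

/-- The slide move for which the new edge images are the projections of the old ones. -/
def Slide.proj (h : ∀ x, FreeGroup.mk (sub D.π (sub R.f (D.g x))) = 1) :
    Rep φ V' {e // e ∉ S} :=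
  R.slide S D.πV D.sV D.hsec D.g D.π D.hg D.hgπ D.hπ1 D.hπ D.hj (fun e => sub D.π (R.f e))
    (by
      have key : ∀ x, D.πV (R.fV (D.sV (D.πV x))) = D.πV (R.fV x) := by
        intro x
        have h1 := (R.isPath_sub (D.hg x)).sub D.isPath_π
        exact h1.end_unique_of_mk (M := []) (isPath_nil.2 rfl)
          ((h x).trans FreeGroup.one_eq_mk)
      intro e
      rw [key, key]
      exact (R.path e).sub D.isPath_π)
    (by
      intro e
      rw [sub_sub, mk_sub_cancel]
      · rw [sub_singleton, sub1_true]
      · rw [← sub_sub]; exact h _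
      · rw [← sub_sub]; exact h _)

/-- The slide move for which the new edge images are computed by sliding along. -/
def Slide.full : Rep φ V' {e // e ∉ S} :=
  R.slide S D.πV D.sV D.hsec D.g D.π D.hg D.hgπ D.hπ1 D.hπ D.hj
    (fun e => sub D.π (sub R.f
        (invRev (D.g (R.o (e.1, true))) ++ [(e.1, true)] ++ D.g (R.o (e.1, false)))))
    (by
      intro e
      refine (R.isPath_sub ?_).sub D.isPath_π
      exact ((D.hg _).invRev.append (isPath_letter _)).append (D.hg _))
    (fun _ => rfl)

variable (R)

section Fold

variable {a b : E × Bool} (hab : a.1 ≠ b.1)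

/-- Projection of letters under the identification of `b` with `a`. -/
noncomputable def foldL (hab : a.1 ≠ b.1) (x : E × Bool) : {e // e ∉ ({b.1} : Set E)} × Bool :=
  open Classical in
  if h : x.1 = b.1 then (if x = b then (⟨a.1, hab⟩, a.2) else (⟨a.1, hab⟩, !a.2))
  else (⟨x.1, h⟩, x.2)

lemma foldL_bar (x : E × Bool) : foldL hab (bar x) = bar (foldL hab x) := by
  unfold foldL
  by_cases h : x.1 = b.1
  · rcases eq_or_eq_bar h with rfl | rfl
    · simp [bar_ne]
    · simp [bar_ne]
  · simp [h, bar]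

lemma foldL_of_ne {x : E × Bool} (h : x.1 ∉ ({b.1} : Set E)) :
    foldL hab x = (⟨x.1, h⟩, x.2) := by
  rw [foldL, dif_neg (by simpa using h)]

lemma foldL_right : foldL hab b = (⟨a.1, hab⟩, a.2) := by
  simp [foldL]

lemma sub1_foldL (x : E × Bool) :
    sub1 (fun e => [foldL hab (e, true)]) x = [foldL hab x] := by
  rcases x with ⟨e, _ | _⟩
  · rw [show (e, false) = bar (e, true) from rfl, foldL_bar, sub1_bar]; simp
  · simp

lemma sub_foldL (L : List (E × Bool)) :
    sub (fun e => [foldL hab (e, true)]) L = L.map (foldL hab) := by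
  induction L with
  | nil => rfl
  | cons x L ih => simp [ih, sub1_foldL]

open Classical in
/-- Projection of vertices when `v` is identified with `w`. -/
noncomputable def foldV {V : Type*} {v w : V} (hvw : v ≠ w) (x : V) : {x // x ≠ v} :=
  if h : x = v then ⟨w, hvw.symm⟩ else ⟨x, h⟩

lemma foldV_of_ne {v w : V} (hvw : v ≠ w) {x : V} (h : x ≠ v) : foldV hvw x = ⟨x, h⟩ := by
  simp [foldV, h]

lemma foldV_left {v w : V} (hvw : v ≠ w) : foldV hvw v = ⟨w, hvw.symm⟩ := by
  simp [foldV]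

/-- To check a property of the edge underlying `b` it is enough to check it for `b`. -/
lemma oriented_path {E' : Type*} {o : E × Bool → V} {o' : E' × Bool → V'} {π : E → List (E' × Bool)}
    {k : V → V'} {b : E × Bool} (h : IsPath o' (k (o b)) (sub1 π b) (k (o (bar b)))) :
    IsPath o' (k (o (b.1, true))) (π b.1) (k (o (b.1, false))) := by
  rcases b with ⟨e, _ | _⟩
  · simpa [invRev_invRev] using h.invRev
  · simpa using h

lemma oriented_lab {E' : Type*} {o : E × Bool → V} {G : E' → F} {r : E → F}
    {π : E → List (E' × Bool)}
    {k : V → F} {b : E × Bool}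
    (h : lab G (sub1 π b) = (k (o b))⁻¹ * lab r [b] * k (o (bar b))) :
    lab G (π b.1) = (k (o (b.1, true)))⁻¹ * r b.1 * k (o (b.1, false)) := by
  rcases b with ⟨e, _ | _⟩
  · have := congrArg (·⁻¹) h
    simpa [lab_invRev, mul_assoc] using this
  · simpa using h

open Classical in
/-- Identification of the oriented edge `b` with the oriented edge `a`. -/
noncomputable def foldSlide (ho : R.o a = R.o b)
    (hv : R.o (bar b) ≠ R.o b) (hvw : R.o (bar b) ≠ R.o (bar a)) : R.Slide {b.1} {x // x ≠ R.o (bar b)} where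
  πV := foldV hvw
  sV := Subtype.val
  hsec := fun u => by rw [foldV_of_ne hvw u.2]
  g := fun x => if x = R.o (bar b) then [bar b, a] else []
  π := fun e => [foldL hab (e, true)]
  hg := by
    intro x
    by_cases hx : x = R.o (bar b)
    · subst hx
      simp [foldV_left, ho]
    · simp [hx, foldV_of_ne]
  hgπ := by
    intro x
    by_cases hx : x = R.o (bar b)
    · rw [if_pos hx, sub_foldL]
      simp only [List.map_cons, List.map_nil, foldL_bar, foldL_right, foldL_of_ne hab hab]
      exact mk_invRev_append [_]
    · rw [if_neg hx]; exact FreeGroup.one_eq_mk.symm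
  hπ1 := fun e he => by rw [foldL_of_ne hab (x := (e, true)) he]
  hπ := by
    rintro e rfl
    refine oriented_path (o := R.o) (π := fun e => [foldL hab (e, true)]) (b := b)
      (k := foldV hvw) ?_
    rw [sub1_foldL, foldL_right]
    simp only [isPath_cons, isPath_nil, bar_mk]
    refine ⟨congrArg _ ho, ?_⟩
    rw [foldV_left, foldV_of_ne hvw (x := R.o (a.1, !a.2)) hvw.symm]
    rfl
  hj := by
    rintro e rfl
    rw [lab_sub]
    refine oriented_lab (o := R.o) (π := fun e => [foldL hab (e, true)]) (b := b)
      (k := fun x => lab R.r (if x = R.o (bar b) then [bar b, a] else [])) ?_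
    rw [sub1_foldL, foldL_right]
    have h1 : lab (fun e' : {e // e ∉ ({b.1} : Set E)} => lab R.r
        (invRev (if R.o (e', true) = R.o (bar b) then [bar b, a] else []) ++ [(e'.1, true)] ++
          if R.o (e', false) = R.o (bar b) then [bar b, a] else []))
        [(⟨a.1, hab⟩, a.2)] = lab R.r [a] := by
      have h2 : R.o a ≠ R.o (bar b) := by rw [ho]; exact hv.symm
      have h3 : R.o (bar a) ≠ R.o (bar b) := hvw.symm
      rcases a with ⟨e, _ | _⟩
      · rw [lab_false, lab_false]
        simp only [bar_mk, Bool.not_false] at h3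
        simp [h2, h3]
      · rw [lab_true, lab_true]
        simp only [bar_mk, Bool.not_true] at h3
        simp [h2, h3]
    rw [h1, if_neg hv.symm, if_pos rfl, lab_cons R.r (bar b), lab_bar]
    simp

/-- The representative obtained by identifying two oriented edges with the same origin and the
same image. -/
noncomputable def fold (ho : R.o a = R.o b)
    (hv : R.o (bar b) ≠ R.o b) (hvw : R.o (bar b) ≠ R.o (bar a))
    (hf : sub1 R.f a = sub1 R.f b) : Rep φ {x // x ≠ R.o (bar b)} {e // e ∉ ({b.1} : Set E)} :=
  (R.foldSlide hab ho hv hvw).proj (by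
    intro x
    simp only [foldSlide]
    split_ifs with hx
    · simp only [sub_cons, sub1_bar, sub_nil, hf, List.append_nil, sub_append, sub_invRev]
      exact mk_invRev_append _
    · exact FreeGroup.one_eq_mk.symm)

variable (ho : R.o a = R.o b) (hv : R.o (bar b) ≠ R.o b) (hvw : R.o (bar b) ≠ R.o (bar a))
  (hf : sub1 R.f a = sub1 R.f b)

lemma fold_f (e : {e // e ∉ ({b.1} : Set E)}) :
    (R.fold hab ho hv hvw hf).f e = (R.f e.1).map (foldL hab) := sub_foldL hab _

lemma fold_o (x : {e // e ∉ ({b.1} : Set E)} × Bool) :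
    (R.fold hab ho hv hvw hf).o x = foldV hvw (R.o (x.1.1, x.2)) := rfl

lemma foldL_surj (x : {e // e ∉ ({b.1} : Set E)} × Bool) : foldL hab (x.1.1, x.2) = x := by
  rw [foldL_of_ne hab (x := (x.1.1, x.2)) x.1.2]

lemma sub1_fold (x : E × Bool) :
    sub1 (R.fold hab ho hv hvw hf).f (foldL hab x) = (sub1 R.f x).map (foldL hab) := by
  have key : ∀ x : E × Bool, x.1 ≠ b.1 → sub1 (R.fold hab ho hv hvw hf).f (foldL hab x) =
      (sub1 R.f x).map (foldL hab) := by
    intro x h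
    rw [foldL_of_ne hab h, ← sub_foldL hab, ← sub1_sub]
    rcases x with ⟨e, _ | _⟩
    · simp only [sub1_false, fold_f, sub_foldL]
    · simp only [sub1_true, fold_f, sub_foldL]
  by_cases h : x.1 = b.1
  · have h2 := key a hab
    rw [foldL_of_ne hab hab, hf] at h2
    rcases eq_or_eq_bar h with rfl | rfl
    · rw [foldL_right, h2]
    · rw [foldL_bar, foldL_right, sub1_bar, h2, sub1_bar, ← sub_foldL hab, ← sub_foldL hab,
        sub_invRev]
  · exact key x h

lemma fold_irred (hi : R.Irred) : (R.fold hab ho hv hvw hf).Irred := by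
  intro S hS hinv
  have hq : ∀ x : E × Bool, (foldL hab x).1 = (foldL hab (x.1, true)).1 := by
    rintro ⟨e, _ | _⟩
    · rw [show (e, false) = bar (e, true) from rfl, foldL_bar]; rfl
    · rfl
  have hinv' : ∀ x, x.1 ∈ S → ∀ y ∈ sub1 (R.fold hab ho hv hvw hf).f x, y.1 ∈ S := by
    rintro ⟨e, _ | _⟩ hx y hy
    · rw [sub1_false] at hy
      exact hinv e hx (bar y) (mem_invRev.1 hy)
    · rw [sub1_true] at hy
      exact hinv e hx y hy
  have := hi {e | (foldL hab (e, true)).1 ∈ S} ?_ ?_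
  · ext x
    simp only [Set.mem_univ, iff_true]
    have h1 : x.1 ∈ {e | (foldL hab (e, true)).1 ∈ S} := this ▸ Set.mem_univ _
    simpa [foldL_of_ne hab (x := (x.1, true)) x.2] using h1
  · obtain ⟨x, hx⟩ := hS
    refine ⟨x.1, ?_⟩
    simpa [foldL_of_ne hab (x := (x.1, true)) x.2] using hx
  · intro e he y hy
    have h2 := hinv' _ he (foldL hab y) (by
      rw [sub1_fold, sub1_true]; exact List.mem_map_of_mem hy)
    rwa [hq] at h2

lemma cnt_map_foldL [Fintype E] (b' : {e // e ∉ ({b.1} : Set E)}) (L : List (E × Bool)) :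
    cnt b' (L.map (foldL hab)) =
      cnt b'.1 L + (open Classical in if b'.1 = a.1 then cnt b.1 L else 0) := by
  classical
  induction L with
  | nil => simp
  | cons x L ih =>
    rw [List.map_cons, cnt_cons, ih, cnt_cons _ x, cnt_cons b.1 x]
    have : cnt b' [foldL hab x] = cnt b'.1 [x] + if b'.1 = a.1 then cnt b.1 [x] else 0 := by
      have hb' : b'.1 ≠ b.1 := b'.2
      by_cases h : x.1 = b.1
      · have h1 : (foldL hab x).1 = ⟨a.1, hab⟩ := by
          unfold foldL; rw [dif_pos h]; split_ifs <;> rfl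
        rw [cnt_singleton, cnt_singleton, cnt_singleton, h1, h, if_neg hb'.symm]
        simp only [if_true, zero_add]
        refine if_congr ?_ rfl rfl
        rw [Subtype.ext_iff, eq_comm]
      · rw [foldL_of_ne hab (x := x) h, cnt_singleton, cnt_singleton, cnt_singleton, if_neg h]
        simp only [ite_self, add_zero]
        exact if_congr Subtype.ext_iff rfl rfl
    rw [this]
    split_ifs <;> ring

lemma sum_subtype_ne [Fintype E] (c : E) [Fintype {e // e ∉ ({c} : Set E)}] (G : E → ℝ) :
    ∑ e : {e // e ∉ ({c} : Set E)}, G e.1 = (∑ e, G e) - G c := by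
  classical
  rw [← Finset.sum_erase_eq_sub (Finset.mem_univ c)]
  refine Finset.sum_bij (fun e _ => e.1) ?_ ?_ ?_ ?_
  · intro e _; simpa using e.2
  · intro e _ e' _ h; exact Subtype.ext h
  · intro e he; exact ⟨⟨e, by simpa using he⟩, Finset.mem_univ _, rfl⟩
  · intro e _; rfl

lemma fold_wt [Fintype E] [Fintype {e // e ∉ ({b.1} : Set E)}] {u : E → ℝ} {μ : ℝ}
    (hu : R.Wt u μ) : (R.fold hab ho hv hvw hf).Wt
      (fun e => u e.1 + (open Classical in if e.1 = a.1 then u b.1 else 0)) μ := by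
  classical
  refine ⟨fun e => ?_, fun b' => ?_⟩
  · have := hu.1 e.1
    have := hu.1 b.1
    simp only
    split_ifs <;> linarith
  · simp only [fold_f, cnt_map_foldL]
    let c : E → ℝ := fun e => ((cnt b'.1 (R.f e) + if b'.1 = a.1 then cnt b.1 (R.f e) else 0 : ℕ) : ℝ)
    have hc : c a.1 = c b.1 := by
      have : ∀ x, cnt x (R.f a.1) = cnt x (R.f b.1) := by
        intro x; rw [← cnt_sub1, hf, cnt_sub1]
      simp only [c, this]
    have h1 := sum_subtype_ne b.1 (fun e => c e * (u e + if e = a.1 then u b.1 else 0))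
    refine h1.trans_le ?_
    simp only [mul_add, Finset.sum_add_distrib]
    have h2 : ∑ e, c e * (if e = a.1 then u b.1 else 0) = c b.1 * u b.1 := by
      simp [hc]
    rw [h2, if_neg hab.symm]
    have h3 : ∑ e, c e * u e = ∑ e, (cnt b'.1 (R.f e) : ℝ) * u e +
        if b'.1 = a.1 then ∑ e, (cnt b.1 (R.f e) : ℝ) * u e else 0 := by
      simp only [c]
      split_ifs with h
      · rw [← Finset.sum_add_distrib]
        refine Finset.sum_congr rfl fun e _ => ?_
        push_cast; ring
      · simp
    rw [h3]
    have h4 := hu.2 b'.1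
    have h5 := hu.2 b.1
    split_ifs <;> simp <;> linarith

end Fold

end Rep

/-- Delete the letters of `S` from a word. -/
noncomputable def del {E : Type*} (S : Set E) (e : E) : List ({e // e ∉ S} × Bool) :=
  open Classical in if h : e ∈ S then [] else [(⟨e, h⟩, true)]

lemma sub_del_eq_nil {E : Type*} {S : Set E} {L : List (E × Bool)} (h : ∀ a ∈ L, a.1 ∈ S) :
    sub (del S) L = [] := by
  induction L with
  | nil => rfl
  | cons a L ih =>
    simp only [List.mem_cons, forall_eq_or_imp] at h
    rw [sub_cons, ih h.2]
    rcases a with ⟨e, _ | _⟩ <;> simp [del, h.1]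

lemma cnt_sub_del {E : Type*} {S : Set E} (b : {e // e ∉ S}) (L : List (E × Bool)) :
    cnt b (sub (del S) L) = cnt b.1 L := by
  classical
  induction L with
  | nil => simp
  | cons a L ih =>
    rw [sub_cons, cnt_append, ih, cnt_cons _ a, cnt_sub1, del]
    split_ifs with h
    · rw [cnt_nil, cnt_singleton_of_ne]
      intro hb
      exact b.2 (hb ▸ h)
    · rw [cnt_singleton, cnt_singleton]
      congr 1
      exact if_congr Subtype.ext_iff rfl rfl

namespace Rep

variable {F V E V' : Type*} [Group F] {φ : MulAut F} (R : Rep φ V E)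

section Collapse

variable {c : E × Bool}

open Classical in
/-- Slide the origin of `c` along `c`, collapsing `c`. -/
noncomputable def collapseSlide (hc : R.o c ≠ R.o (bar c)) : R.Slide {c.1} {x // x ≠ R.o c} where
  πV := foldV hc
  sV := Subtype.val
  hsec := fun u => by rw [foldV_of_ne hc u.2]
  g := fun x => if x = R.o c then [c] else []
  π := del {c.1}
  hg := by
    intro x
    by_cases hx : x = R.o c
    · subst hx
      simp [foldV_left]
    · simp [hx, foldV_of_ne]
  hgπ := by
    intro x
    by_cases hx : x = R.o c
    · rw [if_pos hx, sub_del_eq_nil (by simp)]; exact FreeGroup.one_eq_mk.symm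
    · rw [if_neg hx]; exact FreeGroup.one_eq_mk.symm
  hπ1 := fun e he => by rw [del, dif_neg he]
  hπ := by
    rintro e rfl
    refine oriented_path (o := R.o) (π := del {c.1}) (b := c) (k := foldV hc) ?_
    rw [← sub_singleton, sub_del_eq_nil (by simp), isPath_nil, foldV_left, foldV_of_ne hc hc.symm]
  hj := by
    rintro e rfl
    rw [lab_sub]
    refine oriented_lab (o := R.o) (π := del {c.1}) (b := c)
      (k := fun x => lab R.r (if x = R.o c then [c] else [])) ?_
    rw [← sub_singleton, sub_del_eq_nil (by simp), if_pos rfl, if_neg hc.symm]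
    simp

/-- The representative obtained by collapsing the nonloop edge `c`. -/
noncomputable def collapse (hc : R.o c ≠ R.o (bar c)) :
    Rep φ {x // x ≠ R.o c} {e // e ∉ ({c.1} : Set E)} :=
  (R.collapseSlide hc).full

open Classical in
lemma collapse_wt (hc : R.o c ≠ R.o (bar c)) [Fintype E] [Fintype {e // e ∉ ({c.1} : Set E)}]
    {u : E → ℝ} {μ κ : ℝ} (hu : ∀ e, e ≠ c.1 → 0 < u e)
    (hκ : ∑ e, (if e = c.1 then 0 else ((if R.o (e, true) = R.o c then 1 else 0) +
      (if R.o (e, false) = R.o c then 1 else 0)) * u e) ≤ κ)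
    (h : ∀ b, b ≠ c.1 → ∑ e, (if e = c.1 then 0 else (cnt b (R.f e) : ℝ) * u e) +
      cnt b (R.f c.1) * κ ≤ μ * u b) :
    (R.collapse hc).Wt (fun e => u e.1) μ := by
  refine ⟨fun e => hu e.1 e.2, fun b' => le_trans ?_ (h b'.1 b'.2)⟩
  have hg : ∀ x, cnt b'.1 (sub R.f (if x = R.o c then [c] else [])) =
      (if x = R.o c then 1 else 0) * cnt b'.1 (R.f c.1) := by
    intro x
    split_ifs
    · rw [sub_singleton, cnt_sub1, one_mul]
    · simp
  have hf : ∀ e : {e // e ∉ ({c.1} : Set E)}, cnt b' ((R.collapse hc).f e) =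
      (if R.o (e.1, true) = R.o c then 1 else 0) * cnt b'.1 (R.f c.1) + cnt b'.1 (R.f e.1) +
      (if R.o (e.1, false) = R.o c then 1 else 0) * cnt b'.1 (R.f c.1) := by
    intro e
    change cnt b' (sub (del {c.1}) (sub R.f (invRev (if R.o (e.1, true) = R.o c then [c] else [])
      ++ [(e.1, true)] ++ (if R.o (e.1, false) = R.o c then [c] else [])))) = _
    rw [cnt_sub_del, sub_append, sub_append, cnt_append, cnt_append, sub_invRev, cnt_invRev, hg, hg,
      sub_singleton, cnt_sub1]
  have h1 := sum_subtype_ne c.1 (fun e => (((if R.o (e, true) = R.o c then 1 else 0) *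
    cnt b'.1 (R.f c.1) + cnt b'.1 (R.f e) +
      (if R.o (e, false) = R.o c then 1 else 0) * cnt b'.1 (R.f c.1) : ℕ) : ℝ) * u e)
  simp only [hf]
  refine h1.trans_le ?_
  refine le_trans ?_ (add_le_add_right (mul_le_mul_of_nonneg_left hκ (Nat.cast_nonneg _)) _)
  rw [Finset.mul_sum, ← Finset.sum_add_distrib, sub_le_iff_le_add]
  rw [← Finset.sum_erase_add _ _ (Finset.mem_univ c.1), ← Finset.sum_erase_add (a := c.1) (s := Finset.univ)
    (f := fun e => _ + _) (Finset.mem_univ c.1)]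
  simp only [if_true, mul_zero, add_zero]
  refine add_le_add_left (Finset.sum_le_sum fun e he => le_of_eq ?_) _
  rw [if_neg (Finset.ne_of_mem_erase he), if_neg (Finset.ne_of_mem_erase he)]
  push_cast
  ring

end Collapse

section Forest

variable {S : Set E}

/-- Being joined by a path in `S`. -/
def forestSetoid (S : Set E) : Setoid V where
  r x y := ∃ p, IsPath R.o x p y ∧ ∀ a ∈ p, a.1 ∈ S
  iseqv := ⟨fun x => ⟨[], by simp⟩,
    fun ⟨p, hp, h⟩ => ⟨invRev p, hp.invRev, fun a ha => h (bar a) (mem_invRev.1 ha)⟩,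
    fun ⟨p, hp, h⟩ ⟨q, hq, h'⟩ => ⟨p ++ q, hp.append hq, fun a ha =>
      (List.mem_append.1 ha).elim (h a) (h' a)⟩⟩

lemma exists_forest_path (x : V) : ∃ p,
    IsPath R.o x p (Quotient.mk (R.forestSetoid S) x).out ∧ ∀ a ∈ p, a.1 ∈ S :=
  (R.forestSetoid S).iseqv.symm (Quotient.mk_out (s := R.forestSetoid S) x)

/-- Collapse of an invariant forest, as a slide. -/
noncomputable def forestSlide
    (hS : ∀ x p, IsPath R.o x p x → (∀ a ∈ p, a.1 ∈ S) → FreeGroup.mk p = 1) :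
    R.Slide S (Quotient (R.forestSetoid S)) where
  πV := Quotient.mk _
  sV := Quotient.out
  hsec := Quotient.out_eq
  g := fun x => (R.exists_forest_path (S := S) x).choose
  π := del S
  hg := fun x => (R.exists_forest_path (S := S) x).choose_spec.1
  hgπ := by
    intro x
    rw [sub_del_eq_nil (R.exists_forest_path (S := S) x).choose_spec.2]
    exact FreeGroup.one_eq_mk.symm
  hπ1 := fun e he => by rw [del, dif_neg he]
  hπ := by
    intro e he
    rw [del, dif_pos he, isPath_nil]
    exact Quotient.sound (s := R.forestSetoid S) ⟨[(e, true)], by simp, by simpa using he⟩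
  hj := by
    intro e he
    rw [del, dif_pos he]
    obtain ⟨h1, h2⟩ := (R.exists_forest_path (S := S) (R.o (e, true))).choose_spec
    obtain ⟨h3, h4⟩ := (R.exists_forest_path (S := S) (R.o (e, false))).choose_spec
    set p := (R.exists_forest_path (S := S) (R.o (e, true))).choose
    set q := (R.exists_forest_path (S := S) (R.o (e, false))).choose
    have he' : Quotient.mk (R.forestSetoid S) (R.o (e, true)) =
      Quotient.mk (R.forestSetoid S) (R.o (e, false)) :=
      Quotient.sound (s := R.forestSetoid S) ⟨[(e, true)], by simp, by simpa using he⟩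
    have h5 := hS _ (invRev p ++ [(e, true)] ++ q)
      ((h1.invRev.append (isPath_letter _)).append (he' ▸ h3)) (by
        intro a ha
        simp only [List.mem_append, List.mem_singleton] at ha
        rcases ha with (ha | rfl) | ha
        · exact h2 (bar a) (mem_invRev.1 ha)
        · exact he
        · exact h4 a ha)
    have h6 := lab_eq_of_mk R.r (h5.trans FreeGroup.one_eq_mk)
    rw [lab_append, lab_append, lab_invRev, lab_true, lab_nil] at h6
    rw [h6]; simp

/-- The representative obtained by collapsing an invariant forest. -/
noncomputable def forest (hinv : R.Inv S)
    (hS : ∀ x p, IsPath R.o x p x → (∀ a ∈ p, a.1 ∈ S) → FreeGroup.mk p = 1) :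
    Rep φ (Quotient (R.forestSetoid S)) {e // e ∉ S} :=
  (R.forestSlide hS).proj (by
    intro x
    have h := (R.exists_forest_path (S := S) x).choose_spec.2
    have : ∀ a ∈ sub R.f (R.exists_forest_path (S := S) x).choose, a.1 ∈ S := by
      intro a ha
      obtain ⟨b, hb, hab⟩ := (mem_sub _).1 ha
      have := hinv b.1 (h b hb)
      rcases b with ⟨e, _ | _⟩
      · rw [sub1_false, mem_invRev] at hab
        exact this (bar a) hab
      · rw [sub1_true] at hab
        exact this a hab
    change FreeGroup.mk (sub (del S) (sub R.f (R.exists_forest_path (S := S) x).choose)) = 1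
    rw [sub_del_eq_nil this]
    exact FreeGroup.one_eq_mk.symm)

lemma forest_wt (hinv : R.Inv S)
    (hS : ∀ x p, IsPath R.o x p x → (∀ a ∈ p, a.1 ∈ S) → FreeGroup.mk p = 1)
    [Fintype E] [Fintype {e // e ∉ S}] {u : E → ℝ} {μ : ℝ} (hu : R.Wt u μ) :
    (R.forest hinv hS).Wt (fun e => u e.1) μ := by
  classical
  refine ⟨fun e => hu.1 e.1, fun b => le_trans ?_ (hu.2 b.1)⟩
  have hf : ∀ e : {e // e ∉ S}, cnt b ((R.forest hinv hS).f e) = cnt b.1 (R.f e.1) :=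
    fun e => cnt_sub_del b _
  simp only [hf]
  rw [← Finset.sum_image (s := (Finset.univ : Finset {e // e ∉ S})) (g := Subtype.val)
    (f := fun e => (cnt b.1 (R.f e) : ℝ) * u e) (fun _ _ _ _ h => Subtype.ext h)]
  exact Finset.sum_le_sum_of_subset_of_nonneg (Finset.subset_univ _)
    fun e _ _ => mul_nonneg (Nat.cast_nonneg _) (hu.1 e).le

end Forest

end Rep

/-! ### Residual finiteness of free groups and its consequences -/

lemma exists_perm_of_rel {X : Type*} [Finite X] (r : X → X → Prop)
    (h1 : ∀ x y z, r x y → r x z → y = z) (h2 : ∀ x y z, r x z → r y z → x = y) :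
    ∃ σ : Equiv.Perm X, ∀ x y, r x y → σ x = y := by
  classical
  cases nonempty_fintype X
  let f : X → X := fun x => if h : ∃ y, r x y then h.choose else x
  have hf : ∀ x y, r x y → f x = y := by
    intro x y hxy
    have h : ∃ y, r x y := ⟨y, hxy⟩
    simp only [f, dif_pos h]
    exact h1 x _ _ h.choose_spec hxy
  obtain ⟨g, hg⟩ := Set.MapsTo.exists_equiv_extend_of_card_eq (α := X) (β := X)
    (t := Finset.univ) rfl (s := {x | ∃ y, r x y}) (f := f) (fun _ _ => by simp) (by
      rintro x ⟨y, hy⟩ x' ⟨y', hy'⟩ h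
      rw [hf _ _ hy, hf _ _ hy'] at h
      exact h2 x x' y' (h ▸ hy) hy')
  refine ⟨g.trans (Equiv.subtypeUnivEquiv (by simp)), fun x y h => ?_⟩
  rw [← hf x y h, ← hg x ⟨y, h⟩]
  rfl

/-- Free groups are residually finite. -/
lemma exists_finite_quotient {α : Type*} {w : FreeGroup α} (hw : w ≠ 1) :
    ∃ (n : ℕ) (q : FreeGroup α →* Equiv.Perm (Fin n)), q w ≠ 1 := by
  classical
  set L := w.toWord with hL
  have hred : FreeGroup.IsReduced L := FreeGroup.isReduced_toWord
  have hchain := List.isChain_iff_getElem.1 hred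
  set n := L.length with hn
  have hn0 : 0 < n := by
    rw [hn, List.length_pos_iff]
    intro h
    exact hw (FreeGroup.toWord_eq_nil_iff.1 h)
  have key : ∀ x : α, ∃ σ : Equiv.Perm (Fin (n + 1)), ∀ (i : ℕ) (hi : i < n),
      (L[i] = (x, true) → σ ⟨i + 1, by omega⟩ = ⟨i, by omega⟩) ∧
      (L[i] = (x, false) → σ ⟨i, by omega⟩ = ⟨i + 1, by omega⟩) := by
    intro x
    obtain ⟨σ, hσ⟩ := exists_perm_of_rel (X := Fin (n + 1)) (fun j k => ∃ i, ∃ hi : i < n,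
      (L[i] = (x, true) ∧ j.1 = i + 1 ∧ k.1 = i) ∨ (L[i] = (x, false) ∧ j.1 = i ∧ k.1 = i + 1))
      (by
        rintro j k k' ⟨i, hi, h | h⟩ ⟨i', hi', h' | h'⟩
        · ext; omega
        · have h3 : i' = i + 1 := by omega
          subst h3
          have := hchain i (by omega)
          rw [h.1, h'.1] at this; simp at this
        · have h3 : i = i' + 1 := by omega
          subst h3
          have := hchain i' (by omega)
          rw [h.1, h'.1] at this; simp at this
        · ext; omega)
      (by
        rintro j k k' ⟨i, hi, h | h⟩ ⟨i', hi', h' | h'⟩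
        · ext; omega
        · have h3 : i = i' + 1 := by omega
          subst h3
          have := hchain i' (by omega)
          rw [h.1, h'.1] at this; simp at this
        · have h3 : i' = i + 1 := by omega
          subst h3
          have := hchain i (by omega)
          rw [h.1, h'.1] at this; simp at this
        · ext; omega)
    exact ⟨σ, fun i hi => ⟨fun h => hσ _ _ ⟨i, hi, Or.inl ⟨h, rfl, rfl⟩⟩,
      fun h => hσ _ _ ⟨i, hi, Or.inr ⟨h, rfl, rfl⟩⟩⟩⟩
  choose σ hσ using key
  refine ⟨n + 1, FreeGroup.lift σ, fun h => ?_⟩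
  have hact : ∀ i (hi : i ≤ n), lab σ (L.drop i) ⟨n, by omega⟩ = ⟨i, by omega⟩ := by
    intro i hi
    induction hi using Nat.decreasingInduction with
    | self => simp [hn]
    | of_succ i hi ih =>
      rw [List.drop_eq_getElem_cons hi, lab_cons, Equiv.Perm.mul_apply, ih]
      rcases hl : L[i] with ⟨x, _ | _⟩
      · rw [lab_false, Equiv.Perm.inv_eq_iff_eq]
        exact ((hσ x i hi).2 hl).symm
      · rw [lab_true]
        exact (hσ x i hi).1 hl
  have h0 := hact 0 (by omega)
  rw [List.drop_zero, lab, hL, FreeGroup.mk_toWord, h] at h0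
  simp only [Equiv.Perm.one_apply, Fin.mk.injEq] at h0
  omega

/-- An automorphism of a finitely generated free group mapping a retract into itself maps it
onto itself. -/
lemma map_eq_of_retract {α : Type*} [Finite α] (ψ : MulAut (FreeGroup α))
    (ρ : FreeGroup α →* FreeGroup α) (hρ : ∀ g, ρ (ρ g) = ρ g) (hψ : ∀ g, ρ (ψ (ρ g)) = ψ (ρ g)) :
    ρ.range.map (ψ : FreeGroup α →* FreeGroup α) = ρ.range := by
  apply le_antisymm
  · rintro _ ⟨_, ⟨g, rfl⟩, rfl⟩
    exact ⟨_, hψ g⟩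
  rintro _ ⟨g, rfl⟩
  set a := ρ g with ha
  by_contra hcon
  have hne : a⁻¹ * ψ (ρ (ψ⁻¹ a)) ≠ 1 := by
    intro h
    refine hcon ⟨ρ (ψ⁻¹ a), ⟨_, rfl⟩, ?_⟩
    exact (inv_mul_eq_one.1 h).symm
  obtain ⟨n, q, hq⟩ := exists_finite_quotient hne
  have : Finite (FreeGroup α →* Equiv.Perm (Fin n)) :=
    Finite.of_equiv _ (FreeGroup.lift (α := α) (β := Equiv.Perm (Fin n)))
  let X := {h : FreeGroup α →* Equiv.Perm (Fin n) // h.comp ρ = h}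
  let Φ : X → X := fun h => ⟨(h.1.comp (ψ : FreeGroup α →* FreeGroup α)).comp ρ, by
    ext x; simp [hρ]⟩
  have hsurj : Function.Surjective Φ := by
    intro k
    have hk : ∀ x, k.1 (ρ x) = k.1 x := fun x => DFunLike.congr_fun k.2 x
    refine ⟨⟨(k.1.comp ((ψ⁻¹ : MulAut (FreeGroup α)) : FreeGroup α →* FreeGroup α)).comp ρ, ?_⟩, ?_⟩
    · refine MonoidHom.ext fun x => ?_
      simp [hρ]
    · refine Subtype.ext (MonoidHom.ext fun x => ?_)
      change k.1 (ψ⁻¹ (ρ (ψ (ρ x)))) = k.1 x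
      rw [hψ, MulAut.inv_apply_self, hk]
  have hinj := Finite.injective_iff_surjective.2 hsurj
  let h₁ : X := ⟨q.comp ρ, MonoidHom.ext fun x => by simp [hρ]⟩
  let h₂ : X := ⟨(q.comp ((ψ : FreeGroup α →* FreeGroup α).comp (ρ.comp
    ((ψ⁻¹ : MulAut (FreeGroup α)) : FreeGroup α →* FreeGroup α)))).comp ρ,
    MonoidHom.ext fun x => by simp [hρ]⟩
  have h12 : Φ h₁ = Φ h₂ := by
    refine Subtype.ext (MonoidHom.ext fun x => ?_)
    change q (ρ (ψ (ρ x))) = q (ψ (ρ (ψ⁻¹ (ρ (ψ (ρ x))))))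
    rw [hψ, MulAut.inv_apply_self, hρ]
  have := DFunLike.congr_fun (congrArg Subtype.val (hinj h12)) g
  change q (ρ g) = q (ψ (ρ (ψ⁻¹ (ρ g)))) at this
  rw [← ha] at this
  apply hq
  rw [_root_.map_mul, _root_.map_inv, this, inv_mul_cancel]

/-! ### Free factors carried by subgraphs -/

section Words

variable {E Γ : Type*} [Group Γ] {r : E → Γ}

lemma lab_mem {H : Subgroup Γ} {L : List (E × Bool)} (h : ∀ a ∈ L, r a.1 ∈ H) : lab r L ∈ H := by
  induction L with
  | nil => rw [lab_nil]; exact H.one_mem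
  | cons a L ih =>
    simp only [List.mem_cons, forall_eq_or_imp] at h
    rw [lab_cons]
    refine H.mul_mem ?_ (ih h.2)
    rcases a with ⟨e, _ | _⟩
    · rw [lab_false]; exact H.inv_mem h.1
    · rw [lab_true]; exact h.1

lemma lab_eq_one {L : List (E × Bool)} (h : ∀ a ∈ L, r a.1 = 1) : lab r L = 1 := by
  have := lab_mem (H := ⊥) (r := r) (L := L) (by simpa using h)
  simpa using this

/-- A short word cannot cancel a long suffix of a reduced word. -/
lemma exists_red_append_eq {P z c : List (E × Bool)} (h : FreeGroup.IsReduced (P ++ z))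
    (hc : c.length ≤ z.length) : ∃ M, red (P ++ z ++ c) = P ++ M := by
  induction c generalizing z with
  | nil => exact ⟨z, by rw [List.append_nil, red_eq_self.2 h]⟩
  | cons b c ih =>
    simp only [List.length_cons] at hc
    by_cases hb : FreeGroup.IsReduced (P ++ (z ++ [b]))
    · obtain ⟨M, hM⟩ := ih hb (by simp; omega)
      exact ⟨M, by simpa using hM⟩
    · obtain rfl | ⟨z, d, rfl⟩ := z.eq_nil_or_concat'
      · simp at hc
      have hd : b = bar d := by
        by_contra hne
        apply hb
        rw [← List.append_assoc, isReduced_append_iff]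
        refine ⟨h, by simp, ?_⟩
        rw [← List.append_assoc]
        simpa using hne
      have h' : FreeGroup.IsReduced (P ++ z) := by
        rw [← List.append_assoc] at h
        exact (isReduced_append_iff.1 h).1
      obtain ⟨M, hM⟩ := ih h' (by simp at hc; omega)
      refine ⟨M, ?_⟩
      rw [← hM, red_eq_iff, hd]
      have := @FreeGroup.Red.Step.not _ (P ++ z) c d.1 d.2
      have h2 : FreeGroup.mk _ = FreeGroup.mk _ := _root_.Quot.sound this
      simpa [bar] using h2

end Words

section FreeFactor

variable {F V E : Type*} [Group F] {o : E × Bool → V} {r : E → F}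

/-- The subgroup carried by the closed paths at `x` in the subgraph `S`. -/
def carried (o : E × Bool → V) (r : E → F) (S : Set E) (x : V) : Subgroup F where
  carrier := {g | ∃ p, IsPath o x p x ∧ (∀ a ∈ p, a.1 ∈ S) ∧ lab r p = g}
  mul_mem' := by
    rintro _ _ ⟨p, hp, hpS, rfl⟩ ⟨q, hq, hqS, rfl⟩
    exact ⟨p ++ q, hp.append hq, fun a ha => (List.mem_append.1 ha).elim (hpS a) (hqS a),
      lab_append _ _ _⟩
  one_mem' := ⟨[], by simp⟩
  inv_mem' := by
    rintro _ ⟨p, hp, hpS, rfl⟩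
    exact ⟨invRev p, hp.invRev, fun a ha => hpS (bar a) (mem_invRev.1 ha), lab_invRev _ _⟩

open Classical in
lemma exists_tree (h : Marked o r) (S : Set E) (x : V) : ∃ y : V → List (E × Bool),
    y x = [] ∧ (∀ v, IsPath o x (y v) v) ∧
    (∀ v, (∃ p, IsPath o x p v ∧ ∀ a ∈ p, a.1 ∈ S) → ∀ a ∈ y v, a.1 ∈ S) ∧
    ∀ v, ∀ a ∈ y v, lab r (y (o a)) * lab r [a] = lab r (y (o (bar a))) := by
  let cost : List (E × Bool) → ℕ ×ₗ ℕ := fun p =>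
    toLex ((p.filter (fun a => a.1 ∉ S)).length, p.length)
  have hcost : ∀ p a, cost p < cost (p ++ [a]) := by
    intro p a
    simp only [cost, Prod.Lex.toLex_lt_toLex, List.filter_append, List.length_append,
      List.length_singleton]
    by_cases ha : a.1 ∈ S
    · right; simp [ha]
    · left; simp [ha]
  have hmin : ∀ v, ∃ p, IsPath o x p v ∧ ∀ q, IsPath o x q v → cost p ≤ cost q := by
    intro v
    obtain ⟨p, hp, -⟩ := h.exists_reduced x v 1
    have hwf := (inferInstance : WellFoundedLT (ℕ ×ₗ ℕ)).wf
    have hne : (cost '' {q | IsPath o x q v}).Nonempty := ⟨_, p, hp, rfl⟩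
    obtain ⟨q, hq, hq'⟩ := hwf.min_mem _ hne
    refine ⟨q, hq, fun q' hq'' => ?_⟩
    rw [hq']
    exact not_lt.1 (hwf.not_lt_min (cost '' {q | IsPath o x q v}) ⟨q', hq'', rfl⟩)
  choose P hP hPmin using hmin
  have hwf : WellFounded (fun v w : V => cost (P v) < cost (P w)) :=
    InvImage.wf (fun v => cost (P v)) (inferInstance : WellFoundedLT (ℕ ×ₗ ℕ)).wf
  have hstep : ∀ v (hv : P v ≠ []), cost (P (o ((P v).getLast hv))) < cost (P v) := by
    intro v hv
    have h1 := hP v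
    rw [← List.dropLast_append_getLast hv] at h1
    obtain ⟨w, h2, h3, h4⟩ := isPath_append.1 h1
    subst h3
    refine (hPmin _ _ h2).trans_lt ?_
    conv_rhs => rw [← List.dropLast_append_getLast hv]
    exact hcost _ _
  let y : V → List (E × Bool) := hwf.fix fun v ih =>
    if hv : P v = [] then [] else ih (o ((P v).getLast hv)) (hstep v hv) ++ [(P v).getLast hv]
  have hy : ∀ v, y v = if hv : P v = [] then [] else
      y (o ((P v).getLast hv)) ++ [(P v).getLast hv] := fun v => hwf.fix_eq _ v
  have hlast : ∀ v (hv : P v ≠ []), o (bar ((P v).getLast hv)) = v := by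
    intro v hv
    have h1 := hP v
    rw [← List.dropLast_append_getLast hv] at h1
    obtain ⟨w, h2, h3, h4⟩ := isPath_append.1 h1
    exact h4
  refine ⟨y, ?_, ?_, ?_, ?_⟩
  · rw [hy, dif_pos]
    have := hPmin x [] (by simp)
    by_contra hne
    rw [← List.dropLast_append_getLast hne] at this
    have h3 : cost [] ≤ cost (P x).dropLast := by
      simp only [cost, Prod.Lex.toLex_le_toLex, List.filter_nil, List.length_nil]
      omega
    exact absurd ((hcost _ _).trans_le this) (not_lt.2 h3)
  · intro v
    induction v using hwf.induction with
    | _ v ih =>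
    rw [hy]
    split_ifs with hv
    · have := hP v
      rwa [hv] at this
    · refine (ih _ (hstep v hv)).append ?_
      simp [hlast v hv]
  · intro v
    induction v using hwf.induction with
    | _ v ih =>
    rintro ⟨p, hp, hpS⟩
    have h1 : ∀ a ∈ P v, a.1 ∈ S := by
      have h2 := hPmin v p hp
      have h3 : (p.filter (fun a => a.1 ∉ S)).length = 0 := by
        simpa using hpS
      simp only [cost, Prod.Lex.toLex_le_toLex, h3] at h2
      have h4 : ((P v).filter (fun a => a.1 ∉ S)).length = 0 := by omega
      simpa using h4
    rw [hy]
    split_ifs with hv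
    · simp
    · intro a ha
      rcases List.mem_append.1 ha with ha | ha
      · refine ih _ (hstep v hv) ⟨(P v).dropLast, ?_, fun a ha => h1 a (List.mem_of_mem_dropLast ha)⟩ a ha
        have h1 := hP v
        rw [← List.dropLast_append_getLast hv] at h1
        obtain ⟨w, h2, h3, h4⟩ := isPath_append.1 h1
        rwa [h3]
      · rw [List.mem_singleton.1 ha]
        exact h1 _ (List.getLast_mem hv)
  · intro v
    induction v using hwf.induction with
    | _ v ih =>
    intro a ha
    rw [hy] at ha
    split_ifs at ha with hv
    · simp at ha
    · rcases List.mem_append.1 ha with ha | ha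
      · exact ih _ (hstep v hv) a ha
      · rw [List.mem_singleton.1 ha, hlast v hv, hy v, dif_neg hv, lab_append]

/-- The subgroup carried by a subgraph is a free factor. -/
lemma isFreeFactor_carried (h : Marked o r) (S : Set E) (x : V) :
    IsFreeFactor (carried o r S x) := by
  classical
  obtain ⟨y, hyx, hyp, hyS, hyt⟩ := exists_tree h S x
  let D : Set E := {e | e ∈ S ∧ ∃ p, IsPath o x p (o (e, true)) ∧ ∀ a ∈ p, a.1 ∈ S}
  let t : E → F := fun e => lab r (y (o (e, true))) * r e * (lab r (y (o (e, false))))⁻¹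
  let B : Subgroup F := Subgroup.closure (t '' Dᶜ)
  have htA : ∀ e ∈ D, t e ∈ carried o r S x := by
    rintro e ⟨heS, p, hp, hpS⟩
    have h1 := hyS _ ⟨p, hp, hpS⟩
    have h2 := hyS (o (e, false)) ⟨p ++ [(e, true)], hp.append (isPath_letter (e, true)), by
      intro a ha
      rcases List.mem_append.1 ha with ha | ha
      · exact hpS a ha
      · rw [List.mem_singleton.1 ha]; exact heS⟩
    refine ⟨y (o (e, true)) ++ [(e, true)] ++ invRev (y (o (e, false))),
      ((hyp _).append (isPath_letter (e, true))).append (hyp _).invRev, ?_, ?_⟩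
    · intro a ha
      simp only [List.mem_append, List.mem_singleton] at ha
      rcases ha with (ha | rfl) | ha
      · exact h1 a ha
      · exact heS
      · exact h2 (bar a) (mem_invRev.1 ha)
    · rw [lab_append, lab_append, lab_invRev, lab_true]
  let κ : E → Monoid.Coprod (carried o r S x) B := fun e =>
    if he : e ∈ D then Monoid.Coprod.inl ⟨t e, htA e he⟩
    else Monoid.Coprod.inr ⟨t e, Subgroup.subset_closure (Set.mem_image_of_mem t he)⟩
  let Λ := Monoid.Coprod.lift (carried o r S x).subtype B.subtype
  have hΛκ : ∀ e, Λ (κ e) = t e := by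
    intro e
    simp only [κ, Λ]
    split_ifs <;> simp
  have hκ1 : ∀ e, t e = 1 → κ e = 1 := by
    intro e he
    simp only [κ]
    split_ifs
    · rw [← map_one Monoid.Coprod.inl]; congr 1; exact Subtype.ext he
    · rw [← map_one Monoid.Coprod.inr]; congr 1; exact Subtype.ext he
  have hΛ : ∀ {u v : V} {p}, IsPath o u p v → Λ (lab κ p) = lab r (y u) * lab r p * (lab r (y v))⁻¹ := by
    intro u v p hp
    rw [map_lab]
    simp only [hΛκ]
    rw [hp.lab_gauge (H := r) (k := fun v => (lab r (y v))⁻¹) (fun a _ => by simp [t])]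
    simp
  have hκy : ∀ v, lab κ (y v) = 1 := by
    intro v
    refine lab_eq_one fun a ha => hκ1 _ ?_
    have := hyt v a ha
    rcases a with ⟨e, _ | _⟩
    · rw [lab_false] at this
      simp only [bar_mk, Bool.not_false] at this
      simp only [t, ← this]
      group
    · rw [lab_true] at this
      simp only [bar_mk, Bool.not_true] at this
      simp only [t, ← this]
      group
  choose pg hpg1 hpg2 _ using fun g => h.exists_reduced x x g
  have hθ : ∀ p, IsPath o x p x → lab κ (pg (lab r p)) = lab κ p := fun p hp =>
    lab_eq_of_mk _ (h.mk_eq (hpg1 _) hp (hpg2 _))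
  let θ : F →* Monoid.Coprod (carried o r S x) B := MonoidHom.mk' (fun g => lab κ (pg g)) (by
    intro a b
    rw [← lab_append, ← hθ _ ((hpg1 a).append (hpg1 b)), lab_append, hpg2, hpg2])
  have hΛθ : ∀ g, Λ (θ g) = g := by
    intro g
    change Λ (lab κ (pg g)) = g
    rw [hΛ (hpg1 g), hyx, hpg2]; simp
  have hD : ∀ {u v : V} {p}, IsPath o u p v → (∀ a ∈ p, a.1 ∈ S) →
      (∃ q, IsPath o x q u ∧ ∀ a ∈ q, a.1 ∈ S) → ∀ a ∈ p, a.1 ∈ D := by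
    intro u v p hp hpS hu
    induction p generalizing u with
    | nil => simp
    | cons a p ih =>
      simp only [List.mem_cons, forall_eq_or_imp] at hpS ⊢
      obtain ⟨q, hq, hqS⟩ := hu
      have hq2 : ∃ q, IsPath o x q (o (bar a)) ∧ ∀ a ∈ q, a.1 ∈ S := by
        refine ⟨q ++ [a], hq.append (by simp [hp.1]), ?_⟩
        intro b hb
        rcases List.mem_append.1 hb with hb | hb
        · exact hqS b hb
        · rw [List.mem_singleton.1 hb]; exact hpS.1
      refine ⟨⟨hpS.1, ?_⟩, ih hp.2 hpS.2 hq2⟩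
      rcases a with ⟨e, _ | _⟩
      · exact hq2
      · exact ⟨q, by rw [← hp.1] at hq; exact hq, hqS⟩
  have hθΛ : θ.comp Λ = MonoidHom.id _ := by
    apply Monoid.Coprod.hom_ext
    · ext ⟨g, hg⟩
      change θ (Λ (Monoid.Coprod.inl _)) = Monoid.Coprod.inl _
      have h1 : Λ (Monoid.Coprod.inl ⟨g, hg⟩) = g := by simp [Λ]
      rw [h1]
      obtain ⟨p, hp, hpS, rfl⟩ := hg
      change lab κ (pg (lab r p)) = _
      rw [hθ p hp]
      have h2 : lab κ p ∈ (Monoid.Coprod.inl : carried o r S x →*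
          Monoid.Coprod (carried o r S x) B).range := by
        refine lab_mem fun a ha => ?_
        have := hD hp hpS ⟨[], by simp⟩ a ha
        simp only [κ, dif_pos this]
        exact ⟨_, rfl⟩
      obtain ⟨c, hc⟩ := h2
      rw [← hc]
      congr 1
      ext
      have h3 := hΛ hp
      rw [← hc, hyx] at h3
      simpa [Λ] using h3
    · ext ⟨g, hg⟩
      change θ (Λ (Monoid.Coprod.inr _)) = Monoid.Coprod.inr _
      have h1 : Λ (Monoid.Coprod.inr ⟨g, hg⟩) = g := by simp [Λ]
      rw [h1]
      induction hg using Subgroup.closure_induction with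
      | mem g hg =>
        obtain ⟨e, he, rfl⟩ := hg
        have h2 : t e = lab r (y (o (e, true)) ++ [(e, true)] ++ invRev (y (o (e, false)))) := by
          rw [lab_append, lab_append, lab_invRev, lab_true]
        have h3 : lab κ (pg (t e)) = κ e := by
          rw [h2, hθ (y (o (e, true)) ++ [(e, true)] ++ invRev (y (o (e, false))))
            (((hyp _).append (isPath_letter (e, true))).append (hyp _).invRev),
            lab_append, lab_append, lab_invRev, hκy, hκy, lab_true, one_mul, inv_one, mul_one]
        refine h3.trans ?_
        simp only [κ]
        rw [dif_neg he]
      | one => rw [map_one]; exact (map_one Monoid.Coprod.inr).symm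
      | mul a b ha hb iha ihb =>
        rw [_root_.map_mul, iha (by simp [Λ]), ihb (by simp [Λ]), ← _root_.map_mul]; rfl
      | inv a ha iha =>
        rw [_root_.map_inv, iha (by simp [Λ]), ← _root_.map_inv]; rfl
  refine ⟨B, Function.bijective_iff_has_inverse.2 ⟨θ, fun z => ?_, hΛθ⟩⟩
  exact DFunLike.congr_fun hθΛ z

lemma exists_retraction {A : Subgroup F} (hA : IsFreeFactor A) :
    ∃ ρ : F →* F, ρ.range = A ∧ ∀ a ∈ A, ρ a = a := by
  obtain ⟨B, hB⟩ := hA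
  let e := MulEquiv.ofBijective _ hB
  let ρ : F →* F := (A.subtype.comp (Monoid.Coprod.lift (MonoidHom.id A) (1 : B →* A))).comp
    e.symm.toMonoidHom
  have h : ∀ a ∈ A, ρ a = a := by
    intro a ha
    have : e.symm a = Monoid.Coprod.inl ⟨a, ha⟩ := by
      rw [MulEquiv.symm_apply_eq]; simp [e]
    change A.subtype (Monoid.Coprod.lift (MonoidHom.id A) (1 : B →* A) (e.symm a)) = a
    rw [this]; simp
  refine ⟨ρ, le_antisymm ?_ fun a ha => ⟨a, h a ha⟩, h⟩
  rintro _ ⟨g, rfl⟩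
  exact SetLike.coe_mem _

lemma finite_of_valence [Finite E] (hval : ∀ v, ∃ a b, a ≠ b ∧ o a = v ∧ o b = v) : Finite V :=
  Finite.of_surjective o fun v => let ⟨a, _, _, h, _⟩ := hval v; ⟨a, h⟩

lemma exists_extend (hval : ∀ v, ∃ a b, a ≠ b ∧ o a = v ∧ o b = v) {u v : V}
    {P : List (E × Bool)} {a : E × Bool} (hp : IsPath o u (P ++ [a]) v)
    (hr : FreeGroup.IsReduced (P ++ [a])) (n : ℕ) :
    ∃ z w, z.length = n ∧ IsPath o u (P ++ [a] ++ z) w ∧ FreeGroup.IsReduced (P ++ [a] ++ z) := by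
  induction n with
  | zero => exact ⟨[], v, rfl, by simpa using hp, by simpa using hr⟩
  | succ n ih =>
    obtain ⟨z, w, hz, hzp, hzr⟩ := ih
    obtain ⟨Q, d, hQ⟩ : ∃ Q d, P ++ [a] ++ z = Q ++ [d] := by
      obtain rfl | ⟨z, d, rfl⟩ := z.eq_nil_or_concat'
      · exact ⟨P, a, by simp⟩
      · exact ⟨P ++ [a] ++ z, d, by simp⟩
    obtain ⟨b, c, hbc, hb, hc⟩ := hval w
    obtain ⟨b, hb, hbd⟩ : ∃ b, o b = w ∧ b ≠ bar d := by
      by_cases hbd : b = bar d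
      · exact ⟨c, hc, fun h => hbc (hbd.trans h.symm)⟩
      · exact ⟨b, hb, hbd⟩
    refine ⟨z ++ [b], o (bar b), by simp [hz], ?_, ?_⟩
    · rw [← List.append_assoc]
      exact hzp.append (by simp [hb])
    · rw [← List.append_assoc, hQ, isReduced_append_iff]
      rw [hQ] at hzr
      exact ⟨hzr, by simp, by simpa using hbd⟩

/-- A proper subgraph of a graph without vertices of valence one carries a proper subgroup. -/
lemma carried_ne_top [Finite E] (h : Marked o r)
    (hval : ∀ v, ∃ a b, a ≠ b ∧ o a = v ∧ o b = v) {S : Set E} (hS : S ≠ Set.univ) (x : V) :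
    carried o r S x ≠ ⊤ := by
  intro htop
  have := finite_of_valence hval
  cases nonempty_fintype V
  obtain ⟨e, he⟩ := (Set.ne_univ_iff_exists_notMem S).1 hS
  obtain ⟨P, a, v, ha, hp, hr⟩ : ∃ P a v, a.1 ∉ S ∧ IsPath o x (P ++ [a]) v ∧
      FreeGroup.IsReduced (P ++ [a]) := by
    obtain ⟨p, hp, -, hr⟩ := h.exists_reduced x (o (e, true)) 1
    by_cases hpe : FreeGroup.IsReduced (p ++ [(e, true)])
    · exact ⟨p, (e, true), _, he, hp.append (isPath_letter (e, true)), hpe⟩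
    · obtain rfl | ⟨z, d, rfl⟩ := p.eq_nil_or_concat'
      · simp at hpe
      refine ⟨z, d, _, ?_, hp, hr⟩
      by_contra hd
      apply hpe
      rw [isReduced_append_iff]
      refine ⟨hr, by simp, ?_⟩
      simp only [List.getLast?_append, List.getLast?_singleton, Option.some_or, Option.mem_def,
        Option.some.injEq, List.head?_cons, forall_eq']
      rintro h
      apply he
      have := congrArg Prod.fst h
      simp only [bar_fst] at this
      rwa [this]
  choose c hc _ _ using fun v => h.exists_reduced v x 1
  obtain ⟨z, w, hz, hzp, hzr⟩ := exists_extend hval hp hr (∑ v, (c v).length)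
  obtain ⟨M, hM⟩ := exists_red_append_eq (c := c w) hzr (by
    rw [hz]; exact Finset.single_le_sum (f := fun v => (c v).length) (fun _ _ => Nat.zero_le _)
      (Finset.mem_univ w))
  have hq := (hzp.append (hc w)).red
  obtain ⟨q, hq', hqS, hql⟩ : lab r (red (P ++ [a] ++ z ++ c w)) ∈ carried o r S x := htop ▸ trivial
  have h1 := h.mk_eq hq' hq hql
  have h2 := red_of_mk_eq h1 (isReduced_red _)
  have h3 : a ∈ red q := by rw [h2, hM]; simp
  exact ha (hqS a ((red_red q).sublist.subset h3))

end FreeFactor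

/-- Full irreducibility, in terms of an automorphism representing the outer class. -/
def FI {F : Type*} [Group F] (φ : MulAut F) : Prop :=
  ∀ k : ℕ, 0 < k → ∀ A : Subgroup F, IsFreeFactor A → A ≠ ⊥ → A ≠ ⊤ → ∀ g : F,
    A.map ((φ ^ k : MulAut F) : F →* F) ≠ A.map ((MulAut.conj g : MulAut F) : F →* F)

/-- An invariant proper subgraph of a representative of a fully irreducible automorphism is a
forest. -/
lemma Rep.forest_of_inv {α V E : Type*} [Finite α] {φ : MulAut (FreeGroup α)} [Finite E]
    (R : Rep φ V E) (hφ : FI φ) (hval : ∀ v, ∃ a b, a ≠ b ∧ R.o a = v ∧ R.o b = v) {S : Set E}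
    (hS : S ≠ Set.univ) (hinv : R.Inv S) (x : V) (p : List (E × Bool)) (hp : IsPath R.o x p x)
    (hpS : ∀ a ∈ p, a.1 ∈ S) : FreeGroup.mk p = 1 := by
  by_contra hne
  have hlab : lab R.r p ≠ 1 := fun h => hne
    ((R.marked.mk_eq hp (by simp : IsPath R.o x [] x) (h.trans (lab_nil _).symm)).trans
      FreeGroup.one_eq_mk.symm)
  have hitS : ∀ n q, (∀ a ∈ q, a.1 ∈ S) → ∀ a ∈ R.it n q, a.1 ∈ S := by
    intro n q hq
    induction n with
    | zero => exact hq
    | succ n ih =>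
      intro a ha
      rw [R.it_succ] at ha
      obtain ⟨b, hb, hab⟩ := (mem_sub _).1 ha
      have := hinv b.1 (ih b hb)
      rcases b with ⟨e, _ | _⟩
      · rw [sub1_false, mem_invRev] at hab
        exact this (bar a) hab
      · rw [sub1_true] at hab
        exact this a hab
  have := finite_of_valence hval
  obtain ⟨n, n', hnn', hx⟩ : ∃ n n', n < n' ∧ R.fV^[n] x = R.fV^[n'] x := by
    obtain ⟨i, j, hij, h⟩ := Finite.exists_ne_map_eq_of_infinite (fun n => R.fV^[n] x)
    rcases lt_or_gt_of_ne hij with h' | h'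
    · exact ⟨i, j, h', h⟩
    · exact ⟨j, i, h', h.symm⟩
  set x' := R.fV^[n] x with hx'
  obtain ⟨k, rfl⟩ := Nat.exists_eq_add_of_lt hnn'
  have hk : R.fV^[k + 1] x' = x' := by
    rw [hx]; conv_rhs => rw [show n + k + 1 = (k + 1) + n by omega, Function.iterate_add_apply, ← hx', hx]
  set A := carried R.o R.r S x' with hA
  have hfree : IsFreeFactor A := isFreeFactor_carried R.marked S x'
  obtain ⟨H, hH⟩ := R.exists_gauge (k + 1)
  refine hφ (k + 1) k.succ_pos A hfree ?_ (carried_ne_top R.marked hval hS x') (H x') ?_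
  · obtain ⟨G, hG⟩ := R.exists_gauge n
    intro hbot
    have h1 : lab R.r (R.it n p) ∈ A := ⟨_, R.isPath_it n hp, hitS n p hpS, rfl⟩
    rw [hbot, Subgroup.mem_bot, hG _ _ _ hp] at h1
    have h2 : (φ ^ n) (lab R.r p) = 1 := by
      have := congrArg (fun g => G x * g * (G x)⁻¹) h1
      simpa [mul_assoc] using this
    exact hlab (by simpa using h2)
  · obtain ⟨ρ, hρA, hρ⟩ := exists_retraction hfree
    have hρm : ∀ g, ρ g ∈ A := fun g => hρA ▸ ⟨g, rfl⟩
    have hψ := map_eq_of_retract ((MulAut.conj (H x'))⁻¹ * φ ^ (k + 1)) ρ (fun g => hρ _ (hρm g)) (by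
      intro g
      refine hρ _ ?_
      obtain ⟨q, hq, hqS, hql⟩ := hρm g
      refine ⟨R.it (k + 1) q, ?_, hitS _ q hqS, ?_⟩
      · have := R.isPath_it (k + 1) hq
        rwa [hk] at this
      · rw [hH _ _ _ hq, hql]
        simp)
    rw [hρA] at hψ
    conv_rhs => rw [← hψ]
    rw [Subgroup.map_map]
    congr 1
    ext g
    simp [mul_assoc]

/-! ### Bounding the size of irreducible representatives -/

section Euler

variable {F V E : Type*} [Group F] {o : E × Bool → V} {r : E → F}

lemma gauge_cancel {G : Type*} [Group G] {A B a b m c : G} (h : a * m * b⁻¹ = A * c * B⁻¹) :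
    (a⁻¹ * A)⁻¹ * m * (b⁻¹ * B) = c := by
  have h1 : c = A⁻¹ * (A * c * B⁻¹) * B := by group
  rw [h1, ← h]
  group

/-- A marked graph has at most `|V| + N` edges. -/
lemma card_edges_le {N : ℕ} [Fintype E] [Fintype V] {r : E → FreeGroup (Fin N)}
    (h : Marked o r) : Fintype.card E ≤ Fintype.card V + N := by
  classical
  rcases isEmpty_or_nonempty E with hE | ⟨⟨e₀⟩⟩
  · simp
  let x := o (e₀, true)
  let Z := Multiplicative (ZMod 2)
  let Ψ : (V → Z) × (Fin N → Z) → (E → Z) := fun k e =>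
    (k.1 (o (e, true)))⁻¹ * FreeGroup.lift k.2 (r e) * k.1 (o (e, false))
  have hΨ : Function.Surjective Ψ := by
    intro c
    choose pg hpg1 hpg2 _ using fun g => h.exists_reduced x x g
    choose y hy _ _ using fun v => h.exists_reduced x v 1
    have hm : ∀ p, IsPath o x p x → lab c (pg (lab r p)) = lab c p := fun p hp =>
      lab_eq_of_mk _ (h.mk_eq (hpg1 _) hp (hpg2 _))
    let m : FreeGroup (Fin N) →* Z := MonoidHom.mk' (fun g => lab c (pg g)) (by
      intro a b
      rw [← lab_append, ← hm _ ((hpg1 a).append (hpg1 b)), lab_append, hpg2, hpg2])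
    refine ⟨(fun v => (m (lab r (y v)))⁻¹ * lab c (y v), fun i => m (FreeGroup.of i)), ?_⟩
    funext e
    have h1 : FreeGroup.lift (fun i => m (FreeGroup.of i)) = m := by
      ext i; simp
    have h2 := hm (y (o (e, true)) ++ [(e, true)] ++ invRev (y (o (e, false))))
      (((hy _).append (isPath_letter (e, true))).append (hy (o (e, false))).invRev)
    change m _ = _ at h2
    rw [lab_append, lab_append, lab_append, lab_append, lab_invRev, lab_invRev, lab_true, lab_true,
      _root_.map_mul, _root_.map_mul, _root_.map_inv] at h2
    simp only [Ψ, h1]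
    exact gauge_cancel h2
  have hc := Fintype.card_le_of_surjective Ψ hΨ
  have hZ : Fintype.card Z = 2 := rfl
  rw [Fintype.card_prod, Fintype.card_fun, Fintype.card_fun, Fintype.card_fun, hZ,
    Fintype.card_fin, ← pow_add] at hc
  exact (Nat.pow_le_pow_iff_right (by norm_num)).1 hc

lemma card_edges_le_of_valence {N : ℕ} [Fintype E] {r : E → FreeGroup (Fin N)} (h : Marked o r)
    (hval : ∀ v, ∃ a b c, a ≠ b ∧ a ≠ c ∧ b ≠ c ∧ o a = v ∧ o b = v ∧ o c = v) :
    Fintype.card E ≤ 3 * N := by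
  classical
  have : Finite V := finite_of_valence fun v =>
    let ⟨a, b, _, hab, _, _, ha, hb, _⟩ := hval v; ⟨a, b, hab, ha, hb⟩
  cases nonempty_fintype V
  have h1 := card_edges_le h
  have h2 : Fintype.card V * 3 ≤ Fintype.card (E × Bool) := by
    choose a b c hab hac hbc ha hb hc using hval
    let g : V × Fin 3 → E × Bool := fun p => ![a p.1, b p.1, c p.1] p.2
    have hog : ∀ p, o (g p) = p.1 := by
      rintro ⟨v, i⟩
      fin_cases i
      exacts [ha v, hb v, hc v]
    have hg : Function.Injective g := by
      rintro ⟨v, i⟩ ⟨w, j⟩ hij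
      have h3 := congrArg o hij
      rw [hog, hog] at h3
      simp only at h3
      subst h3
      congr 1
      have := (hab v).symm
      have := (hac v).symm
      have := (hbc v).symm
      fin_cases i <;> fin_cases j <;> simp_all [g]
    simpa using Fintype.card_le_of_injective g hg
  rw [Fintype.card_prod, Fintype.card_bool] at h2
  omega

lemma not_cyclic_component {N : ℕ} (hN : 2 ≤ N) {r : E → FreeGroup (Fin N)} (h : Marked o r)
    (v : V) (g : FreeGroup (Fin N))
    (hv : ∀ b, o b = v → o (bar b) = v ∧ r b.1 ∈ Subgroup.zpowers g) : False := by
  have h1 : ∀ p, IsPath o v p v → lab r p ∈ Subgroup.zpowers g := by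
    intro p hp
    refine lab_mem ?_
    induction p with
    | nil => simp
    | cons a p ih =>
      have := hv a hp.1
      simp only [List.mem_cons, forall_eq_or_imp]
      refine ⟨this.2, ih ?_⟩
      have h3 := hp.2
      rwa [this.1] at h3
  have h2 : ∀ w, w ∈ Subgroup.zpowers g := by
    intro w
    obtain ⟨p, hp, rfl, -⟩ := h.exists_reduced v v w
    exact h1 p hp
  obtain ⟨i, hi⟩ := h2 (FreeGroup.of ⟨0, by omega⟩)
  obtain ⟨j, hj⟩ := h2 (FreeGroup.of ⟨1, by omega⟩)
  have h3 : FreeGroup.of (⟨0, by omega⟩ : Fin N) * FreeGroup.of ⟨1, by omega⟩ =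
      FreeGroup.of ⟨1, by omega⟩ * FreeGroup.of ⟨0, by omega⟩ := by
    rw [← hi, ← hj]; exact zpow_mul_comm g i j
  have h4 := congrArg FreeGroup.toWord h3
  simp [FreeGroup.toWord_mul, FreeGroup.toWord_of] at h4

end Euler

namespace Rep

variable {F V E : Type*} [Group F] {φ : MulAut F} (R : Rep φ V E)

/-- Collapsing the larger edge at a vertex of valence at most two does not increase the
subinvariance factor. -/
lemma collapse_wt_of_valence [Fintype E] {c : E × Bool} [Fintype {e // e ∉ ({c.1} : Set E)}]
    (hc : R.o c ≠ R.o (bar c)) {u : E → ℝ}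
    {μ : ℝ} (hu : R.Wt u μ) (d : E) (hd : u d ≤ u c.1)
    (h : ∀ b, R.o b = R.o c → b = c ∨ (b.1 = d ∧ R.o (bar b) ≠ R.o c)) :
    (R.collapse hc).Wt (fun e => u e.1) μ := by
  classical
  refine R.collapse_wt hc (κ := u c.1) (fun e _ => hu.1 e) ?_ ?_
  · refine le_trans (Finset.sum_le_sum (g := fun e => if e = d then u e else 0) fun e _ => ?_) ?_
    · have h1 := h (e, true)
      have h2 := h (e, false)
      have h3 := (hu.1 e).le
      by_cases he : e = c.1
      · rw [if_pos he]; split_ifs <;> simp [h3]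
      · have h4 : ∀ s, (e, s) ≠ c := fun s hs => he (by rw [← hs])
        rw [if_neg he]
        by_cases hed : e = d
        · rw [if_pos hed]
          by_cases ht : R.o (e, true) = R.o c
          · have h5 := (h1 ht).resolve_left (h4 _)
            rw [if_pos ht, if_neg (show R.o (e, false) ≠ R.o c from h5.2)]; simp
          · rw [if_neg ht]; split_ifs <;> simp [h3]
        · have h6 : R.o (e, true) ≠ R.o c := fun ht => hed ((h1 ht).resolve_left (h4 _)).1
          have h7 : R.o (e, false) ≠ R.o c := fun ht => hed ((h2 ht).resolve_left (h4 _)).1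
          rw [if_neg hed, if_neg h6, if_neg h7]; simp
    · simpa using hd
  · intro b _
    refine le_trans (le_of_eq ?_) (hu.2 b)
    rw [← Finset.sum_erase_add _ _ (Finset.mem_univ c.1),
      ← Finset.sum_erase_add (a := c.1) (s := Finset.univ)
      (f := fun e => (cnt b (R.f e) : ℝ) * u e) (Finset.mem_univ c.1), if_pos rfl, add_zero]
    congr 1
    exact Finset.sum_congr rfl fun e he => if_neg (Finset.ne_of_mem_erase he)

end Rep

lemma card_compl_lt {E : Type*} [Fintype E] {S : Set E} (hS : S.Nonempty)
    [Fintype {e // e ∉ S}] : Fintype.card {e // e ∉ S} < Fintype.card E :=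
  let ⟨e, he⟩ := hS
  Fintype.card_subtype_lt (x := e) (by simpa using he)

/-- Every representative can be simplified to an irreducible one of bounded size without
increasing the subinvariance factor. -/
lemma exists_irred_rep {N : ℕ} (hN : 2 ≤ N) {φ : MulAut (FreeGroup (Fin N))} (hφ : FI φ) {μ : ℝ}
    {V E : Type} [Fintype E] [hV : Nonempty V] (R : Rep φ V E) {u : E → ℝ} (hu : R.Wt u μ) :
    ∃ (V' E' : Type) (_ : Fintype E') (R' : Rep φ V' E') (u' : E' → ℝ),
      Nonempty E' ∧ R'.Irred ∧ Fintype.card E' ≤ 3 * N ∧ R'.Wt u' μ := by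
  classical
  induction hn : Fintype.card E using Nat.strong_induction_on generalizing V E with
  | _ n ih =>
  by_cases hval : ∀ v, ∃ a b c, a ≠ b ∧ a ≠ c ∧ b ≠ c ∧ R.o a = v ∧ R.o b = v ∧ R.o c = v
  · by_cases hirr : R.Irred
    · exact ⟨V, E, _, R, u, hV.elim fun v => ⟨(hval v).choose.1⟩, hirr, card_edges_le_of_valence R.marked hval, hu⟩
    · simp only [Rep.Irred, not_forall] at hirr
      obtain ⟨S, hne, hinv, hS⟩ := hirr
      have hforest := R.forest_of_inv hφ (fun v =>
        let ⟨a, b, _, hab, _, _, ha, hb, _⟩ := hval v; ⟨a, b, hab, ha, hb⟩) hS hinv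
      have : Nonempty (Quotient (R.forestSetoid S)) := hV.map (Quotient.mk _)
      exact ih _ (hn ▸ card_compl_lt hne) (R.forest hinv hforest) (R.forest_wt hinv hforest hu) rfl
  · push Not at hval
    obtain ⟨v, hv⟩ := hval
    have hred : ∀ (c : E × Bool) (hc : R.o c ≠ R.o (bar c)) (d : E), u d ≤ u c.1 →
        (∀ b, R.o b = R.o c → b = c ∨ (b.1 = d ∧ R.o (bar b) ≠ R.o c)) →
        ∃ (V' E' : Type) (_ : Fintype E') (R' : Rep φ V' E') (u' : E' → ℝ),
          Nonempty E' ∧ R'.Irred ∧ Fintype.card E' ≤ 3 * N ∧ R'.Wt u' μ := fun c hc d hd h =>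
      have : Nonempty {x // x ≠ R.o c} := ⟨⟨_, hc.symm⟩⟩
      ih _ (hn ▸ card_compl_lt (Set.singleton_nonempty c.1)) (R.collapse hc)
        (R.collapse_wt_of_valence hc hu d hd h) rfl
    by_cases h0 : ∃ a, R.o a = v
    swap
    · push Not at h0
      exact (not_cyclic_component hN R.marked v 1 fun b hb => (h0 b hb).elim).elim
    obtain ⟨a, ha⟩ := h0
    by_cases h1 : ∃ d, d ≠ a ∧ R.o d = v
    swap
    · push Not at h1
      refine hred a (fun h => h1 (bar a) (bar_ne a) (h ▸ ha)) a.1 le_rfl fun b hb => Or.inl ?_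
      by_contra hba
      exact h1 b hba (hb.trans ha)
    obtain ⟨d, hda, hd⟩ := h1
    have h2 : ∀ b, R.o b = v → b = a ∨ b = d := by
      intro b hb
      by_contra hcon
      push Not at hcon
      exact hv a d b hda.symm hcon.1.symm hcon.2.symm ha hd hb
    by_cases hdb : d = bar a
    · refine (not_cyclic_component hN R.marked v (R.r a.1) fun b hb => ?_).elim
      rcases h2 b hb with rfl | rfl
      · exact ⟨hdb ▸ hd, Subgroup.mem_zpowers _⟩
      · rw [hdb]
        exact ⟨by simpa using ha, by simp⟩
    have ha' : R.o (bar a) ≠ v := fun h => (h2 _ h).elim (bar_ne a) (fun h => hdb h.symm)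
    have hd' : R.o (bar d) ≠ v := fun h => (h2 _ h).elim
      (fun h => hdb (by rw [← h, bar_bar])) (bar_ne d)
    rcases le_total (u d.1) (u a.1) with hle | hle
    · refine hred a (by rw [ha]; exact ha'.symm) d.1 hle fun b hb => ?_
      rcases h2 b (hb.trans ha) with rfl | rfl
      · exact Or.inl rfl
      · exact Or.inr ⟨rfl, by rwa [ha]⟩
    · refine hred d (by rw [hd]; exact hd'.symm) a.1 hle fun b hb => ?_
      rcases h2 b (hb.trans hd) with rfl | rfl
      · exact Or.inr ⟨rfl, by rwa [hd]⟩
      · exact Or.inl rfl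

/-! ### Nonnegative irreducible matrices -/

section Matrices

variable {E : Type*} [Fintype E]

/-- Irreducibility of a nonnegative integer matrix. -/
def MIrr (M : E → E → ℕ) : Prop :=
  ∀ S : Set E, S.Nonempty → (∀ a ∈ S, ∀ b, 0 < M b a → b ∈ S) → S = Set.univ

lemma exists_lt_of_strict [Nonempty E] {M : E → E → ℕ} {u : E → ℝ} (hu : ∀ e, 0 < u e) {l : ℝ}
    (h : ∀ b, ∑ a, (M b a : ℝ) * u a < l * u b) :
    ∃ μ < l, ∀ b, ∑ a, (M b a : ℝ) * u a ≤ μ * u b := by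
  obtain ⟨c, -, hc⟩ := Finset.exists_max_image Finset.univ
    (fun b => (∑ a, (M b a : ℝ) * u a) / u b) Finset.univ_nonempty
  refine ⟨_, (div_lt_iff₀ (hu c)).2 (h c), fun b => ?_⟩
  exact (div_le_iff₀ (hu b)).1 (hc b (Finset.mem_univ b))

lemma exists_perturb {M : E → E → ℕ} {u : E → ℝ} (hu : ∀ e, 0 < u e) {l : ℝ}
    (h : ∀ b, ∑ a, (M b a : ℝ) * u a ≤ l * u b) :
    ∃ v : E → ℝ, (∀ e, 0 < v e) ∧ (∀ b, ∑ a, (M b a : ℝ) * v a ≤ l * v b) ∧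
      (∀ b, ∑ a, (M b a : ℝ) * u a < l * u b → ∑ a, (M b a : ℝ) * v a < l * v b) ∧
      ∀ a b, ∑ c, (M a c : ℝ) * u c < l * u a → 0 < M b a →
        ∑ a, (M b a : ℝ) * v a < l * v b := by
  classical
  let Z : Set E := {b | ∑ a, (M b a : ℝ) * u a < l * u b}
  have hε : ∃ ε : ℝ, 0 < ε ∧ ε < 1 ∧ ∀ b ∈ Z, ∑ a, (M b a : ℝ) * u a < l * ((1 - ε) * u b) := by
    have h1 : ∀ᶠ ε : ℝ in nhdsWithin 0 (Set.Ioi 0), ∀ b, b ∈ Z →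
        ∑ a, (M b a : ℝ) * u a < l * ((1 - ε) * u b) := by
      rw [Filter.eventually_all]
      intro b
      by_cases hb : b ∈ Z
      · have hc : Continuous fun ε : ℝ => l * ((1 - ε) * u b) := by fun_prop
        have := (hc.tendsto 0).eventually (lt_mem_nhds (a := ∑ a, (M b a : ℝ) * u a)
          (by simpa [Z] using hb))
        exact (this.filter_mono nhdsWithin_le_nhds).mono fun ε h _ => h
      · exact Filter.Eventually.of_forall fun _ h => (hb h).elim
    have h2 : ∀ᶠ ε : ℝ in nhdsWithin 0 (Set.Ioi 0), ε < 1 :=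
      (gt_mem_nhds (by norm_num : (0:ℝ) < 1)).filter_mono nhdsWithin_le_nhds
    obtain ⟨ε, h3, h4, h5⟩ := (h1.and (h2.and self_mem_nhdsWithin)).exists
    exact ⟨ε, h5, h4, h3⟩
  obtain ⟨ε, h0, h1, hεZ⟩ := hε
  let v : E → ℝ := fun e => if e ∈ Z then (1 - ε) * u e else u e
  have hv : ∀ e, 0 < v e := by
    intro e
    have := hu e
    simp only [v]; split_ifs
    · exact mul_pos (by linarith) this
    · exact this
  have hvu : ∀ e, v e ≤ u e := by
    intro e
    have := hu e
    simp only [v]; split_ifs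
    · nlinarith
    · exact le_rfl
  have hle : ∀ b, ∑ a, (M b a : ℝ) * v a ≤ ∑ a, (M b a : ℝ) * u a := fun b =>
    Finset.sum_le_sum fun a _ => mul_le_mul_of_nonneg_left (hvu a) (Nat.cast_nonneg _)
  have hZ : ∀ b ∈ Z, ∑ a, (M b a : ℝ) * v a < l * v b := by
    intro b hb
    refine (hle b).trans_lt ?_
    simpa only [v, if_pos hb] using hεZ b hb
  refine ⟨v, hv, fun b => ?_, hZ, fun a b ha hab => ?_⟩
  · by_cases hb : b ∈ Z
    · exact (hZ b hb).le
    · refine (hle b).trans ?_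
      simpa only [v, if_neg hb] using h b
  · by_cases hb : b ∈ Z
    · exact hZ b hb
    · refine lt_of_lt_of_le ?_ (by simpa only [v, if_neg hb] using h b)
      refine Finset.sum_lt_sum (fun c _ => mul_le_mul_of_nonneg_left (hvu c) (Nat.cast_nonneg _))
        ⟨a, Finset.mem_univ a, ?_⟩
      have ha' : v a = (1 - ε) * u a := if_pos ha
      have : (0 : ℝ) < M b a := by exact_mod_cast hab
      rw [ha']
      have := hu a
      refine mul_lt_mul_of_pos_left ?_ (by assumption)
      nlinarith

/-- A matrix which is strictly smaller than an irreducible one has strictly smaller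
subinvariance factor. -/
lemma exists_smaller_factor {M M' : E → E → ℕ} (hM : MIrr M) (hle : ∀ b a, M' b a ≤ M b a)
    {u : E → ℝ} (hu : ∀ e, 0 < u e) {l : ℝ} (h : ∀ b, ∑ a, (M b a : ℝ) * u a ≤ l * u b)
    (hs : ∃ b, ∑ a, (M' b a : ℝ) * u a < l * u b) :
    ∃ μ < l, ∃ v : E → ℝ, (∀ e, 0 < v e) ∧ ∀ b, ∑ a, (M' b a : ℝ) * v a ≤ μ * v b := by
  classical
  have key : ∀ n (u : E → ℝ), (∀ e, 0 < u e) → (∀ b, ∑ a, (M' b a : ℝ) * u a ≤ l * u b) →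
      (∃ b, ∑ a, (M' b a : ℝ) * u a < l * u b) →
      (∀ b, ¬ ∑ a, (M' b a : ℝ) * u a < l * u b → ∀ a, M' b a = M b a) →
      (Finset.univ.filter fun b => ¬ ∑ a, (M' b a : ℝ) * u a < l * u b).card = n →
      ∃ μ < l, ∃ v : E → ℝ, (∀ e, 0 < v e) ∧ ∀ b, ∑ a, (M' b a : ℝ) * v a ≤ μ * v b := by
    intro n
    induction n using Nat.strong_induction_on with
    | _ n ih =>
    intro u hu h hs hrow hn
    obtain ⟨b₀, hb₀⟩ := hs
    by_cases hall : ∀ b, ∑ a, (M' b a : ℝ) * u a < l * u b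
    · have : Nonempty E := ⟨b₀⟩
      obtain ⟨μ, h1, h2⟩ := exists_lt_of_strict hu hall
      exact ⟨μ, h1, u, hu, h2⟩
    · have h1 : ∃ a b, ∑ c, (M' a c : ℝ) * u c < l * u a ∧ 0 < M b a ∧
          ¬ ∑ c, (M' b c : ℝ) * u c < l * u b := by
        by_contra hcon
        push Not at hcon
        have := hM {b | ∑ a, (M' b a : ℝ) * u a < l * u b} ⟨b₀, hb₀⟩ (fun a ha b hb => hcon a b ha hb)
        exact hall fun b => by
          have hb : b ∈ {b | ∑ a, (M' b a : ℝ) * u a < l * u b} := by rw [this]; trivial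
          exact hb
      obtain ⟨a, b, ha, hab, hb⟩ := h1
      obtain ⟨v, hv, hv1, hv2, hv3⟩ := exists_perturb hu h
      refine ih _ ?_ v hv hv1 ⟨b₀, hv2 _ hb₀⟩ (fun c hc => hrow c fun h => hc (hv2 c h)) rfl
      rw [← hn]
      refine Finset.card_lt_card ⟨fun c hc => ?_, fun hsub => ?_⟩
      · simp only [Finset.mem_filter, Finset.mem_univ, true_and] at hc ⊢
        exact fun h => hc (hv2 c h)
      · have := hsub (x := b) (by simpa using hb)
        simp only [Finset.mem_filter, Finset.mem_univ, true_and] at this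
        exact this (hv3 a b ha (by rwa [hrow b hb]))
  have hle' : ∀ b a, (M' b a : ℝ) * u a ≤ M b a * u a := fun b a =>
    mul_le_mul_of_nonneg_right (by exact_mod_cast hle b a) (hu a).le
  have h' : ∀ b, ∑ a, (M' b a : ℝ) * u a ≤ l * u b := fun b =>
    (Finset.sum_le_sum fun a _ => hle' b a).trans (h b)
  refine key _ u hu h' hs (fun b hb a => ?_) rfl
  have h1 : ∑ a, (M' b a : ℝ) * u a = ∑ a, (M b a : ℝ) * u a :=
    le_antisymm (Finset.sum_le_sum fun a _ => hle' b a) ((h b).trans (not_lt.1 hb))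
  have h2 := (Finset.sum_eq_sum_iff_of_le fun a _ => hle' b a).1 h1 a (Finset.mem_univ a)
  exact_mod_cast mul_right_cancel₀ (hu a).ne' h2

lemma weight_ratio {M : E → E → ℕ} (hM : MIrr M) {u : E → ℝ} (hu : ∀ e, 0 < u e) {l : ℝ}
    (hl : 1 ≤ l) (h : ∀ b, ∑ a, (M b a : ℝ) * u a ≤ l * u b) (a b : E) :
    u a ≤ l ^ Fintype.card E * u b := by
  classical
  have hstep : ∀ c d, 0 < M d c → u c ≤ l * u d := by
    intro c d hcd
    refine le_trans ?_ ((Finset.single_le_sum (f := fun c => (M d c : ℝ) * u c) (fun e _ =>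
      mul_nonneg (Nat.cast_nonneg _) (hu e).le) (Finset.mem_univ c)).trans (h d))
    have : (1 : ℝ) ≤ M d c := by exact_mod_cast hcd
    simpa using mul_le_mul_of_nonneg_right this (hu c).le
  have hgrow : ∀ k, (Finset.univ.filter fun c => u a ≤ l ^ k * u c) = Finset.univ ∨
      k + 1 ≤ (Finset.univ.filter fun c => u a ≤ l ^ k * u c).card := by
    intro k
    have hmono : ∀ c, u a ≤ l ^ k * u c → u a ≤ l ^ (k + 1) * u c := fun c hc => hc.trans
      (mul_le_mul_of_nonneg_right (pow_le_pow_right₀ hl k.le_succ) (hu c).le)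
    induction k with
    | zero => exact Or.inr (Finset.card_pos.2 ⟨a, by simp⟩)
    | succ k ih =>
      have hmono' : ∀ c, u a ≤ l ^ k * u c → u a ≤ l ^ (k + 1) * u c := fun c hc => hc.trans
        (mul_le_mul_of_nonneg_right (pow_le_pow_right₀ hl k.le_succ) (hu c).le)
      by_cases huniv : ∀ c, u a ≤ l ^ k * u c
      · exact Or.inl (Finset.filter_true_of_mem fun c _ => hmono' c (huniv c))
      have ih := (ih hmono').resolve_left fun h => huniv fun c => by
        have : c ∈ Finset.univ.filter fun c => u a ≤ l ^ k * u c := by rw [h]; exact Finset.mem_univ c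
        simpa using this
      refine Or.inr (lt_of_le_of_lt ih (Finset.card_lt_card ?_))
      have h1 : ∃ c d, u a ≤ l ^ k * u c ∧ 0 < M d c ∧ ¬ u a ≤ l ^ k * u d := by
        by_contra hcon
        push Not at hcon
        have := hM {c | u a ≤ l ^ k * u c} ⟨a, by
          simpa using mul_le_mul_of_nonneg_right (one_le_pow₀ hl (n := k)) (hu a).le⟩
          (fun c hc d hd => hcon c d hc hd)
        exact huniv fun b => by
          have hb : b ∈ {c | u a ≤ l ^ k * u c} := by rw [this]; trivial
          exact hb
      obtain ⟨c, d, hc, hcd, hd⟩ := h1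
      refine ⟨fun c hc => by simpa using hmono' c (by simpa using hc), fun hsub => hd ?_⟩
      have h2 := hsub (x := d) ?_
      · simpa using h2
      · simp only [Finset.mem_filter, Finset.mem_univ, true_and]
        refine hc.trans ?_
        rw [pow_succ, mul_assoc]
        exact mul_le_mul_of_nonneg_left (hstep c d hcd) (by positivity)
  rcases hgrow (Fintype.card E) with h1 | h1
  · have : b ∈ Finset.univ.filter fun c => u a ≤ l ^ (Fintype.card E) * u c := by rw [h1]; exact Finset.mem_univ b
    simpa using this
  · exact absurd (h1.trans (Finset.card_le_univ _)) (by omega)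

lemma entry_le {M : E → E → ℕ} (hM : MIrr M) {u : E → ℝ} (hu : ∀ e, 0 < u e) {l : ℝ}
    (hl : 1 ≤ l) (h : ∀ b, ∑ a, (M b a : ℝ) * u a ≤ l * u b) (a b : E) :
    (M b a : ℝ) ≤ l ^ (Fintype.card E + 1) := by
  have h1 := (Finset.single_le_sum (f := fun c => (M b c : ℝ) * u c) (fun e _ =>
      mul_nonneg (Nat.cast_nonneg _) (hu e).le) (Finset.mem_univ a)).trans (h b)
  have h2 := weight_ratio hM hu hl h b a
  refine le_of_mul_le_mul_right (h1.trans ?_) (hu a)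
  rw [pow_succ']
  rw [mul_assoc]
  exact mul_le_mul_of_nonneg_left h2 (by linarith)

lemma isCompact_factors (M : E → E → ℕ) (B : ℝ) :
    IsCompact {l : ℝ | l ∈ Set.Icc 0 B ∧ ∃ u ∈ stdSimplex ℝ E,
      ∀ b, ∑ a, (M b a : ℝ) * u a ≤ l * u b} := by
  have h1 : IsCompact ((stdSimplex ℝ E) ×ˢ (Set.Icc (0 : ℝ) B)) :=
    (isCompact_stdSimplex ℝ E).prod isCompact_Icc
  have h2 : IsClosed {p : (E → ℝ) × ℝ | ∀ b, ∑ a, (M b a : ℝ) * p.1 a ≤ p.2 * p.1 b} := by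
    rw [Set.ofPred_forall]
    refine isClosed_iInter fun b => isClosed_le ?_ ?_ <;> fun_prop
  convert (h1.inter_right h2).image continuous_snd using 1
  ext l
  simp only [Set.mem_ofPred_eq, Set.mem_image, Set.mem_inter_iff, Set.mem_prod, Prod.exists,
    exists_eq_right]
  constructor
  · rintro ⟨h1, u, h2, h3⟩; exact ⟨u, ⟨h2, h1⟩, h3⟩
  · rintro ⟨u, ⟨h2, h1⟩, h3⟩; exact ⟨h1, u, h2, h3⟩

lemma pos_of_simplex {M : E → E → ℕ} (hM : MIrr M) {u : E → ℝ} (hu : u ∈ stdSimplex ℝ E) {l : ℝ}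
    (h : ∀ b, ∑ a, (M b a : ℝ) * u a ≤ l * u b) (e : E) : 0 < u e := by
  have h1 : {e | 0 < u e} = Set.univ := by
    refine hM _ ?_ fun a ha b hb => ?_
    · by_contra hcon
      rw [Set.not_nonempty_iff_eq_empty, Set.eq_empty_iff_forall_notMem] at hcon
      have := hu.2
      rw [Finset.sum_eq_zero fun e _ => le_antisymm (not_lt.1 (hcon e)) (hu.1 e)] at this
      exact zero_ne_one this
    · have h1 := (Finset.single_le_sum (f := fun c => (M b c : ℝ) * u c) (fun e _ =>
        mul_nonneg (Nat.cast_nonneg _) (hu.1 e)) (Finset.mem_univ a)).trans (h b)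
      have h2 : 0 < (M b a : ℝ) * u a := mul_pos (by exact_mod_cast hb) ha
      refine lt_of_le_of_ne (hu.1 b) fun h0 => ?_
      rw [← h0] at h1
      simp only [mul_zero] at h1
      linarith
  have : e ∈ {e | 0 < u e} := by rw [h1]; trivial
  exact this

end Matrices

/-! ### Optimal representatives -/

lemma isPath_unit {E : Type*} (L : List (E × Bool)) (u v : Unit) :
    IsPath (fun _ : E × Bool => ()) u L v := by
  induction L generalizing u with
  | nil => rfl
  | cons a L ih => exact ⟨rfl, ih _⟩

lemma rose_marked {α : Type*} : Marked (fun _ : α × Bool => ()) (FreeGroup.of : α → FreeGroup α) where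
  surj u v g := by
    obtain ⟨L, rfl⟩ := Quot.exists_rep g
    exact ⟨L, isPath_unit _ _ _, lab_of L⟩
  inj u p _ h := by rwa [lab_of] at h

/-- The representative of an automorphism on the rose. -/
def Rep.rose {α : Type*} [DecidableEq α] (φ : MulAut (FreeGroup α)) : Rep φ Unit α where
  o _ := ()
  r := FreeGroup.of
  marked := rose_marked
  f e := (φ (FreeGroup.of e)).toWord
  fV := id
  path e := isPath_unit _ _ _
  h _ := 1
  rep e := by rw [lab_of, FreeGroup.mk_toWord]; simp

/-- A power of a fully irreducible automorphism is not inner. -/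
lemma FI.not_inner {N : ℕ} (hN : 2 ≤ N) {φ : MulAut (FreeGroup (Fin N))} (hφ : FI φ) {k : ℕ}
    (hk : 0 < k) (g : FreeGroup (Fin N)) : φ ^ k ≠ MulAut.conj g := by
  intro h
  have hc : ∀ i : Fin N, FreeGroup.of i ∈ carried (fun _ : Fin N × Bool => ()) FreeGroup.of {i} () :=
    fun i => ⟨[(i, true)], isPath_unit _ _ _, by simp, lab_true _ _⟩
  refine hφ k hk _ (isFreeFactor_carried rose_marked {⟨0, by omega⟩} ()) ?_ ?_ g (by rw [h])
  · intro hbot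
    have := hc ⟨0, by omega⟩
    rw [hbot, Subgroup.mem_bot] at this
    exact FreeGroup.of_ne_one _ this
  · intro htop
    have h1 : FreeGroup.of (⟨1, by omega⟩ : Fin N) ∈
      carried (fun _ : Fin N × Bool => ()) FreeGroup.of {⟨0, by omega⟩} () := by rw [htop]; trivial
    obtain ⟨p, -, hp, hl⟩ := h1
    have h2 := congrArg (FreeGroup.lift fun i : Fin N =>
      if i = ⟨0, by omega⟩ then (1 : FreeGroup (Fin N)) else FreeGroup.of i) hl
    rw [FreeGroup.lift_apply_of, if_neg (by simp), lab_of, ← lab] at h2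
    rw [lab_eq_one] at h2
    · exact FreeGroup.of_ne_one _ h2.symm
    · intro a ha
      exact if_pos (hp a ha)

/-- `l` is a lower bound for the subinvariance factors of all representatives of `φ`. -/
def IsMin {F : Type*} [Group F] (φ : MulAut F) (l : ℝ) : Prop :=
  ∀ (V E : Type) [Fintype E] [Nonempty V] (R : Rep φ V E) (u : E → ℝ) (μ : ℝ), R.Wt u μ → l ≤ μ

/-- An irreducible representative with weights of minimal factor. -/
structure Rep.Opt {F : Type*} [Group F] {φ : MulAut F} {V E : Type} [Fintype E] (R : Rep φ V E)
    (u : E → ℝ) (l : ℝ) : Prop where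
  ne : Nonempty E
  irred : R.Irred
  wt : R.Wt u l
  min : IsMin φ l

namespace Rep

variable {F V E : Type*} [Group F] {φ : MulAut F} (R : Rep φ V E)

lemma Irred.mIrr {R : Rep φ V E} (h : R.Irred) : MIrr fun b a => cnt b (R.f a) := by
  intro S hS hinv
  exact h S hS fun e he a ha => hinv e he a.1 ((cnt_pos _).2 ⟨a, ha, rfl⟩)

lemma exists_wt [Fintype E] (u : E → ℝ) (hu : ∀ e, 0 < u e) : ∃ μ, R.Wt u μ := by
  classical
  rcases isEmpty_or_nonempty E with hE | hE
  · exact ⟨0, hu, fun b => hE.elim b⟩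
  obtain ⟨c, -, hc⟩ := Finset.exists_max_image Finset.univ
    (fun b => (∑ a, (cnt b (R.f a) : ℝ) * u a) / u b) Finset.univ_nonempty
  exact ⟨_, hu, fun b => (div_le_iff₀ (hu b)).1 (hc b (Finset.mem_univ b))⟩

lemma Wt.mono [Fintype E] {R : Rep φ V E} {u : E → ℝ} {l μ : ℝ} (h : R.Wt u l) (hl : l ≤ μ) : R.Wt u μ :=
  ⟨h.1, fun b => (h.2 b).trans (mul_le_mul_of_nonneg_right hl (h.1 b).le)⟩

lemma Wt.nonneg [Fintype E] {R : Rep φ V E} {u : E → ℝ} {l : ℝ} (h : R.Wt u l) (b : E) : 0 ≤ l := by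
  have h1 := h.1 b
  have h2 := h.2 b
  have h3 : 0 ≤ ∑ a, (cnt b (R.f a) : ℝ) * u a :=
    Finset.sum_nonneg fun a _ => mul_nonneg (Nat.cast_nonneg _) (h.1 a).le
  exact nonneg_of_mul_nonneg_left (h3.trans h2) h1

end Rep

/-- A fully irreducible automorphism has an irreducible representative of minimal factor. -/
lemma exists_opt {N : ℕ} (hN : 2 ≤ N) {φ : MulAut (FreeGroup (Fin N))} (hφ : FI φ) :
    ∃ (V E : Type) (_ : Fintype E) (R : Rep φ V E) (u : E → ℝ) (l : ℝ), R.Opt u l := by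
  classical
  obtain ⟨μ₀, h0⟩ := (Rep.rose φ).exists_wt (fun _ => 1) (fun _ => one_pos)
  let B := max μ₀ 1
  have hB : 1 ≤ B := le_max_right _ _
  -- realizable matrices
  let Good : (n : ℕ) → Set (Fin n → Fin n → ℕ) := fun n =>
    {M | (∀ b a, M b a ≤ ⌊B ^ (n + 1)⌋₊) ∧ ∃ (V E : Type) (_ : Fintype E) (R : Rep φ V E)
      (i : E ≃ Fin n), R.Irred ∧ ∀ b a, M (i b) (i a) = cnt b (R.f a)}
  have hfin : ∀ n, (Good n).Finite := by
    intro n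
    refine Set.Finite.subset (Set.Finite.pi' fun _ => Set.Finite.pi' fun _ =>
      Set.finite_Iic ⌊B ^ (n + 1)⌋₊) fun M hM b a => hM.1 b a
  let T : Set ℝ := ⋃ n ∈ Finset.Icc 1 (3 * N), ⋃ M ∈ Good n,
    {l : ℝ | l ∈ Set.Icc 0 B ∧ ∃ u ∈ stdSimplex ℝ (Fin n), ∀ b, ∑ a, (M b a : ℝ) * u a ≤ l * u b}
  have hT : IsCompact T := Finset.isCompact_biUnion _ fun n _ =>
    (hfin n).isCompact_biUnion fun M _ => isCompact_factors M B
  have hmemT : ∀ (V E : Type) [Fintype E] [Nonempty V] (R : Rep φ V E) (u : E → ℝ) (μ : ℝ),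
      R.Wt u μ → μ ≤ B → μ ∈ T := by
    intro V₀ E₀ _ _ R₀ u₀ μ hw₀ hμ
    obtain ⟨V, E, _, R, u, hne, hirr, hcard, hw⟩ := exists_irred_rep hN hφ R₀ hw₀
    let i := Fintype.equivFin E
    have hpos : 0 < ∑ e, u e := Finset.sum_pos (fun e _ => hw.1 e) Finset.univ_nonempty
    simp only [T, Set.mem_iUnion]
    refine ⟨Fintype.card E, Finset.mem_Icc.2 ⟨Fintype.card_pos, hcard⟩,
      fun b a => cnt (i.symm b) (R.f (i.symm a)), ⟨fun b a => Nat.le_floor ?_,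
        V, E, inferInstance, R, i, hirr, by simp⟩, ⟨hw.nonneg hne.some, hμ⟩,
      fun a => u (i.symm a) / ∑ e, u e, ⟨fun a => div_nonneg (hw.1 _).le hpos.le, ?_⟩, fun b => ?_⟩
    · exact entry_le hirr.mIrr hw.1 hB (hw.mono hμ).2 _ _
    · rw [← Finset.sum_div, Equiv.sum_comp i.symm u, div_self hpos.ne']
    · rw [mul_div_assoc', ← Equiv.sum_comp i]
      simp only [Equiv.symm_apply_apply, mul_div_assoc']
      rw [← Finset.sum_div]
      exact div_le_div_of_nonneg_right (hw.2 _) hpos.le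
  have hTne : T.Nonempty := ⟨B, hmemT Unit (Fin N) (Rep.rose φ) _ B (h0.mono (le_max_left _ _)) le_rfl⟩
  obtain ⟨l, hl, hlmin⟩ := hT.exists_isLeast hTne
  have hmin : IsMin φ l := by
    intro V E _ _ R u μ hw
    rcases le_total μ B with h | h
    · exact hlmin (hmemT V E R u μ hw h)
    · refine le_trans ?_ h
      exact hlmin (hmemT Unit (Fin N) (Rep.rose φ) _ B (h0.mono (le_max_left _ _)) le_rfl)
  simp only [T, Set.mem_iUnion] at hl
  obtain ⟨n, hn, M, ⟨-, V, E, _, R, i, hirr, hM⟩, ⟨hl0, -⟩, u, hu, hw⟩ := hl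
  have hne : Nonempty E := ⟨i.symm ⟨0, by simp at hn; omega⟩⟩
  have hw' : ∀ b, ∑ a, (cnt b (R.f a) : ℝ) * u (i a) ≤ l * u (i b) := by
    intro b
    refine le_trans (le_of_eq ?_) (hw (i b))
    rw [← Equiv.sum_comp i]
    simp only [hM]
  have hMirr : MIrr M := by
    intro S hS hinv
    have := hirr (i ⁻¹' S) (hS.preimage i.surjective) fun e he a ha => by
      refine hinv (i e) he (i a.1) ?_
      rw [hM]
      exact (cnt_pos _).2 ⟨a, ha, rfl⟩
    rw [Set.preimage_eq_univ_iff, i.range_eq_univ] at this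
    exact Set.univ_subset_iff.1 this
  exact ⟨V, E, _, R, u ∘ i, l, hne, hirr, ⟨fun e => pos_of_simplex hMirr hu hw _, hw'⟩, hmin⟩

namespace Rep

variable {F : Type*} [Group F] {V E : Type} {φ : MulAut F} {R : Rep φ V E} [Fintype E]
  {u : E → ℝ} {l : ℝ}

lemma Opt.not_smaller (h : R.Opt u l) (R' : Rep φ V E) (hle : ∀ b a, cnt b (R'.f a) ≤ cnt b (R.f a))
    (hs : ∃ b, ∑ a, (cnt b (R'.f a) : ℝ) * u a < l * u b) : False := by
  obtain ⟨μ, hμ, v, hv, hv'⟩ := exists_smaller_factor h.irred.mIrr hle h.wt.1 h.wt.2 hs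
  have : Nonempty V := h.ne.map fun e => R.o (e, true)
  exact not_lt.2 (h.min V E R' v μ ⟨hv, hv'⟩) hμ

lemma Opt.eigen (h : R.Opt u l) (b : E) : ∑ a, (cnt b (R.f a) : ℝ) * u a = l * u b := by
  refine le_antisymm (h.wt.2 b) (not_lt.1 fun hlt => h.not_smaller R (fun _ _ => le_rfl) ⟨b, hlt⟩)

lemma Opt.tight (h : R.Opt u l) (e : E) : FreeGroup.IsReduced (R.f e) := by
  by_contra hcon
  have hle : ∀ b a, cnt b (R.tighten.f a) ≤ cnt b (R.f a) := fun b a => cnt_le_of_red _ (red_red _)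
  have hlt : ∃ b, cnt b (R.tighten.f e) < cnt b (R.f e) := by
    by_contra h1
    push Not at h1
    have h2 : (red (R.f e)).length = (R.f e).length := by
      rw [← sum_cnt, ← sum_cnt]
      exact Finset.sum_congr rfl fun b _ => le_antisymm (hle b e) (h1 b)
    exact hcon (red_eq_self.1 ((red_red _).sublist.eq_of_length h2))
  obtain ⟨b, hb⟩ := hlt
  refine h.not_smaller R.tighten hle ⟨b, lt_of_lt_of_le ?_ (h.wt.2 b)⟩
  refine Finset.sum_lt_sum (fun a _ => mul_le_mul_of_nonneg_right (by exact_mod_cast hle b a)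
    (h.wt.1 a).le) ⟨e, Finset.mem_univ e, mul_lt_mul_of_pos_right (by exact_mod_cast hb) (h.wt.1 e)⟩

omit [Fintype E] in
lemma Irred.f_ne_nil {R : Rep φ V E} [Nontrivial F] (h : R.Irred) (e : E) : R.f e ≠ [] := by
  intro he
  have h1 := h {e} ⟨e, rfl⟩ (by rintro _ rfl; simp [he])
  obtain ⟨w, hw⟩ := exists_ne (1 : F)
  obtain ⟨p, hp, hpw⟩ := R.marked.surj (R.o (e, true)) (R.o (e, true)) w
  have h2 : sub R.f p = [] := by
    simp only [sub, List.flatMap_eq_nil_iff]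
    intro a _
    have : a.1 ∈ ({e} : Set E) := by rw [h1]; trivial
    rw [Set.mem_singleton_iff] at this
    rcases a with ⟨a, _ | _⟩ <;> simp_all
  have h3 := R.lab_map hp
  rw [h2, hpw, lab_nil] at h3
  have h4 : φ w = 1 := by
    have : φ w = R.h (R.o (e, true)) * 1 * (R.h (R.o (e, true)))⁻¹ := by rw [h3]; group
    simpa using this
  exact hw (by simpa using h4)

lemma exists_two_le_length {N : ℕ} (hN : 2 ≤ N) {φ : MulAut (FreeGroup (Fin N))} (hφ : FI φ)
    (R : Rep φ V E) (hE : Nonempty E) (hne : ∀ e, R.f e ≠ []) : ∃ e, 2 ≤ (R.f e).length := by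
  by_contra hcon
  push Not at hcon
  have h1 : ∀ e, ∃ a, R.f e = [a] := fun e => List.length_eq_one_iff.1 (by
    have := List.length_pos_iff.2 (hne e)
    have := hcon e
    omega)
  choose D hD using h1
  have h2 : ∀ n e, ∃ a, R.it n [(e, true)] = [a] := by
    intro n
    induction n with
    | zero => exact fun e => ⟨_, rfl⟩
    | succ n ih =>
      intro e
      rw [R.it_succ', sub_singleton, sub1_true, hD]
      rcases D e with ⟨d, _ | _⟩
      · obtain ⟨a, ha⟩ := ih d
        refine ⟨bar a, ?_⟩
        rw [show (d, false) = bar (d, true) from rfl, R.it_bar, ha]; rfl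
      · exact ih d
  choose G hG using h2
  obtain ⟨m, n, hmn, hG'⟩ := Finite.exists_ne_map_eq_of_infinite G
  wlog hlt : m < n generalizing m n
  · exact this n m hmn.symm hG'.symm (by omega)
  have h3 : ∀ L, R.it m L = R.it n L := by
    intro L
    rw [R.it_eq_sub m, R.it_eq_sub n]
    exact sub_congr fun a _ => by rw [hG, hG, hG']
  obtain ⟨Hm, hHm⟩ := R.exists_gauge m
  obtain ⟨Hn, hHn⟩ := R.exists_gauge n
  obtain ⟨e⟩ := hE
  let v := R.o (e, true)
  refine hφ.not_inner hN (k := n - m) (by omega) (Hn v * (Hm v)⁻¹) ?_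
  ext1 w
  obtain ⟨p, hp, hpw⟩ := R.marked.surj v v ((φ ^ m)⁻¹ w)
  have h4 := hHm v v p hp
  rw [h3, hHn v v p hp, hpw] at h4
  have h5 : (φ ^ n) ((φ ^ m)⁻¹ w) = (φ ^ (n - m)) w := by
    rw [← MulAut.mul_apply, show n = (n - m) + m by omega, pow_add, mul_inv_cancel_right]
    simp
  have h6 : (φ ^ m) ((φ ^ m)⁻¹ w) = w := by rw [← MulAut.mul_apply, mul_inv_cancel]; rfl
  rw [h5, h6] at h4
  rw [MulAut.conj_apply]
  calc (φ ^ (n - m)) w = Hn v * ((Hn v)⁻¹ * (φ ^ (n - m)) w * Hn v) * (Hn v)⁻¹ := by group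
    _ = _ := by rw [h4]; group

end Rep

/-! ### Growth of edge words -/

section Lengths

variable {E E' : Type*} {f : E → List (E' × Bool)}

lemma length_sub1 (a : E × Bool) : (sub1 f a).length = (f a.1).length := by
  rcases a with ⟨e, _ | _⟩ <;> simp [FreeGroup.invRev_length]

lemma length_sub_le {K : ℕ} (h : ∀ e, (f e).length ≤ K) (L : List (E × Bool)) :
    (sub f L).length ≤ K * L.length := by
  induction L with
  | nil => simp
  | cons a L ih =>
    have := h a.1
    rw [sub_cons, List.length_append, length_sub1, List.length_cons, Nat.mul_succ]
    omega

lemma le_length_sub {K : ℕ} (h : ∀ e, K ≤ (f e).length) (L : List (E × Bool)) :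
    K * L.length ≤ (sub f L).length := by
  induction L with
  | nil => simp
  | cons a L ih =>
    have := h a.1
    rw [sub_cons, List.length_append, length_sub1, List.length_cons, Nat.mul_succ]
    omega

lemma exists_length_le [Finite E] (f : E → List (E' × Bool)) : ∃ K : ℕ, 1 ≤ K ∧ ∀ e, (f e).length ≤ K := by
  cases nonempty_fintype E
  exact ⟨(∑ e, (f e).length) + 1, by omega, fun e =>
    (Finset.single_le_sum (f := fun e => (f e).length) (fun _ _ => Nat.zero_le _)
      (Finset.mem_univ e)).trans (Nat.le_succ _)⟩

lemma length_sub_cons_le (a : E × Bool) (L : List (E × Bool)) (ha : a ∈ L) :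
    (sub f [a]).length ≤ (sub f L).length := by
  obtain ⟨L₁, L₂, rfl⟩ := List.append_of_mem ha
  rw [show L₁ ++ a :: L₂ = L₁ ++ ([a] ++ L₂) by simp]
  simp only [sub_append, List.length_append]
  omega

end Lengths

namespace Rep

section

variable {F V E : Type*} [Group F] {φ : MulAut F} {R : Rep φ V E}

lemma length_it_le {K : ℕ} (h : ∀ e, (R.f e).length ≤ K) (n : ℕ) (L : List (E × Bool)) :
    (R.it n L).length ≤ K ^ n * L.length := by
  induction n with
  | zero => simp
  | succ n ih =>
    rw [it_succ]
    refine (length_sub_le h _).trans ((Nat.mul_le_mul_left _ ih).trans ?_)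
    rw [pow_succ', mul_assoc]

lemma length_le_it (h : ∀ e, R.f e ≠ []) (n : ℕ) (L : List (E × Bool)) :
    L.length ≤ (R.it n L).length := by
  induction n with
  | zero => simp
  | succ n ih =>
    rw [it_succ]
    refine ih.trans ?_
    simpa using le_length_sub (K := 1) (fun e => List.length_pos_iff.2 (h e)) (R.it n L)

lemma length_it_mono (h : ∀ e, R.f e ≠ []) {m n : ℕ} (hmn : m ≤ n) (L : List (E × Bool)) :
    (R.it m L).length ≤ (R.it n L).length := by
  obtain ⟨k, rfl⟩ := Nat.exists_eq_add_of_le' hmn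
  rw [it_add]
  exact length_le_it h _ _

lemma length_it_mem {n : ℕ} {a : E × Bool} {L : List (E × Bool)} (ha : a ∈ L) :
    (R.it n [a]).length ≤ (R.it n L).length := by
  rw [R.it_eq_sub n L, R.it_eq_sub n [a]]
  exact length_sub_cons_le a L ha

lemma Irred.reach (h : R.Irred) (a b : E) : ∃ j, 0 < cnt b (R.it j [(a, true)]) := by
  have h1 := h {b | ∃ j, 0 < cnt b (R.it j [(a, true)])} ⟨a, 0, by simp⟩ (by
    rintro c ⟨j, hj⟩ d hd
    obtain ⟨x, hx, hxc⟩ := (cnt_pos _).1 hj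
    refine ⟨j + 1, (cnt_pos _).2 ?_⟩
    rw [R.it_succ]
    have h2 : 0 < cnt d.1 (sub1 R.f x) := by
      rw [cnt_sub1, hxc]
      exact (cnt_pos _).2 ⟨d, hd, rfl⟩
    obtain ⟨y, hy, hyd⟩ := (cnt_pos _).1 h2
    exact ⟨y, (mem_sub _).2 ⟨x, hx, hy⟩, hyd⟩)
  have : b ∈ {b | ∃ j, 0 < cnt b (R.it j [(a, true)])} := by rw [h1]; trivial
  exact this

lemma Irred.exists_expanding [Finite E] (h : R.Irred) (hne : ∀ e, R.f e ≠ [])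
    (h2 : ∃ e, 2 ≤ (R.f e).length) : ∃ m, 0 < m ∧ ∀ a, 2 ≤ (R.it m [a]).length := by
  cases nonempty_fintype E
  obtain ⟨e, he⟩ := h2
  choose j hj using fun a => h.reach a e
  refine ⟨(∑ a, j a) + 1, by omega, fun a => ?_⟩
  obtain ⟨x, hx, hxe⟩ := (cnt_pos _).1 (hj a.1)
  rw [R.length_it]
  have h1 : j a.1 ≤ ∑ a, j a := Finset.single_le_sum (fun _ _ => Nat.zero_le _) (Finset.mem_univ a.1)
  refine le_trans ?_ (length_it_mono hne (show j a.1 + 1 ≤ _ by omega) _)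
  rw [add_comm, R.it_add]
  refine le_trans ?_ (length_it_mem hx)
  rw [R.it_succ, it_zero, sub_singleton, length_sub1, hxe]
  exact he

lemma Irred.comparable [Finite E] (h : R.Irred) : ∃ K : ℕ, 1 ≤ K ∧ ∀ n (a e : E × Bool),
    (R.it n [a]).length ≤ K * (R.it n [e]).length := by
  cases nonempty_fintype E
  obtain ⟨L, hL1, hL⟩ := exists_length_le R.f
  choose j hj using fun p : E × E => h.reach p.1 p.2
  have hs : ∀ p, L ^ j p ≤ ∑ p, L ^ j p :=
    fun p => Finset.single_le_sum (f := fun p => L ^ j p) (fun _ _ => Nat.zero_le _) (Finset.mem_univ p)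
  refine ⟨(∑ p, L ^ j p) + 1, by omega, fun n a e => ?_⟩
  obtain ⟨x, hx, hxe⟩ := (cnt_pos _).1 (hj (e.1, a.1))
  have h1 : (R.it n [a]).length ≤ (R.it n (R.it (j (e.1, a.1)) [(e.1, true)])).length := by
    have hxe' : x.1 = a.1 := hxe
    refine le_trans (le_of_eq ?_) (length_it_mem hx)
    rw [R.length_it, R.length_it n x, hxe']
  rw [← R.it_add, add_comm, R.it_add] at h1
  refine h1.trans ((length_it_le hL _ _).trans ?_)
  rw [← R.length_it n e]
  exact Nat.mul_le_mul_right _ ((hs _).trans (Nat.le_succ _))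

lemma it_eigen [Fintype E] {u : E → ℝ} {l : ℝ} (h : ∀ b, ∑ a, (cnt b (R.f a) : ℝ) * u a = l * u b)
    (n : ℕ) (b : E) : ∑ a, (cnt b (R.it n [(a, true)]) : ℝ) * u a = l ^ n * u b := by
  classical
  induction n generalizing b with
  | zero =>
    simp only [it_zero, cnt_singleton, pow_zero, one_mul]
    rw [Finset.sum_eq_single b] <;> simp +contextual
  | succ n ih =>
    have h1 : ∀ a, (cnt b (R.it (n + 1) [(a, true)]) : ℝ) * u a =
        ∑ c, (cnt b (R.f c) : ℝ) * ((cnt c (R.it n [(a, true)]) : ℝ) * u a) := by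
      intro a
      rw [R.it_succ, cnt_sub, Nat.cast_sum, Finset.sum_mul]
      refine Finset.sum_congr rfl fun c _ => ?_
      push_cast; ring
    simp only [h1]
    rw [Finset.sum_comm]
    simp only [← Finset.mul_sum, ih]
    calc ∑ c, (cnt b (R.f c) : ℝ) * (l ^ n * u c) = l ^ n * ∑ c, (cnt b (R.f c) : ℝ) * u c := by
          rw [Finset.mul_sum]; exact Finset.sum_congr rfl fun c _ => by ring
      _ = _ := by rw [h]; ring

lemma sum_length_it [Fintype E] {u : E → ℝ} {l : ℝ} (h : ∀ b, ∑ a, (cnt b (R.f a) : ℝ) * u a = l * u b)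
    (n : ℕ) : ∑ a, ((R.it n [(a, true)]).length : ℝ) * u a = l ^ n * ∑ b, u b := by
  rw [Finset.mul_sum]
  simp only [← it_eigen h n]
  rw [Finset.sum_comm]
  refine Finset.sum_congr rfl fun a _ => ?_
  rw [← sum_cnt, Nat.cast_sum, Finset.sum_mul]

end

variable {V E : Type} [Fintype E] {u : E → ℝ} {l : ℝ}

lemma Opt.length_bounds {F : Type*} [Group F] {φ : MulAut F} {R : Rep φ V E} (h : R.Opt u l) :
    ∃ K : ℝ, 0 < K ∧ ∀ n a, ((R.it n [a]).length : ℝ) ≤ K * l ^ n ∧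
      l ^ n ≤ K * (R.it n [a]).length := by
  obtain ⟨K, hK1, hK⟩ := h.irred.comparable
  have hne := h.ne
  have hpos : 0 < ∑ b, u b := Finset.sum_pos (fun e _ => h.wt.1 e) Finset.univ_nonempty
  have hsum : ∀ n, ∑ a, ((R.it n [(a, true)]).length : ℝ) * u a = l ^ n * ∑ b, u b := sum_length_it h.eigen
  have hK' : ∀ n (a e : E × Bool), ((R.it n [a]).length : ℝ) ≤ K * (R.it n [e]).length := by
    intro n a e; exact_mod_cast hK n a e
  refine ⟨K, by exact_mod_cast hK1, fun n a => ⟨?_, ?_⟩⟩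
  · refine le_of_mul_le_mul_right ?_ hpos
    rw [mul_assoc, ← hsum, Finset.mul_sum, Finset.mul_sum]
    refine Finset.sum_le_sum fun e _ => ?_
    rw [← mul_assoc]
    exact mul_le_mul_of_nonneg_right (hK' _ _ _) (h.wt.1 e).le
  · refine le_of_mul_le_mul_right ?_ hpos
    rw [← hsum, Finset.mul_sum]
    exact Finset.sum_le_sum fun e _ => mul_le_mul_of_nonneg_right (hK' _ _ _) (h.wt.1 e).le

variable {N : ℕ} {φ : MulAut (FreeGroup (Fin N))} {R : Rep φ V E}

lemma Opt.f_ne_nil (hN : 2 ≤ N) (h : R.Opt u l) (e : E) : R.f e ≠ [] := by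
  have : Nontrivial (FreeGroup (Fin N)) :=
    ⟨⟨FreeGroup.of ⟨0, by omega⟩, 1, FreeGroup.of_ne_one _⟩⟩
  exact h.irred.f_ne_nil e

lemma Opt.exists_expanding (hN : 2 ≤ N) (hφ : FI φ) (h : R.Opt u l) :
    ∃ m, 0 < m ∧ ∀ a, 2 ≤ (R.it m [a]).length :=
  h.irred.exists_expanding (h.f_ne_nil hN) (exists_two_le_length hN hφ R h.ne (h.f_ne_nil hN))

lemma Opt.one_lt (hN : 2 ≤ N) (hφ : FI φ) (h : R.Opt u l) : 1 < l := by
  obtain ⟨m, -, hm⟩ := h.exists_expanding hN hφ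
  obtain ⟨K, -, hK⟩ := h.length_bounds
  have e := h.ne.some
  by_contra hl
  have hgrow : ∀ k, 2 ^ k ≤ (R.it (k * m) [(e, true)]).length := by
    intro k
    induction k with
    | zero => simp
    | succ k ih =>
      rw [Nat.succ_mul, add_comm (k * m), R.it_add, R.it_eq_sub m (R.it _ _)]
      refine le_trans ?_ (le_length_sub (fun e => hm (e, true)) _)
      rw [pow_succ']
      exact Nat.mul_le_mul_left _ ih
  obtain ⟨k, hk⟩ := pow_unbounded_of_one_lt K (one_lt_two)
  have h1 := (hK (k * m) (e, true)).1
  have h2 : l ^ (k * m) ≤ 1 := pow_le_one₀ (h.wt.nonneg e) (not_lt.1 hl)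
  have h3 : (2 : ℝ) ^ k ≤ (R.it (k * m) [(e, true)]).length := by exact_mod_cast hgrow k
  have h4 : 0 ≤ K := by
    have := (hK 0 (e, true)).1
    simp at this
    linarith
  nlinarith

end Rep

/-! ### Directions -/

namespace Rep

section

variable {F V E : Type*} [Group F] {φ : MulAut F} (R : Rep φ V E)

/-- The derivative of the graph map: the first letter of the image of an oriented edge. -/
noncomputable def D (a : E × Bool) : E × Bool := ((sub1 R.f a).head?).getD a

variable {R}

lemma sub1_ne_nil (hne : ∀ e, R.f e ≠ []) (a : E × Bool) : sub1 R.f a ≠ [] := by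
  rcases a with ⟨e, _ | _⟩
  · simpa [invRev_eq_nil] using hne e
  · simpa using hne e

lemma D_eq {a x : E × Bool} {L : List (E × Bool)} (h : sub1 R.f a = x :: L) : R.D a = x := by
  simp [D, h]

lemma sub1_eq_D (hne : ∀ e, R.f e ≠ []) (a : E × Bool) : ∃ L, sub1 R.f a = R.D a :: L := by
  obtain ⟨x, L, h⟩ := List.exists_cons_of_ne_nil (sub1_ne_nil hne a)
  exact ⟨L, by rw [D_eq h, h]⟩

lemma o_D (hne : ∀ e, R.f e ≠ []) (a : E × Bool) : R.o (R.D a) = R.fV (R.o a) := by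
  obtain ⟨L, h⟩ := sub1_eq_D hne a
  have := R.isPath_sub1 a
  rw [h] at this
  exact this.1

lemma o_D_iter (hne : ∀ e, R.f e ≠ []) (n : ℕ) (a : E × Bool) :
    R.o (R.D^[n] a) = R.fV^[n] (R.o a) := by
  induction n with
  | zero => rfl
  | succ n ih => rw [Function.iterate_succ_apply', Function.iterate_succ_apply', o_D hne, ih]

lemma it_eq_D (hne : ∀ e, R.f e ≠ []) (n : ℕ) (a : E × Bool) :
    ∃ L, R.it n [a] = R.D^[n] a :: L := by
  induction n with
  | zero => exact ⟨[], rfl⟩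
  | succ n ih =>
    obtain ⟨L, hL⟩ := ih
    obtain ⟨M, hM⟩ := sub1_eq_D hne (R.D^[n] a)
    exact ⟨M ++ sub R.f L, by rw [R.it_succ, hL, sub_cons, hM, Function.iterate_succ_apply']; rfl⟩

/-! #### Directions under subdivision -/

variable {e₀ : E} {w₁ w₂ : List (E × Bool)} (hw : R.f e₀ = w₁ ++ w₂)

lemma D_subdivide (hne : ∀ e, R.f e ≠ []) (h₁ : w₁ ≠ []) (h₂ : w₂ ≠ []) (a : E × Bool) :
    (R.subdivide e₀ w₁ w₂ hw).D (cutD e₀ a) = cutD e₀ (R.D a) := by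
  obtain ⟨L, hL⟩ := sub1_cut e₀ a
  obtain ⟨M, hM⟩ := sub1_eq_D hne a
  obtain ⟨K, hK⟩ := sub1_cut e₀ (R.D a)
  obtain ⟨J, hJ⟩ := sub1_eq_D (R.subdivide_f_ne_nil e₀ w₁ w₂ hw hne h₁ h₂) (cutD e₀ a)
  have h := R.sub_cutF e₀ w₁ w₂ hw [a]
  rw [sub_singleton, hL, sub_singleton, hM, sub_cons, sub_cons, hK, ← R.subdivide_f e₀ w₁ w₂ hw, hJ] at h
  simpa using congrArg List.head? h

lemma D_iter_subdivide (hne : ∀ e, R.f e ≠ []) (h₁ : w₁ ≠ []) (h₂ : w₂ ≠ []) (n : ℕ)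
    (a : E × Bool) : (R.subdivide e₀ w₁ w₂ hw).D^[n] (cutD e₀ a) = cutD e₀ (R.D^[n] a) := by
  induction n with
  | zero => rfl
  | succ n ih => rw [Function.iterate_succ_apply', Function.iterate_succ_apply', ih, D_subdivide hw hne h₁ h₂]

lemma fV_iter_subdivide (n : ℕ) (v : V) :
    (R.subdivide e₀ w₁ w₂ hw).fV^[n] (some v) = some (R.fV^[n] v) := by
  induction n with
  | zero => rfl
  | succ n ih => rw [Function.iterate_succ_apply', Function.iterate_succ_apply', ih, subdivide_fV_some]

lemma exists_split {a : E × Bool} {p s : List (E × Bool)} (h : sub1 R.f a = p ++ s) (hp : p ≠ [])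
    (hs : s ≠ []) : ∃ (w₁ w₂ : List (E × Bool)) (hw : R.f a.1 = w₁ ++ w₂), w₁ ≠ [] ∧ w₂ ≠ [] ∧
      sub1 (R.subdivide a.1 w₁ w₂ hw).f (cutD a.1 a) = sub (cut a.1) p := by
  rcases a with ⟨e, _ | _⟩
  · rw [sub1_false] at h
    have h' : R.f e = invRev s ++ invRev p := by rw [← invRev_append, ← h, invRev_invRev]
    refine ⟨invRev s, invRev p, h', by rwa [ne_eq, invRev_eq_nil], by rwa [ne_eq, invRev_eq_nil], ?_⟩
    simp [cutD, subdivide_f, cutF, sub_invRev, invRev_invRev]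
  · rw [sub1_true] at h
    refine ⟨p, s, h, hp, hs, ?_⟩
    simp [cutD, subdivide_f, cutF]

end

/-! ### Illegal turns at vertices of valence two -/

/-- The vertex at the origin of `d` has valence two, and its two directions `d` and `d'` are
identified by the `k + 1`-st iterate of the derivative, but not by the `k`-th one. -/
structure Bad {F V E : Type*} [Group F] {φ : MulAut F} (R : Rep φ V E) (k : ℕ) (d d' : E × Bool) :
    Prop where
  o_eq : R.o d = R.o d'
  val : ∀ x, R.o x = R.o d → x = d ∨ x = d'
  ne : R.D^[k] d ≠ R.D^[k] d'
  eq : R.D^[k + 1] d = R.D^[k + 1] d'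

section

variable {F V E : Type*} [Group F] {φ : MulAut F} {R : Rep φ V E} {k : ℕ} {d d' : E × Bool}

lemma Bad.symm (h : R.Bad k d d') : R.Bad k d' d :=
  ⟨h.o_eq.symm, fun x hx => (h.val x (hx.trans h.o_eq.symm)).symm, h.ne.symm, h.eq.symm⟩

lemma exists_bad (ho : R.o d = R.o d') (val : ∀ x, R.o x = R.o d → x = d ∨ x = d') (ne : d ≠ d')
    (eq : R.D^[k] d = R.D^[k] d') : ∃ j < k, R.Bad j d d' := by
  induction k with
  | zero => exact (ne eq).elim
  | succ k ih =>
    by_cases h : R.D^[k] d = R.D^[k] d'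
    · obtain ⟨j, hj, hb⟩ := ih h
      exact ⟨j, by omega, hb⟩
    · exact ⟨k, by omega, ho, val, h, eq⟩

lemma Bad.subdivide {e₀ : E} {w₁ w₂ : List (E × Bool)} (hw : R.f e₀ = w₁ ++ w₂)
    (hne : ∀ e, R.f e ≠ []) (h₁ : w₁ ≠ []) (h₂ : w₂ ≠ []) (h : R.Bad k d d') :
    (R.subdivide e₀ w₁ w₂ hw).Bad k (cutD e₀ d) (cutD e₀ d') where
  o_eq := by rw [subdivide_o, cutO_cutD, cutO_cutD, h.o_eq]
  val x hx := by
    rw [subdivide_o, cutO_cutD] at hx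
    obtain ⟨a, rfl, ha⟩ := cutO_eq_some e₀ R.o hx
    rcases h.val a ha with rfl | rfl
    · exact Or.inl rfl
    · exact Or.inr rfl
  ne := by
    rw [D_iter_subdivide hw hne h₁ h₂, D_iter_subdivide hw hne h₁ h₂]
    exact fun hh => h.ne (cutD_injective e₀ hh)
  eq := by
    rw [D_iter_subdivide hw hne h₁ h₂, D_iter_subdivide hw hne h₁ h₂, h.eq]

/-- The terminal vertex of `d` is not the `k`-th image of its origin. -/
def Apart (R : Rep φ V E) (k : ℕ) (d : E × Bool) : Prop := R.o (bar d) ≠ R.fV^[k] (R.o d)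

lemma apart_subdivide_of_eq {e₀ : E} {w₁ w₂ : List (E × Bool)} (hw : R.f e₀ = w₁ ++ w₂)
    (h : d.1 = e₀) : (R.subdivide e₀ w₁ w₂ hw).Apart k (cutD e₀ d) := by
  rw [Apart, subdivide_o, cutO_bar_cutD_of_eq e₀ R.o h, cutO_cutD, fV_iter_subdivide]
  simp

lemma Apart.subdivide {e₀ : E} {w₁ w₂ : List (E × Bool)} (hw : R.f e₀ = w₁ ++ w₂)
    (h : R.Apart k d) : (R.subdivide e₀ w₁ w₂ hw).Apart k (cutD e₀ d) := by
  by_cases hd : d.1 = e₀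
  · exact apart_subdivide_of_eq hw hd
  · rw [Apart, subdivide_o, cutO_bar_cutD_of_ne e₀ R.o hd, cutO_cutD, fV_iter_subdivide]
    exact fun hh => h (Option.some_injective _ hh)

end

section

variable {V E : Type} [Fintype E] {u : E → ℝ} {l : ℝ} {N : ℕ} {φ : MulAut (FreeGroup (Fin N))}
  {R : Rep φ V E} {k : ℕ} {d d' : E × Bool}

lemma Opt.subdivide (hN : 2 ≤ N) (h : R.Opt u l) {e₀ : E} {w₁ w₂ : List (E × Bool)}
    (hw : R.f e₀ = w₁ ++ w₂) (h₁ : w₁ ≠ []) (h₂ : w₂ ≠ []) :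
    (R.subdivide e₀ w₁ w₂ hw).Opt (fun x => u (uncut e₀ x)) l :=
  ⟨inferInstance, R.subdivide_irred e₀ w₁ w₂ hw h.irred (h.f_ne_nil hN) h₁ h₂,
    R.subdivide_wt e₀ w₁ w₂ hw h.wt, h.min⟩

lemma Bad.exists_apart (hN : 2 ≤ N) (h : R.Opt u l) (hb : R.Bad k d d') {m : ℕ}
    (hm : 2 ≤ (R.it m [d]).length) : ∃ (V' E' : Type) (_ : Fintype E') (R' : Rep φ V' E')
      (u' : E' → ℝ) (d₁ d₁' : E' × Bool), R'.Opt u' l ∧ R'.Bad k d₁ d₁' ∧ R'.Apart k d₁ ∧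
        (R.Apart k d' → R'.Apart k d₁') := by
  induction m generalizing V E with
  | zero => simp at hm
  | succ m ih =>
    by_cases h2 : 2 ≤ (R.it m [d]).length
    · exact ih h hb h2
    have h1 : (R.it m [d]).length = 1 := by
      have := length_le_it (h.f_ne_nil hN) m [d]
      simp only [List.length_singleton] at this
      omega
    obtain ⟨y, hy⟩ := List.length_eq_one_iff.1 h1
    rw [R.it_succ, hy, sub_singleton, length_sub1] at hm
    obtain ⟨x, L, hxL⟩ := List.exists_cons_of_ne_nil (h.f_ne_nil hN y.1)
    have hw : R.f y.1 = [x] ++ L := hxL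
    have hL : L ≠ [] := by
      rintro rfl
      simp [hxL] at hm
    have hopt := h.subdivide hN hw (by simp) hL
    have hbad := hb.subdivide hw (h.f_ne_nil hN) (by simp) hL
    by_cases hd : d.1 = y.1
    · exact ⟨_, _, _, _, _, _, _, hopt, hbad, apart_subdivide_of_eq hw hd, fun h => h.subdivide hw⟩
    · obtain ⟨V', E', i, R', u', d₁, d₁', r1, r2, r3, r4⟩ := ih hopt hbad (by
        rw [← sub1_cut_of_ne y.1 hd, ← sub_singleton, it_subdivide, hy, sub_singleton,
          sub1_cut_of_eq y.1 rfl]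
        simp)
      exact ⟨V', E', i, R', u', d₁, d₁', r1, r2, r3, fun h => r4 (h.subdivide hw)⟩

/-- A representative of minimal factor has no vertex of valence one. -/
lemma Opt.exists_ne (hN : 2 ≤ N) (h : R.Opt u l) (c : E × Bool) : ∃ x, x ≠ c ∧ R.o x = R.o c := by
  classical
  by_contra hcon
  push Not at hcon
  have hval : ∀ x, R.o x = R.o c → x = c := fun x hx => by
    by_contra hne
    exact hcon x hne hx
  have hc : R.o c ≠ R.o (bar c) := fun hh => bar_ne c (hval _ hh.symm)
  obtain ⟨x, hx⟩ := List.exists_mem_of_ne_nil _ (h.f_ne_nil hN c.1)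
  obtain ⟨μ, hμ, v, hv, hw⟩ := exists_smaller_factor (M := fun b a => cnt b (R.f a))
    (M' := fun b a => if a = c.1 then 0 else cnt b (R.f a)) h.irred.mIrr
    (fun b a => by split_ifs <;> simp) h.wt.1 h.wt.2 ⟨x.1, by
      refine lt_of_lt_of_le ?_ (h.wt.2 x.1)
      refine Finset.sum_lt_sum (fun a _ => mul_le_mul_of_nonneg_right ?_ (h.wt.1 a).le)
        ⟨c.1, Finset.mem_univ _, mul_lt_mul_of_pos_right ?_ (h.wt.1 _)⟩
      · split_ifs <;> simp
      · rw [if_pos rfl]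
        exact_mod_cast (cnt_pos _).2 ⟨x, hx, rfl⟩⟩
  have hw' : (R.collapse hc).Wt (fun e => v e.1) μ := by
    refine R.collapse_wt hc (κ := 0) (fun e _ => hv e) (le_of_eq (Finset.sum_eq_zero fun e _ => ?_))
      fun b _ => ?_
    · split_ifs with h1 h2 h3 h3
      · rfl
      · exact (h1 (congrArg Prod.fst (hval _ h2))).elim
      · exact (h1 (congrArg Prod.fst (hval _ h2))).elim
      · exact (h1 (congrArg Prod.fst (hval _ h3))).elim
      · simp
    · rw [mul_zero, add_zero]
      refine le_trans (le_of_eq (Finset.sum_congr rfl fun e _ => ?_)) (hw b)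
      split_ifs <;> simp
  have : Nonempty {x // x ≠ R.o c} := ⟨⟨_, hc.symm⟩⟩
  exact not_lt.2 (h.min _ _ (R.collapse hc) _ μ hw') hμ

end

end Rep

namespace Rep

section

variable {F V E : Type*} [Group F] {φ : MulAut F} {R : Rep φ V E} {a b : E × Bool}
  (hab : a.1 ≠ b.1) (ho : R.o a = R.o b) (hv : R.o (bar b) ≠ R.o b)
  (hvw : R.o (bar b) ≠ R.o (bar a)) (hf : sub1 R.f a = sub1 R.f b)

lemma fold_o_foldL (x : E × Bool) :
    (R.fold hab ho hv hvw hf).o (foldL hab x) = foldV hvw (R.o x) := by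
  by_cases h : x.1 = b.1
  · rcases eq_or_eq_bar h with rfl | rfl
    · rw [foldL_right, fold_o, ← ho]
    · rw [foldL_bar, foldL_right, fold_o, foldV_left]
      exact foldV_of_ne hvw hvw.symm
  · rw [foldL_of_ne hab (x := x) h, fold_o]

lemma D_fold (hne : ∀ e, R.f e ≠ []) (x : E × Bool) :
    (R.fold hab ho hv hvw hf).D (foldL hab x) = foldL hab (R.D x) := by
  obtain ⟨L, hL⟩ := sub1_eq_D hne x
  refine D_eq (L := L.map (foldL hab)) ?_
  rw [sub1_fold, hL, List.map_cons]

lemma D_iter_fold (hne : ∀ e, R.f e ≠ []) (n : ℕ) (x : E × Bool) :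
    (R.fold hab ho hv hvw hf).D^[n] (foldL hab x) = foldL hab (R.D^[n] x) := by
  induction n with
  | zero => rfl
  | succ n ih => rw [Function.iterate_succ_apply', Function.iterate_succ_apply', ih, D_fold _ _ _ _ _ hne]

lemma o_of_foldV {hvw : R.o (bar b) ≠ R.o (bar a)} {x : E × Bool} {v : V} (hv' : v ≠ R.o (bar b))
    (hva : v ≠ R.o (bar a)) (h : foldV hvw (R.o x) = foldV hvw v) : R.o x = v := by
  rw [foldV_of_ne hvw hv'] at h
  by_cases h1 : R.o x = R.o (bar b)
  · rw [h1, foldV_left, Subtype.mk.injEq] at h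
    exact (hva h.symm).elim
  · rw [foldV_of_ne hvw h1, Subtype.mk.injEq] at h
    exact h

end

section

variable {V E : Type} [Fintype E] {u : E → ℝ} {l : ℝ} {N : ℕ} {φ : MulAut (FreeGroup (Fin N))}
  {R : Rep φ V E} {k : ℕ} {d d' : E × Bool}

open Classical in
lemma Opt.fold (h : R.Opt u l) {a b : E × Bool}
    (hab : a.1 ≠ b.1) (ho : R.o a = R.o b) (hv : R.o (bar b) ≠ R.o b)
    (hvw : R.o (bar b) ≠ R.o (bar a)) (hf : sub1 R.f a = sub1 R.f b) :
    (R.fold hab ho hv hvw hf).Opt (fun e => u e.1 + if e.1 = a.1 then u b.1 else 0) l :=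
  ⟨⟨⟨a.1, hab⟩⟩, fold_irred R hab ho hv hvw hf h.irred, fold_wt R hab ho hv hvw hf h.wt, h.min⟩

/-- Two distinct edges with the same image are not inverse to each other. -/
lemma Opt.fst_ne_of_sub1_eq (hN : 2 ≤ N) (h : R.Opt u l) {a b : E × Bool} (hab : a ≠ b)
    (hf : sub1 R.f a = sub1 R.f b) : a.1 ≠ b.1 := by
  intro h1
  rcases eq_or_eq_bar h1 with rfl | rfl
  · exact hab rfl
  have h2 : R.f b.1 = invRev (R.f b.1) := by
    rcases b with ⟨e, _ | _⟩
    · simpa [bar, invRev_invRev] using hf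
    · simpa [bar] using hf.symm
  have h3 : FreeGroup.mk (R.f b.1) ^ 2 = 1 ^ 2 := by
    nth_rw 1 [pow_two, h2]
    rw [one_pow, ← FreeGroup.inv_mk, inv_mul_cancel]
  have h4 : FreeGroup.mk (R.f b.1) = 1 := (pow_left_inj two_ne_zero).1 h3
  rw [mk_eq_one_iff, red_eq_self.2 (h.tight _)] at h4
  exact h.f_ne_nil hN _ h4

omit [Fintype E] in
/-- Two distinct edges with the same origin and the same image have distinct ends. -/
lemma Opt.o_bar_ne_of_sub1_eq {a b : E × Bool} (hab : a ≠ b)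
    (ho : R.o a = R.o b) (hf : sub1 R.f a = sub1 R.f b) : R.o (bar a) ≠ R.o (bar b) := by
  intro h1
  have hp : IsPath R.o (R.o (bar a)) [bar a, b] (R.o (bar a)) := by
    simp [ho, h1]
  have h2 := R.lab_map hp
  have h3 : lab R.r (sub R.f [bar a, b]) = 1 := by
    simp only [sub_cons, sub_nil, List.append_nil, sub1_bar, hf]
    rw [lab_append, lab_invRev, inv_mul_cancel]
  rw [h3] at h2
  have h4 : φ (lab R.r [bar a, b]) = 1 := by
    have := congrArg (fun g => R.h (R.o (bar a)) * g * (R.h (R.o (bar a)))⁻¹) h2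
    simpa [mul_assoc] using this.symm
  have h5 : lab R.r [bar a, b] = 1 := by simpa using h4
  have h6 := R.marked.inj _ _ hp h5
  have h7 : FreeGroup.IsReduced [bar a, b] := isReduced_cons_cons.2 ⟨by simpa using hab.symm, by simp⟩
  rw [mk_eq_one_iff, red_eq_self.2 h7] at h6
  simp at h6

/-- No representative with factor `l` has an illegal turn at a vertex of valence two which is
identified before the `k + 1`-st iterate. -/
def NoBad (φ : MulAut (FreeGroup (Fin N))) (l : ℝ) (k : ℕ) : Prop :=
  ∀ j < k, ∀ (V E : Type) (_ : Fintype E) (R : Rep φ V E) (u : E → ℝ) (d d' : E × Bool),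
    R.Opt u l → ¬ R.Bad j d d'

lemma Bad.false_of_fold (hN : 2 ≤ N) (hk : NoBad φ l k) (h : R.Opt u l) (hb : R.Bad k d d')
    (h₁ : R.Apart k d) (h₂ : R.Apart k d') {a b : E × Bool} (ha : R.D^[k] d = a)
    (hb' : R.D^[k] d' = b) (hf : sub1 R.f a = sub1 R.f b) (hv : R.o (bar b) ≠ R.o b) : False := by
  classical
  have hne := h.f_ne_nil hN
  have hne' : a ≠ b := ha ▸ hb' ▸ hb.ne
  have hab := h.fst_ne_of_sub1_eq hN hne' hf
  have hP : R.o a = R.fV^[k] (R.o d) := by rw [← o_D_iter hne k d, ha]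
  have hP' : R.o b = R.fV^[k] (R.o d') := by rw [← o_D_iter hne k d', hb']
  have ho : R.o a = R.o b := by rw [hP, hP', hb.o_eq]
  have hvw := (Opt.o_bar_ne_of_sub1_eq hne' ho hf).symm
  have hopt := h.fold hab ho hv hvw hf
  obtain rfl | hk0 := Nat.eq_zero_or_pos k
  · simp only [Function.iterate_zero, id] at ha hb'
    subst ha hb'
    obtain ⟨x, hx, hxo⟩ := hopt.exists_ne hN (foldL hab d)
    rw [← foldL_surj hab x, fold_o_foldL, fold_o_foldL] at hxo
    have h3 := o_of_foldV (by rw [ho]; exact hv.symm) h₁.symm hxo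
    rcases hb.val _ h3 with h4 | h4
    · exact hx (by rw [← foldL_surj hab x, h4])
    · exact x.1.2 (congrArg Prod.fst h4)
  · have hPQ : R.o d ≠ R.o a := by
      intro hPQ
      have e1 := hb.val a hPQ.symm
      have e2 := hb.val b (ho.symm.trans hPQ.symm)
      have e3 : R.D a = R.D b := by
        have := hb.eq
        rwa [Function.iterate_succ_apply', Function.iterate_succ_apply', ha, hb'] at this
      have e4 : R.D d = R.D d' := by
        rcases e1 with rfl | rfl <;> rcases e2 with rfl | rfl
        · exact (hne' rfl).elim
        · exact e3
        · exact e3.symm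
        · exact (hne' rfl).elim
      refine hb.ne ?_
      obtain ⟨j, rfl⟩ := Nat.exists_eq_add_of_lt hk0
      rw [Function.iterate_succ_apply, Function.iterate_succ_apply, e4]
    have hApart : ∀ c, R.o c = R.o a → R.o d ≠ R.o (bar c) := by
      intro c hc hh
      rcases hb.val _ hh.symm with h3 | h3
      · refine h₁ ?_
        rw [← hP, ← h3, bar_bar, hc]
      · refine h₂ ?_
        rw [← hP', ← h3, bar_bar, hc, ho]
    have key : ∀ c, R.o c = R.o d → c.1 ≠ b.1 := by
      intro c hc h3
      rcases eq_or_eq_bar h3 with rfl | rfl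
      · exact hPQ (hc.symm.trans ho.symm)
      · exact hApart b ho.symm hc.symm
    obtain ⟨j, hj, hbad⟩ := exists_bad (R := R.fold hab ho hv hvw hf) (k := k) (d := foldL hab d)
      (d' := foldL hab d') (by rw [fold_o_foldL, fold_o_foldL, hb.o_eq]) (by
        intro x hx
        rw [← foldL_surj hab x, fold_o_foldL, fold_o_foldL] at hx
        have h3 := o_of_foldV (hApart b ho.symm) (hApart a rfl) hx
        rw [← foldL_surj hab x]
        exact (hb.val _ h3).imp (congrArg _) (congrArg _)) (by
        intro hh
        rw [foldL_of_ne hab (x := d) (key d rfl), foldL_of_ne hab (x := d') (key d' hb.o_eq.symm)] at hh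
        have h4 : d = d' := Prod.ext (congrArg (fun x => x.1.1) hh) (congrArg (fun x => x.2) hh)
        exact hb.ne (by rw [h4])) (by
        rw [D_iter_fold _ _ _ _ _ hne, D_iter_fold _ _ _ _ _ hne, ha, hb',
          foldL_of_ne hab hab, foldL_right])
    exact hk j hj _ _ _ _ _ _ _ hopt hbad

lemma Bad.false_of_eq (hN : 2 ≤ N) (hk : NoBad φ l k) (h : R.Opt u l) (hb : R.Bad k d d')
    (h₁ : R.Apart k d) (h₂ : R.Apart k d')
    (hf : sub1 R.f (R.D^[k] d) = sub1 R.f (R.D^[k] d')) : False := by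
  by_cases hv : R.o (bar (R.D^[k] d')) = R.o (R.D^[k] d')
  · have hne := h.f_ne_nil hN
    have ho : R.o (R.D^[k] d) = R.o (R.D^[k] d') := by rw [o_D_iter hne, o_D_iter hne, hb.o_eq]
    refine hb.symm.false_of_fold hN hk h h₂ h₁ rfl rfl hf.symm ?_
    rw [ho, ← hv]
    exact Opt.o_bar_ne_of_sub1_eq hb.ne ho hf
  · exact hb.false_of_fold hN hk h h₁ h₂ rfl rfl hf hv

lemma Bad.false_of_append (hN : 2 ≤ N) (hk : NoBad φ l k) (h : R.Opt u l) (hb : R.Bad k d d')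
    (h₁ : R.Apart k d) (h₂ : R.Apart k d') {t : List (E × Bool)}
    (hf : sub1 R.f (R.D^[k] d') = sub1 R.f (R.D^[k] d) ++ t) : False := by
  classical
  have hne := h.f_ne_nil hN
  by_cases ht : t = []
  · rw [ht, List.append_nil] at hf
    exact hb.false_of_eq hN hk h h₁ h₂ hf.symm
  obtain ⟨w₁, w₂, hw, hw₁, hw₂, hs⟩ := exists_split hf (sub1_ne_nil hne _) ht
  have hab : (R.D^[k] d).1 ≠ (R.D^[k] d').1 := by
    intro hh
    have h1 := congrArg List.length hf
    rw [List.length_append, length_sub1, length_sub1, hh] at h1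
    exact ht (List.length_eq_zero_iff.1 (by omega))
  refine (hb.subdivide hw hne hw₁ hw₂).false_of_eq hN hk (h.subdivide hN hw hw₁ hw₂)
    (h₁.subdivide hw) (h₂.subdivide hw) ?_
  rw [D_iter_subdivide hw hne hw₁ hw₂, D_iter_subdivide hw hne hw₁ hw₂, hs]
  have := R.sub_cutF _ _ _ hw [R.D^[k] d]
  rwa [sub_singleton, sub1_cut_of_ne _ hab, sub_singleton, sub_singleton] at this

lemma Bad.false_of_apart (hN : 2 ≤ N) (hk : NoBad φ l k) (h : R.Opt u l) (hb : R.Bad k d d')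
    (h₁ : R.Apart k d) (h₂ : R.Apart k d') : False := by
  classical
  have hne := h.f_ne_nil hN
  obtain ⟨s, hs⟩ := sub1_eq_D hne (R.D^[k] d)
  obtain ⟨t, ht⟩ := sub1_eq_D hne (R.D^[k] d')
  have hx : R.D (R.D^[k] d) = R.D (R.D^[k] d') := by
    rw [← Function.iterate_succ_apply' R.D k d, ← Function.iterate_succ_apply' R.D k d']
    exact hb.eq
  rw [← hx] at ht
  by_cases hs0 : s = []
  · refine hb.false_of_append hN hk h h₁ h₂ (t := t) ?_
    rw [hs, hs0, ht]
    rfl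
  obtain ⟨w₁, w₂, hw, hw₁, hw₂, hs'⟩ := exists_split (R := R) (p := [R.D (R.D^[k] d)]) hs (by simp) hs0
  have key : ∃ t', sub1 (R.subdivide _ w₁ w₂ hw).f (cutD (R.D^[k] d).1 (R.D^[k] d')) =
      sub (cut (R.D^[k] d).1) [R.D (R.D^[k] d)] ++ t' := by
    by_cases hab : (R.D^[k] d').1 = (R.D^[k] d).1
    · rcases eq_or_eq_bar hab with h1 | h1
      · exact (hb.ne h1.symm).elim
      · rw [h1, sub1_bar, hs] at ht
        rw [h1]
        have h2 := R.sub_cutF _ _ _ hw [R.D^[k] d]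
        rw [sub_singleton, sub1_cut_of_eq _ rfl, sub_cons, sub_singleton, sub_singleton, hs,
          ← R.subdivide_f _ w₁ w₂ hw, hs', ← List.singleton_append (l := s), sub_append,
          List.append_cancel_left_eq, sub1_bar] at h2
        have h3 := congrArg invRev h2
        rw [invRev_invRev, ← sub_invRev] at h3
        rw [h3]
        obtain ⟨z, r, hr⟩ := List.exists_cons_of_ne_nil (l := invRev s) (by rwa [ne_eq, invRev_eq_nil])
        rw [invRev_cons, hr, List.cons_append, List.cons.injEq] at ht
        rw [hr, ht.1]
        exact ⟨sub (cut (R.D^[k] d).1) r, by rw [← sub_append]; rfl⟩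
    · have h2 := R.sub_cutF _ _ _ hw [R.D^[k] d']
      rw [sub_singleton, sub1_cut_of_ne _ hab, sub_singleton, sub_singleton, ht] at h2
      exact ⟨sub (cut (R.D^[k] d).1) t, by rw [← sub_append]; exact h2⟩
  obtain ⟨t', ht'⟩ := key
  refine (hb.subdivide hw hne hw₁ hw₂).false_of_append hN hk (h.subdivide hN hw hw₁ hw₂)
    (h₁.subdivide hw) (h₂.subdivide hw) (t := t') ?_
  rw [D_iter_subdivide hw hne hw₁ hw₂, D_iter_subdivide hw hne hw₁ hw₂, hs', ht']

lemma noBad (hN : 2 ≤ N) (hφ : FI φ) (k : ℕ) : NoBad φ l k := by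
  induction k with
  | zero => exact fun j hj => (Nat.not_lt_zero j hj).elim
  | succ k ih =>
    intro j hj V E _ R u d d' h hb
    obtain hj | rfl := Nat.lt_succ_iff_lt_or_eq.1 hj
    · exact ih j hj _ _ _ _ _ _ _ h hb
    obtain ⟨m, _, hm⟩ := h.exists_expanding hN hφ
    obtain ⟨V₁, E₁, _, R₁, u₁, d₁, d₁', h₁, hb₁, ha₁, -⟩ := hb.exists_apart hN h (hm d)
    obtain ⟨m, _, hm⟩ := h₁.exists_expanding hN hφ
    obtain ⟨V₂, E₂, _, R₂, u₂, d₂, d₂', h₂, hb₂, ha₂, ha₂'⟩ := hb₁.symm.exists_apart hN h₁ (hm d₁')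
    exact hb₂.false_of_apart hN ih h₂ ha₂ (ha₂' ha₁)

/-! ### The train track property -/

omit [Fintype E] in
lemma exists_turn (hne : ∀ e, R.f e ≠ []) {m : ℕ} (hm : ∀ y, FreeGroup.IsReduced (R.it m [y]))
    {L : List (E × Bool)} (hL : ¬ FreeGroup.IsReduced (R.it m L)) :
    ∃ L₁ y z L₂, L = L₁ ++ y :: z :: L₂ ∧ R.D^[m] (bar y) = R.D^[m] z := by
  induction L with
  | nil => simp [it_nil] at hL
  | cons y L ih =>
    by_cases h : FreeGroup.IsReduced (R.it m L)
    · rw [it_cons, isReduced_append_iff] at hL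
      push Not at hL
      obtain ⟨a, ha, b, hb, hab⟩ := hL (hm y) h
      cases L with
      | nil => simp [it_nil] at hb
      | cons z L =>
        refine ⟨[], y, z, L, rfl, ?_⟩
        obtain ⟨M, hM⟩ := it_eq_D hne m z
        obtain ⟨M', hM'⟩ := it_eq_D hne m (bar y)
        rw [it_cons, hM] at hb
        simp only [List.cons_append, List.head?_cons, Option.mem_some_iff] at hb
        have h1 : R.it m [y] = invRev (R.it m [bar y]) := by
          rw [← it_invRev, invRev_singleton, bar_bar]
        rw [h1, hM', invRev_cons] at ha
        simp only [List.getLast?_append, List.getLast?_singleton, Option.some_or, Option.mem_some_iff] at ha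
        rw [hb, hab, ← ha, bar_bar]
    · obtain ⟨L₁, y', z, L₂, rfl, h1⟩ := ih h
      exact ⟨y :: L₁, y', z, L₂, rfl, h1⟩

/-- A representative of minimal factor is a train track map. -/
theorem Opt.isReduced_it (hN : 2 ≤ N) (hφ : FI φ) (h : R.Opt u l) (n : ℕ) (a : E × Bool) :
    FreeGroup.IsReduced (R.it n [a]) := by
  classical
  have hne := h.f_ne_nil hN
  induction n generalizing a with
  | zero => simp
  | succ n ih =>
    by_contra hcon
    have hcon' : ¬ FreeGroup.IsReduced (R.it n (R.f a.1)) := by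
      intro hh
      apply hcon
      rw [it_succ', sub_singleton]
      rcases a with ⟨e, _ | _⟩
      · rw [sub1_false, it_invRev]
        exact isReduced_invRev hh
      · rwa [sub1_true]
    obtain ⟨L₁, y, z, L₂, hL, hyz⟩ := exists_turn hne ih hcon'
    have hw : R.f a.1 = (L₁ ++ [y]) ++ (z :: L₂) := by rw [hL]; simp
    have hzy : z ≠ bar y := by
      have := h.tight a.1
      rw [hw, isReduced_append_iff] at this
      exact this.2.2 y (by simp) z (by simp)
    have h₁ : L₁ ++ [y] ≠ [] := by simp
    have h₂ : z :: L₂ ≠ [] := by simp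
    have hopt := h.subdivide hN hw h₁ h₂
    have hne' := hopt.f_ne_nil hN
    have hD1 : (R.subdivide a.1 _ _ hw).D (some a.1, false) = cutD a.1 (bar y) := by
      obtain ⟨M, hM⟩ := sub1_cut a.1 (bar y)
      refine D_eq (L := M ++ invRev (sub (cut a.1) L₁)) ?_
      rw [sub1_false, subdivide_f, cutF, if_pos rfl, sub_append, sub_singleton, invRev_append,
        ← sub1_bar, hM]
      rfl
    have hD2 : (R.subdivide a.1 _ _ hw).D (none, true) = cutD a.1 z := by
      obtain ⟨M, hM⟩ := sub1_cut a.1 z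
      refine D_eq (L := M ++ sub (cut a.1) L₂) ?_
      rw [sub1_true, subdivide_f, cutF, sub_cons, hM]
      rfl
    obtain ⟨j, -, hbad⟩ := exists_bad (R := R.subdivide a.1 _ _ hw) (k := n + 1)
      (d := (some a.1, false)) (d' := (none, true)) (by simp [subdivide_o, cutO]) (by
        intro x hx
        refine (cutO_eq_none a.1 R.o).1 ?_
        rw [subdivide_o] at hx
        rw [hx]
        simp [cutO]) (by simp) (by
        rw [Function.iterate_succ_apply, Function.iterate_succ_apply, hD1, hD2,
          D_iter_subdivide hw hne h₁ h₂, D_iter_subdivide hw hne h₁ h₂, hyz])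
    exact noBad hN hφ (j + 1) j (Nat.lt_succ_self j) _ _ _ _ _ _ _ hopt hbad

end

end Rep

/-! ### Bounded cancellation -/

section

variable {E E' V : Type*}

lemma mk_eq_of_red {L M : List (E × Bool)} (h : FreeGroup.Red L M) :
    FreeGroup.mk L = FreeGroup.mk M :=
  FreeGroup.Red.exact.2 ⟨M, h, Relation.ReflTransGen.refl⟩

lemma exists_cancel {p q : List (E × Bool)} (hp : FreeGroup.IsReduced p)
    (hq : FreeGroup.IsReduced q) : ∃ p' t q', p = p' ++ t ∧ q = invRev t ++ q' ∧
      FreeGroup.IsReduced (p' ++ q') := by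
  induction q generalizing p with
  | nil => exact ⟨p, [], [], by simp, by simp, by simpa⟩
  | cons b q ih =>
    by_cases h : FreeGroup.IsReduced (p ++ b :: q)
    · exact ⟨p, [], b :: q, by simp, by simp, h⟩
    · rw [isReduced_append_iff] at h
      push Not at h
      obtain ⟨a, ha, b', hb, hab⟩ := h hp hq
      simp only [List.head?_cons, Option.mem_some_iff] at hb
      obtain ⟨p₀, rfl⟩ := List.getLast?_eq_some_iff.1 ha
      obtain ⟨p', t, q', h1, h2, h3⟩ := ih (p := p₀) (hp.subword ⟨[], [a], by simp⟩) (hq.subword ⟨[b], [], by simp⟩)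
      exact ⟨p', t ++ [a], q', by rw [h1, List.append_assoc], by
        rw [h2, invRev_append, invRev_singleton, ← hab, ← hb]; rfl, h3⟩

variable {G : E → List (E' × Bool)} {K : ℕ}

lemma exists_split_sub (hK : ∀ e, (G e).length ≤ K) {U : List (E × Bool)} {L M : List (E' × Bool)}
    (h : sub G U = L ++ M) : ∃ U₁ U₂ c, U = U₁ ++ U₂ ∧ M = c ++ sub G U₂ ∧ c.length ≤ K := by
  induction U generalizing L with
  | nil =>
    have : M = [] := by
      have := h.symm
      rw [sub_nil, List.append_eq_nil_iff] at this
      exact this.2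
    exact ⟨[], [], [], rfl, by simp [this], by simp⟩
  | cons a U ih =>
    rw [sub_cons, List.append_eq_append_iff] at h
    rcases h with ⟨z, h1, h2⟩ | ⟨z, h1, h2⟩
    · obtain ⟨U₁, U₂, c, rfl, h3, h4⟩ := ih h2
      exact ⟨a :: U₁, U₂, c, rfl, h3, h4⟩
    · refine ⟨[a], U, z, rfl, h2, ?_⟩
      have := congrArg List.length h1
      rw [length_sub1, List.length_append] at this
      have := hK a.1
      omega

lemma exists_split_sub' (hK : ∀ e, (G e).length ≤ K) {U : List (E × Bool)} {L M : List (E' × Bool)}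
    (h : sub G U = L ++ M) : ∃ U₁ U₂ c, U = U₁ ++ U₂ ∧ L = sub G U₁ ++ c ∧ c.length ≤ K := by
  have h' := congrArg invRev h
  rw [← sub_invRev, invRev_append] at h'
  obtain ⟨U₁, U₂, c, h1, h2, h3⟩ := exists_split_sub hK h'
  refine ⟨invRev U₂, invRev U₁, invRev c, ?_, ?_, by rwa [FreeGroup.invRev_length]⟩
  · rw [← invRev_append, ← h1, invRev_invRev]
  · rw [sub_invRev, ← invRev_append, ← h2, invRev_invRev]

lemma finite_short_image [Finite E] [Finite E'] {o : E × Bool → V}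
    (hinj : ∀ u v p q, IsPath o u p v → IsPath o u q v → FreeGroup.IsReduced p →
      FreeGroup.IsReduced q → FreeGroup.mk (sub G p) = FreeGroup.mk (sub G q) → p = q) (n : ℕ) :
    {p | FreeGroup.IsReduced p ∧ (∃ u v, IsPath o u p v) ∧ (red (sub G p)).length ≤ n}.Finite := by
  refine Set.Finite.of_finite_image (f := fun p => (p.head?, p.getLast?, red (sub G p))) ?_ ?_
  · refine Set.Finite.subset (Set.finite_univ.prod (Set.finite_univ.prod
      (List.finite_length_le (E' × Bool) n))) ?_
    rintro _ ⟨p, hp, rfl⟩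
    exact ⟨trivial, trivial, hp.2.2⟩
  · rintro p ⟨hp, ⟨u, v, hpath⟩, -⟩ q ⟨hq, ⟨u', v', hpath'⟩, -⟩ h
    simp only [Prod.mk.injEq] at h
    obtain ⟨h1, h2, h3⟩ := h
    rw [red_eq_iff] at h3
    cases p with
    | nil =>
      cases q with
      | nil => rfl
      | cons b q => simp at h1
    | cons a p =>
      obtain ⟨p₀, b, hb⟩ := List.eq_nil_or_concat (a :: p) |>.resolve_left (by simp)
      rw [List.concat_eq_append] at hb
      rw [hb, List.getLast?_append, List.getLast?_singleton, Option.some_or] at h2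
      obtain ⟨q₀, hq₀⟩ := List.getLast?_eq_some_iff.1 h2.symm
      have hu : u = u' := by
        cases q with
        | nil => simp at h1
        | cons c q =>
          simp only [List.head?_cons, Option.some.injEq] at h1
          rw [← hpath.1, ← hpath'.1, h1]
      have hv : v = v' := by
        rw [hb] at hpath
        rw [hq₀] at hpath'
        obtain ⟨_, -, hx⟩ := isPath_append.1 hpath
        obtain ⟨_, -, hy⟩ := isPath_append.1 hpath'
        exact hx.2.symm.trans hy.2
      subst hu hv
      exact hinj _ _ _ _ hpath hpath' hp hq h3

lemma bounded_cancellation [Finite E] [Finite E'] {o : E × Bool → V}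
    (hinj : ∀ u v p q, IsPath o u p v → IsPath o u q v → FreeGroup.IsReduced p →
      FreeGroup.IsReduced q → FreeGroup.mk (sub G p) = FreeGroup.mk (sub G q) → p = q) :
    ∃ C : ℕ, ∀ u v U W, IsPath o u (U ++ W) v → FreeGroup.IsReduced (U ++ W) → ∀ p t q,
      red (sub G U) = p ++ t → red (sub G W) = invRev t ++ q → t.length ≤ C := by
  obtain ⟨K, -, hK⟩ := exists_length_le G
  obtain ⟨B, hB⟩ := ((finite_short_image hinj (K + K)).image List.length).bddAbove
  refine ⟨K + K * B, fun u v U W hpath hred p t q hU hW => ?_⟩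
  obtain ⟨L, M, h1, -, hM⟩ := FreeGroup.Red.to_append_iff.1 (hU ▸ red_red (sub G U))
  obtain ⟨U₁, U₂, c, rfl, rfl, hc⟩ := exists_split_sub hK h1
  obtain ⟨L', M', h2, hL', -⟩ := FreeGroup.Red.to_append_iff.1 (hW ▸ red_red (sub G W))
  obtain ⟨W₁, W₂, d, rfl, rfl, hd⟩ := exists_split_sub' hK h2
  have e1 := (mk_eq_of_red hM)
  have e2 := (mk_eq_of_red hL')
  rw [← FreeGroup.mul_mk] at e1 e2
  rw [← FreeGroup.inv_mk] at e2
  have e3 : FreeGroup.mk (sub G (U₂ ++ W₁)) = FreeGroup.mk (invRev c ++ invRev d) := by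
    rw [sub_append, ← FreeGroup.mul_mk, ← FreeGroup.mul_mk, ← FreeGroup.inv_mk, ← FreeGroup.inv_mk,
      eq_inv_mul_of_mul_eq e1, eq_mul_inv_of_mul_eq e2]
    group
  have hmem : (U₂ ++ W₁).length ≤ B := by
    refine hB ⟨U₂ ++ W₁, ⟨hred.subword ⟨U₁, W₂, by simp⟩, ?_, ?_⟩, rfl⟩
    · rw [show U₁ ++ U₂ ++ (W₁ ++ W₂) = U₁ ++ ((U₂ ++ W₁) ++ W₂) by simp] at hpath
      obtain ⟨x, -, hx⟩ := isPath_append.1 hpath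
      obtain ⟨y, hy, -⟩ := isPath_append.1 hx
      exact ⟨x, y, hy⟩
    · rw [red_eq_iff.2 e3]
      refine (length_red_le _).trans ?_
      rw [List.length_append, FreeGroup.invRev_length, FreeGroup.invRev_length]
      omega
  have ht : FreeGroup.IsReduced t := by
    have := isReduced_red (sub G (U₁ ++ U₂))
    rw [hU] at this
    exact this.subword ⟨p, [], by simp⟩
  rw [← red_of_mk_eq (mk_eq_of_red hM) ht]
  refine (length_red_le _).trans ?_
  rw [List.length_append]
  rw [List.length_append] at hmem
  have h3 := length_sub_le hK U₂
  have h4 : K * U₂.length ≤ K * B := Nat.mul_le_mul_left _ (by omega)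
  omega

/-- The bounded cancellation property with constant `C`. -/
def Cancel (o : E × Bool → V) (G : E → List (E' × Bool)) (C : ℕ) : Prop :=
  ∀ u v U W, IsPath o u (U ++ W) v → FreeGroup.IsReduced (U ++ W) → ∃ p t q,
    red (sub G U) = p ++ t ∧ red (sub G W) = invRev t ++ q ∧ red (sub G (U ++ W)) = p ++ q ∧
      t.length ≤ C

lemma exists_cancel_const [Finite E] [Finite E'] {o : E × Bool → V}
    (hinj : ∀ u v p q, IsPath o u p v → IsPath o u q v → FreeGroup.IsReduced p →
      FreeGroup.IsReduced q → FreeGroup.mk (sub G p) = FreeGroup.mk (sub G q) → p = q) :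
    ∃ C : ℕ, Cancel o G C := by
  obtain ⟨C, hC⟩ := bounded_cancellation hinj
  refine ⟨C, fun u v U W hpath hred => ?_⟩
  obtain ⟨p, t, q, h1, h2, h3⟩ := exists_cancel (isReduced_red (sub G U)) (isReduced_red (sub G W))
  refine ⟨p, t, q, h1, h2, ?_, hC u v U W hpath hred p t q h1 h2⟩
  rw [sub_append]
  refine red_of_mk_eq ?_ h3
  rw [← FreeGroup.mul_mk, ← mk_red (sub G U), ← mk_red (sub G W), h1, h2]
  simp only [← FreeGroup.mul_mk, ← FreeGroup.inv_mk]
  group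

lemma Cancel.left {o : E × Bool → V} {C : ℕ} (h : Cancel o G C) {u v : V} {A x W : List (E × Bool)}
    (hp : IsPath o u (A ++ x ++ W) v) (hr : FreeGroup.IsReduced (A ++ x ++ W))
    (hA : FreeGroup.IsReduced (sub G (A ++ x))) (hx : C ≤ (sub G x).length) :
    ∃ x' W', red (sub G (A ++ x ++ W)) = sub G A ++ x' ++ W' ∧ x' <+: sub G x ∧
      (sub G x).length ≤ x'.length + C := by
  obtain ⟨p, t, q, h1, h2, h3, h4⟩ := h u v _ _ hp hr
  rw [red_eq_self.2 hA, sub_append, List.append_eq_append_iff] at h1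
  rcases h1 with ⟨x', h5, h6⟩ | ⟨z, h5, h6⟩
  · refine ⟨x', q, by rw [h3, h5], ⟨t, h6.symm⟩, ?_⟩
    rw [h6, List.length_append]
    omega
  · have hz : z = [] := by
      have := congrArg List.length h6
      rw [List.length_append] at this
      exact List.length_eq_zero_iff.1 (by omega)
    subst hz
    refine ⟨[], q, by rw [h3, h5]; simp, ⟨_, rfl⟩, ?_⟩
    rw [h6] at h4
    simpa using h4

lemma Cancel.right {o : E × Bool → V} {C : ℕ} (h : Cancel o G C) {u v : V} {B W : List (E × Bool)}
    (hp : IsPath o u (W ++ B) v) (hr : FreeGroup.IsReduced (W ++ B))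
    (hB : FreeGroup.IsReduced (sub G B)) :
    ∃ B' W', red (sub G (W ++ B)) = W' ++ B' ∧ B' <:+ sub G B ∧
      (sub G B).length ≤ B'.length + C := by
  obtain ⟨p, t, q, h1, h2, h3, h4⟩ := h u v _ _ hp hr
  rw [red_eq_self.2 hB] at h2
  refine ⟨q, p, h3, ⟨invRev t, h2.symm⟩, ?_⟩
  rw [h2, List.length_append, FreeGroup.invRev_length]
  omega

end

/-! ### Legal paths -/

namespace Rep

section

variable {F V E : Type*} [Group F] {φ : MulAut F}

/-- A word is legal if all its iterated images are reduced. -/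
def Legal (R : Rep φ V E) (L : List (E × Bool)) : Prop := ∀ n, FreeGroup.IsReduced (R.it n L)

/-- `Pieces R k L`: the word `L` is a concatenation of `k` legal words. -/
inductive Pieces (R : Rep φ V E) : ℕ → List (E × Bool) → Prop
  | nil : Pieces R 0 []
  | append {k : ℕ} {p q : List (E × Bool)} : R.Legal p → Pieces R k q → Pieces R (k + 1) (p ++ q)

variable {R : Rep φ V E} {L M : List (E × Bool)} {k m C : ℕ}

lemma legal_nil : R.Legal [] := fun n => by simp

lemma Legal.subword (h : R.Legal L) (h' : M <:+: L) : R.Legal M := by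
  obtain ⟨s, t, rfl⟩ := h'
  exact fun n => (h n).subword ⟨R.it n s, R.it n t, by simp⟩

lemma Legal.it (h : R.Legal L) (m : ℕ) : R.Legal (R.it m L) := fun n => by
  rw [← it_add]
  exact h (n + m)

lemma Pieces.of_append_right (h : R.Pieces k (L ++ M)) : R.Pieces k M := by
  generalize hN : L ++ M = N at h
  induction h generalizing L with
  | nil =>
    rw [List.append_eq_nil_iff] at hN
    rw [hN.2]
    exact .nil
  | append hp hq ih =>
    rw [List.append_eq_append_iff] at hN
    rcases hN with ⟨z, rfl, rfl⟩ | ⟨z, rfl, h⟩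
    · exact .append (hp.subword ⟨L, [], by simp⟩) hq
    · exact .append (p := []) legal_nil (ih h.symm)

lemma Pieces.of_append_left (h : R.Pieces k (L ++ M)) : R.Pieces k L := by
  generalize hN : L ++ M = N at h
  induction h generalizing L M with
  | nil =>
    rw [List.append_eq_nil_iff] at hN
    rw [hN.1]
    exact .nil
  | append hp hq ih =>
    rw [List.append_eq_append_iff] at hN
    rcases hN with ⟨z, rfl, rfl⟩ | ⟨z, rfl, h⟩
    · have := Pieces.append (hp.subword (M := L) ⟨[], z, by simp⟩) (ih (L := []) (M := _) rfl)
      rwa [List.append_nil] at this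
    · exact .append hp (ih h.symm)

lemma Pieces.subword (h : R.Pieces k L) (h' : M <:+: L) : R.Pieces k M := by
  obtain ⟨s, t, rfl⟩ := h'
  exact h.of_append_left.of_append_right

lemma Pieces.red_sub (h : R.Pieces k L) : R.Pieces k (red (TrainTrack.sub R.f L)) := by
  induction h with
  | nil =>
    rw [sub_nil, red_eq_self.2 (by simp)]
    exact .nil
  | @append k p q hp hq ih =>
    obtain ⟨p', t, q', h1, h2, h3⟩ := exists_cancel (hp 1) (isReduced_red (TrainTrack.sub R.f q))
    have : red (TrainTrack.sub R.f (p ++ q)) = p' ++ q' := by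
      refine red_of_mk_eq ?_ h3
      rw [sub_append, ← FreeGroup.mul_mk, ← mk_red (TrainTrack.sub R.f q), h2]
      rw [it_succ, it_zero] at h1
      rw [h1]
      simp only [← FreeGroup.mul_mk, ← FreeGroup.inv_mk]
      group
    rw [this]
    refine .append ((hp.it 1).subword ⟨[], t, by simp [h1]⟩) (Pieces.of_append_right (L := invRev t) ?_)
    rwa [← h2]

lemma Pieces.length_le (h : R.Pieces k L) (hC : ∀ M, M <:+: L → R.Legal M → M.length ≤ C) :
    L.length ≤ k * C := by
  induction h with
  | nil => simp
  | @append k p q hp hq ih =>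
    have h1 := hC p ⟨[], q, by simp⟩ hp
    have h2 := ih fun M hM => hC M (hM.trans ⟨p, [], by simp⟩)
    rw [List.length_append, Nat.succ_mul]
    omega

lemma pieces_length (h : ∀ a, R.Legal [a]) (L : List (E × Bool)) : R.Pieces L.length L := by
  induction L with
  | nil => exact .nil
  | cons a L ih => exact .append (p := [a]) (h a) ih

/-! #### Growth of loops with a long legal segment -/

/-- A cyclically reduced word: its square is reduced. -/
def _root_.TrainTrack.CycRed {E : Type*} (L : List (E × Bool)) : Prop := FreeGroup.IsReduced (L ++ L)

/-- A cyclically reduced loop starting with `A` and having a long legal segment around its base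
point, which contains `A`. -/
structure Grow (R : Rep φ V E) (C : ℕ) (u : V) (L A : List (E × Bool)) : Prop where
  path : IsPath R.o u L u
  cyc : CycRed L
  ne : A ≠ []
  seg : ∃ x B W W', L = A ++ x ++ W ∧ L = W' ++ B ∧ C ≤ x.length ∧ C + 1 ≤ B.length ∧
    R.Legal (B ++ (A ++ x))

lemma Grow.step (hC : Cancel R.o (fun e => R.it m [(e, true)]) C)
    (hm : ∀ a, 2 ≤ (R.it m [a]).length) {u : V} {A : List (E × Bool)} (h : R.Grow C u L A) :
    R.Grow C (R.fV^[m] u) (red (R.it m L)) (R.it m A) := by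
  have hm' : ∀ L, 2 * L.length ≤ (R.it m L).length := fun L => by
    rw [it_eq_sub]
    exact le_length_sub (fun e => hm (e, true)) L
  obtain ⟨x, B, W, W', h1, h2, h3, h4, h5⟩ := h.seg
  have hcyc : FreeGroup.IsReduced L := h.cyc.subword ⟨[], L, by simp⟩
  have hAx : R.Legal (A ++ x) := h5.subword ⟨B, [], by simp⟩
  have hB : R.Legal B := h5.subword ⟨[], A ++ x, by simp⟩
  obtain ⟨x', Z, e1, e2, e3⟩ := hC.left (A := A) (x := x) (W := W) (h1 ▸ h.path) (h1 ▸ hcyc)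
    (by rw [← it_eq_sub]; exact hAx m) (by rw [← it_eq_sub]; have := hm' x; omega)
  obtain ⟨B', Z', e4, e5, e6⟩ := hC.right (B := B) (W := W') (h2 ▸ h.path) (h2 ▸ hcyc)
    (by rw [← it_eq_sub]; exact hB m)
  rw [← h1] at e1
  rw [← h2] at e4
  simp only [← it_eq_sub] at e1 e2 e3 e4 e5 e6
  have hne : R.it m A ≠ [] := by
    have h7 := hm' A
    have h8 := List.length_pos_iff.2 h.ne
    exact List.length_pos_iff.1 (by omega)
  have hleg : R.Legal (B' ++ (R.it m A ++ x')) := by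
    obtain ⟨s, hs⟩ := e2
    obtain ⟨t, ht⟩ := e5
    refine (h5.it m).subword ⟨t, s, ?_⟩
    rw [it_append, it_append, ← hs, ← ht]
    simp
  refine ⟨(R.isPath_it m h.path).red, ?_, hne, x', B', Z, Z', e1, e4, ?_, ?_, hleg⟩
  · unfold CycRed
    rw [isReduced_append_iff]
    refine ⟨isReduced_red _, isReduced_red _, fun a ha b hb => ?_⟩
    have h7 : FreeGroup.IsReduced (B' ++ (R.it m A ++ x')) := hleg 0
    have hB' : B' ≠ [] := List.length_pos_iff.1 (by have := hm' B; omega)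
    rw [e4, List.getLast?_append_of_ne_nil _ hB'] at ha
    rw [e1, List.head?_append_of_ne_nil _ (by simp [hne])] at hb
    exact (isReduced_append_iff.1 h7).2.2 a ha b hb
  · have := hm' x
    omega
  · have := hm' B
    omega

lemma Grow.iterate (hC : Cancel R.o (fun e => R.it m [(e, true)]) C)
    (hm : ∀ a, 2 ≤ (R.it m [a]).length) {u : V} {A : List (E × Bool)} (h : R.Grow C u L A) (j : ℕ) :
    ∃ v M, R.Grow C v M (R.it (m * j) A) ∧ FreeGroup.mk M = FreeGroup.mk (R.it (m * j) L) ∧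
      v = R.fV^[m * j] u := by
  induction j with
  | zero => exact ⟨u, L, h, rfl, rfl⟩
  | succ j ih =>
    obtain ⟨v, M, h1, h2, h3⟩ := ih
    refine ⟨_, red (R.it m M), ?_, ?_, rfl⟩
    · have h4 := h1.step hC hm
      rw [h3, ← Function.iterate_add_apply, ← it_add] at h4
      rwa [Nat.mul_succ, Nat.add_comm (m * j) m]
    · rw [mk_red, Nat.mul_succ, Nat.add_comm, it_add]
      exact R.mk_it_congr m h2

lemma exists_cancel_it [Finite E] (R : Rep φ V E) (m : ℕ) :
    ∃ C : ℕ, Cancel R.o (fun e => R.it m [(e, true)]) C := by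
  obtain ⟨H, hH⟩ := R.exists_gauge m
  refine exists_cancel_const fun u v p q hp hq hpr hqr h => ?_
  rw [← it_eq_sub, ← it_eq_sub] at h
  refine R.marked.eq_of_reduced hp hq ?_ hpr hqr
  have h1 := lab_eq_of_mk R.r h
  rw [hH u v p hp, hH u v q hq] at h1
  exact (φ ^ m).injective (mul_left_cancel (mul_right_cancel h1))

end

end Rep

/-! ### Conjugacy classes and loops -/

/-- The action of the powers of an automorphism on conjugacy classes. -/
def act {F : Type*} [Group F] (φ : MulAut F) (n : ℕ) (α : ConjClasses F) : ConjClasses F :=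
  ConjClasses.map ((φ ^ n : MulAut F) : F →* F) α

section Act

variable {F : Type*} [Group F] {φ : MulAut F}

lemma act_mk (n : ℕ) (x : F) : act φ n (ConjClasses.mk x) = ConjClasses.mk ((φ ^ n) x) := rfl

lemma act_add (m n : ℕ) (α : ConjClasses F) : act φ (m + n) α = act φ m (act φ n α) := by
  obtain ⟨x, rfl⟩ := ConjClasses.exists_rep α
  rw [act_mk, act_mk, act_mk, pow_add, MulAut.mul_apply]

lemma act_injective (n : ℕ) : Function.Injective (act φ n) := by
  intro α β h
  obtain ⟨x, rfl⟩ := ConjClasses.exists_rep α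
  obtain ⟨y, rfl⟩ := ConjClasses.exists_rep β
  rw [act_mk, act_mk, ConjClasses.mk_eq_mk_iff_isConj, isConj_iff] at h
  obtain ⟨c, hc⟩ := h
  rw [ConjClasses.mk_eq_mk_iff_isConj, isConj_iff]
  refine ⟨(φ ^ n).symm c, (φ ^ n).injective ?_⟩
  rw [_root_.map_mul, _root_.map_mul, _root_.map_inv, MulEquiv.apply_symm_apply, hc]

end Act

section CycRed

variable {E : Type*} {L M p : List (E × Bool)}

lemma cycRed_iff : CycRed L ↔ FreeGroup.IsCyclicallyReduced L := by
  rw [CycRed, isReduced_append_iff, FreeGroup.isCyclicallyReduced_iff]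
  constructor
  · rintro ⟨h, -, h'⟩
    refine ⟨h, fun a ha b hb hab => ?_⟩
    have := h' a ha b hb
    by_contra hne
    exact this (Prod.ext hab.symm (Bool.eq_not_of_ne (Ne.symm hne)))
  · rintro ⟨h, h'⟩
    refine ⟨h, h, fun a ha b hb hab => ?_⟩
    subst hab
    have := h' a ha _ hb rfl
    simp [bar] at this

lemma exists_cycRed (hL : FreeGroup.IsReduced L) :
    ∃ c M, L = c ++ M ++ invRev c ∧ CycRed M := by
  classical
  exact ⟨FreeGroup.reduceCyclically.conjugator L, FreeGroup.reduceCyclically L,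
    (FreeGroup.reduceCyclically.conj_conjugator_reduceCyclically L).symm,
    cycRed_iff.2 (FreeGroup.reduceCyclically.isCyclicallyReduced hL)⟩

lemma mk_flatten_replicate (L : List (E × Bool)) (n : ℕ) :
    FreeGroup.mk (List.replicate n L).flatten = FreeGroup.mk L ^ n := by
  induction n with
  | zero => simp [FreeGroup.one_eq_mk]
  | succ n ih => rw [List.replicate_succ, List.flatten_cons, ← FreeGroup.mul_mk, ih, pow_succ']

/-- A cyclically reduced word is shortest among the words representing its conjugates. -/
lemma CycRed.length_le (hL : CycRed L)
    (h : FreeGroup.mk L = FreeGroup.mk p * FreeGroup.mk M * (FreeGroup.mk p)⁻¹) :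
    L.length ≤ M.length := by
  by_contra! hlt
  set n := 2 * p.length + 1
  have hr : FreeGroup.IsReduced (List.replicate n L).flatten :=
    ((cycRed_iff.1 hL).flatten_replicate n).isReduced
  have h1 : FreeGroup.mk (p ++ (List.replicate n M).flatten ++ invRev p) =
      FreeGroup.mk (List.replicate n L).flatten := by
    rw [← FreeGroup.mul_mk, ← FreeGroup.mul_mk, mk_flatten_replicate, mk_flatten_replicate,
      mk_invRev, h, conj_pow]
  have h2 := length_red_le (p ++ (List.replicate n M).flatten ++ invRev p)
  rw [red_of_mk_eq h1 hr] at h2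
  simp only [List.length_append, List.length_flatten, List.map_replicate, List.sum_replicate,
    smul_eq_mul, FreeGroup.invRev_length] at h2
  have h3 : n * (M.length + 1) ≤ n * L.length := Nat.mul_le_mul_left _ hlt
  rw [Nat.mul_succ] at h3
  omega

end CycRed

namespace Rep

section

variable {F V E : Type*} [Group F] {φ : MulAut F}

/-- The loop `L` represents the conjugacy class `α`. -/
def Reps (R : Rep φ V E) (L : List (E × Bool)) (α : ConjClasses F) : Prop :=
  ∃ u, IsPath R.o u L u ∧ ConjClasses.mk (lab R.r L) = α

variable {R : Rep φ V E} {L M : List (E × Bool)} {α : ConjClasses F}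

lemma Reps.it (h : R.Reps L α) (n : ℕ) : R.Reps (R.it n L) (act φ n α) := by
  obtain ⟨u, hu, rfl⟩ := h
  obtain ⟨H, hH⟩ := R.exists_gauge n
  refine ⟨_, R.isPath_it n hu, ?_⟩
  rw [hH u u L hu, act_mk, ConjClasses.mk_eq_mk_iff_isConj, isConj_iff]
  exact ⟨H u, by group⟩

lemma Reps.red (h : R.Reps L α) : R.Reps (red L) α := by
  obtain ⟨u, hu, hα⟩ := h
  exact ⟨u, hu.red, by rw [← hα, lab_eq_of_mk R.r (mk_red L)]⟩

lemma Reps.rotate (h : R.Reps (L ++ M) α) : R.Reps (M ++ L) α := by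
  obtain ⟨u, hu, hα⟩ := h
  obtain ⟨w, h1, h2⟩ := isPath_append.1 hu
  refine ⟨w, h2.append h1, ?_⟩
  rw [← hα, ConjClasses.mk_eq_mk_iff_isConj, isConj_iff, lab_append, lab_append]
  exact ⟨lab R.r L, by group⟩

lemma Reps.length_le (h : R.Reps L α) (h' : R.Reps M α) (hL : CycRed L) : L.length ≤ M.length := by
  obtain ⟨u, hu, hα⟩ := h
  obtain ⟨v, hv, hα'⟩ := h'
  rw [← hα, ConjClasses.mk_eq_mk_iff_isConj, isConj_iff] at hα'
  obtain ⟨g, hg⟩ := hα'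
  obtain ⟨p, hp, rfl⟩ := R.marked.surj u v g
  refine hL.length_le (p := p) ?_
  rw [R.marked.mk_eq hu ((hp.append hv).append hp.invRev)
    (by rw [lab_append, lab_append, lab_invRev, hg]), ← FreeGroup.mul_mk, ← FreeGroup.mul_mk, mk_invRev]

lemma Reps.exists_cycRed (h : R.Reps L α) :
    ∃ M, CycRed M ∧ M <:+: TrainTrack.red L ∧ R.Reps M α := by
  obtain ⟨c, M, h1, h2⟩ := TrainTrack.exists_cycRed (isReduced_red L)
  refine ⟨M, h2, ⟨c, invRev c, h1.symm⟩, ?_⟩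
  obtain ⟨u, hu, hα⟩ := h.red
  rw [h1, List.append_assoc] at hu
  obtain ⟨w, hw, hu⟩ := isPath_append.1 hu
  obtain ⟨w', hw', hu⟩ := isPath_append.1 hu
  obtain rfl : w' = w := by
    have h3 := hu.invRev
    rw [invRev_invRev] at h3
    exact h3.end_unique hw
  refine ⟨_, hw', ?_⟩
  rw [← hα, h1, lab_append, lab_append, lab_invRev, ConjClasses.mk_eq_mk_iff_isConj, isConj_iff]
  exact ⟨_, rfl⟩

lemma exists_reps [Nonempty V] (R : Rep φ V E) (α : ConjClasses F) : ∃ L, R.Reps L α := by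
  obtain ⟨x, rfl⟩ := ConjClasses.exists_rep α
  obtain ⟨p, hp, hx⟩ := R.marked.surj (Classical.arbitrary V) (Classical.arbitrary V) x
  exact ⟨p, _, hp, by rw [hx]⟩

lemma exists_reps_pieces [Nonempty V] (R : Rep φ V E) (hleg : ∀ a, R.Legal [a])
    (α : ConjClasses F) : ∃ K, ∀ n, ∃ L, CycRed L ∧ R.Reps L (act φ n α) ∧ R.Pieces K L := by
  obtain ⟨L₀, h0⟩ := R.exists_reps (act φ 0 α)
  obtain ⟨M, h1, -, h3⟩ := h0.exists_cycRed
  refine ⟨M.length, fun n => ?_⟩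
  induction n with
  | zero => exact ⟨M, h1, h3, pieces_length hleg M⟩
  | succ n ih =>
    obtain ⟨L, -, h5, h6⟩ := ih
    have h7 := h5.it 1
    rw [← act_add, it_succ, it_zero, Nat.add_comm] at h7
    obtain ⟨M', h8, h9, h10⟩ := h7.exists_cycRed
    exact ⟨M', h8, h10, h6.red_sub.subword h9⟩

/-- The loops representing the iterates of a non-periodic class contain long legal segments. -/
lemma exists_long [Finite E] [Nonempty V] (R : Rep φ V E) (hleg : ∀ a, R.Legal [a])
    (hα : ∀ k, 0 < k → act φ k α ≠ α) (D : ℕ) : ∃ n L S, CycRed L ∧ R.Reps L (act φ n α) ∧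
      S <:+: L ∧ R.Legal S ∧ D ≤ S.length := by
  by_contra! hcon
  obtain ⟨K, hK⟩ := R.exists_reps_pieces hleg α
  choose L h1 h2 h3 using hK
  have h4 : ∀ n, (L n).length ≤ K * D := fun n =>
    (h3 n).length_le fun M hM hM' => (hcon n (L n) M (h1 n) (h2 n) hM hM').le
  have : Finite {l : List (E × Bool) | l.length ≤ K * D} := (List.finite_length_le _ _).to_subtype
  obtain ⟨i, j, hij, h5⟩ := Finite.exists_ne_map_eq_of_infinite
    (fun n => (⟨L n, h4 n⟩ : {l : List (E × Bool) | l.length ≤ K * D}))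
  have key : ∀ i j, i < j → L i = L j → False := by
    intro i j hij h5
    have h6 := h2 j
    rw [← h5] at h6
    have h7 : act φ i α = act φ j α := by
      obtain ⟨u, hu, h8⟩ := h2 i
      obtain ⟨v, hv, h9⟩ := h6
      rw [← h8, ← h9]
    obtain ⟨d, rfl⟩ := Nat.exists_eq_add_of_lt hij
    rw [Nat.add_assoc, act_add] at h7
    exact hα (d + 1) (by omega) (act_injective i h7).symm
  rcases Nat.lt_or_gt_of_ne hij with h | h
  · exact key i j h (congrArg Subtype.val h5)
  · exact key j i h (congrArg Subtype.val h5).symm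

lemma exists_grow [Finite E] [Nonempty V] (R : Rep φ V E) (hleg : ∀ a, R.Legal [a])
    (hα : ∀ k, 0 < k → act φ k α ≠ α) (C : ℕ) : ∃ n u L A, R.Grow C u L A ∧
      ConjClasses.mk (lab R.r L) = act φ n α := by
  obtain ⟨n, L, S, h1, h2, ⟨X, Y, rfl⟩, h4, h5⟩ := R.exists_long hleg hα (2 * C + 2)
  obtain ⟨B, T, rfl, hB⟩ : ∃ B T, S = B ++ T ∧ B.length = C + 1 :=
    ⟨S.take (C + 1), S.drop (C + 1), (List.take_append_drop _ _).symm, by simp; omega⟩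
  rw [List.length_append] at h5
  obtain _ | ⟨a, x⟩ := T
  · simp at h5; omega
  rw [List.length_cons] at h5
  have h6 : X ++ (B ++ a :: x) ++ Y = (X ++ B) ++ (a :: x ++ Y) := by simp
  rw [h6] at h1 h2
  obtain ⟨u, hu, h7⟩ := h2.rotate
  refine ⟨n, u, _, [a], ⟨hu, ?_, by simp, x, B, Y ++ (X ++ B), a :: x ++ Y ++ X, by simp, by simp,
    by omega, by omega, by simpa using h4⟩, h7⟩
  have h8 : FreeGroup.IsReduced (((X ++ B) ++ (a :: x ++ Y)) ++ ((X ++ B) ++ (a :: x ++ Y)) ++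
      ((X ++ B) ++ (a :: x ++ Y))) := by
    have := ((cycRed_iff.1 h1).flatten_replicate 3).isReduced
    simpa [List.replicate_succ] using this
  exact h8.subword ⟨X ++ B, a :: x ++ Y, by simp⟩

end

end Rep

/-! ### Growth of conjugacy classes -/

namespace Rep

section Compare

variable {N : ℕ} {V E : Type*} {φ : MulAut (FreeGroup (Fin N))} (R : Rep φ V E)
  (β : FreeGroup (Fin N) ≃* FreeGroup (Fin N))

lemma cycLength_le [Finite E] : ∃ C : ℕ, ∀ α L, R.Reps L α → cycLength β α ≤ C * L.length := by
  classical
  cases nonempty_fintype E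
  refine ⟨∑ e, (β (R.r e)).norm, fun α L hL => ?_⟩
  have h1 : ∀ L, (β (lab R.r L)).norm ≤ (∑ e, (β (R.r e)).norm) * L.length := by
    intro L
    induction L with
    | nil => simp
    | cons a L ih =>
      have h2 : (β (lab R.r [a])).norm = (β (R.r a.1)).norm := by
        obtain ⟨e, _ | _⟩ := a <;> simp
      have h3 := Finset.single_le_sum (f := fun e => (β (R.r e)).norm) (fun _ _ => Nat.zero_le _)
        (Finset.mem_univ a.1)
      have h4 := FreeGroup.norm_mul_le (β (lab R.r [a])) (β (lab R.r L))
      rw [lab_cons, _root_.map_mul, List.length_cons, Nat.mul_succ]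
      omega
  obtain ⟨u, -, hα⟩ := hL
  exact (Nat.sInf_le (Set.mem_image_of_mem (fun g => (β g).norm) hα)).trans (h1 L)

lemma length_le_cycLength [Nonempty V] :
    ∃ C : ℕ, ∀ α L, CycRed L → R.Reps L α → L.length ≤ C * cycLength β α := by
  classical
  have v : V := Classical.arbitrary V
  choose q hq hlab using fun i => R.marked.surj v v (β.symm (FreeGroup.of i))
  obtain ⟨C, -, hC⟩ := exists_length_le q
  refine ⟨C, fun α L hL hα => ?_⟩
  obtain ⟨x, hx, hn⟩ : cycLength β α ∈ (fun g => (β g).norm) '' {g | ConjClasses.mk g = α} := by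
    refine Nat.sInf_mem ?_
    obtain ⟨x, rfl⟩ := ConjClasses.exists_rep α
    exact ⟨_, x, rfl, rfl⟩
  have h1 : R.Reps (sub q (β x).toWord) α := by
    refine ⟨v, ?_, ?_⟩
    · exact IsPath.sub (o := fun _ => ()) (π := fun _ => v) (u := ()) (v := ()) hq (by
        generalize (β x).toWord = w
        induction w with
        | nil => rfl
        | cons a w ih => exact ⟨rfl, ih⟩)
    · rw [lab_sub]
      simp only [hlab]
      have h2 := map_lab FreeGroup.of (β.symm : FreeGroup (Fin N) →* FreeGroup (Fin N)) (β x).toWord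
      rw [lab_of, FreeGroup.mk_toWord] at h2
      have h3 : (β.symm : FreeGroup (Fin N) →* FreeGroup (Fin N)) (β x) = x := by simp
      rw [h3] at h2
      exact (congrArg ConjClasses.mk h2.symm).trans hx
  refine (hα.length_le h1 hL).trans ((length_sub_le hC _).trans (le_of_eq ?_))
  rw [← hn]
  rfl

end Compare

section

variable {N : ℕ} {V E : Type} [Fintype E] {φ : MulAut (FreeGroup (Fin N))} {R : Rep φ V E}
  {w : E → ℝ} {l : ℝ}

omit [Fintype E] in
lemma length_it_le_mul {K : ℝ} (hK : ∀ n a, ((R.it n [a]).length : ℝ) ≤ K * l ^ n) (n : ℕ)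
    (L : List (E × Bool)) : ((R.it n L).length : ℝ) ≤ K * L.length * l ^ n := by
  induction L with
  | nil => simp
  | cons a L ih =>
    rw [it_cons, List.length_append, List.length_cons]
    push_cast
    linarith [hK n a]

/-- Exponential growth of the non-periodic conjugacy classes. -/
lemma Opt.growth (hN : 2 ≤ N) (hφ : FI φ) (h : R.Opt w l) {α : ConjClasses (FreeGroup (Fin N))}
    (hα : ∀ k, 0 < k → act φ k α ≠ α) :
    ∃ c : ℝ, 0 < c ∧ ∃ n₀, ∀ n, n₀ ≤ n → ∀ M, R.Reps M (act φ n α) → c * l ^ n ≤ M.length := by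
  have hne := h.ne
  have : Nonempty V := ⟨R.o (hne.some, true)⟩
  have hl := h.one_lt hN hφ
  have hl0 : 0 < l := one_pos.trans hl
  obtain ⟨m, hm0, hm⟩ := h.exists_expanding hN hφ
  obtain ⟨C, hC⟩ := R.exists_cancel_it m
  obtain ⟨n₀, u, L, A, hG, hL⟩ := R.exists_grow (fun a n => h.isReduced_it hN hφ n a) hα C
  obtain ⟨K, hK0, hK⟩ := h.length_bounds
  obtain ⟨B, hB1, hB⟩ := exists_length_le R.f
  have hB0 : (0 : ℝ) < (B : ℝ) ^ m := by positivity
  refine ⟨(K * B ^ m * l ^ n₀)⁻¹, by positivity, n₀, fun n hn M hM => ?_⟩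
  set j := (n - n₀) / m + 1
  obtain ⟨i, hi, him⟩ : ∃ i, i + n = m * j + n₀ ∧ i ≤ m := by
    have h1 := Nat.div_add_mod (n - n₀) m
    have h2 := Nat.mod_lt (n - n₀) hm0
    have h3 : m * j = m * ((n - n₀) / m) + m := Nat.mul_succ _ _
    exact ⟨m * j + n₀ - n, by omega, by omega⟩
  obtain ⟨v, M', g1, g2, -⟩ := hG.iterate hC hm j
  have hM' : R.Reps M' (act φ (m * j + n₀) α) := by
    refine ⟨v, g1.path, ?_⟩
    rw [lab_eq_of_mk R.r g2, act_add, ← hL]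
    obtain ⟨_, h4, h5⟩ := Reps.it ⟨u, hG.path, rfl⟩ (m * j)
    exact h5
  have h1 := hM.it i
  rw [← act_add, hi] at h1
  have h2 : M'.length ≤ B ^ m * M.length :=
    (hM'.length_le h1 g1.cyc).trans ((length_it_le hB i M).trans
      (Nat.mul_le_mul_right _ (Nat.pow_le_pow_right hB1 him)))
  have h3 : l ^ (m * j) ≤ K * M'.length := by
    obtain ⟨x, _, W, _, e1, -⟩ := g1.seg
    obtain ⟨a, ha⟩ := List.exists_mem_of_ne_nil _ hG.ne
    have h4 : (R.it (m * j) [a]).length ≤ M'.length := by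
      refine (length_it_mem ha).trans ?_
      rw [e1, List.append_assoc, List.length_append]
      exact Nat.le_add_right _ _
    refine ((hK (m * j) a).2).trans ?_
    exact mul_le_mul_of_nonneg_left (by exact_mod_cast h4) hK0.le
  have h4 : l ^ n ≤ l ^ (m * j) * l ^ n₀ := by
    rw [← pow_add]
    exact pow_le_pow_right₀ hl.le (by omega)
  have h5 : (M'.length : ℝ) ≤ B ^ m * M.length := by exact_mod_cast h2
  rw [inv_mul_le_iff₀ (by positivity)]
  calc l ^ n ≤ l ^ (m * j) * l ^ n₀ := h4
    _ ≤ (K * M'.length) * l ^ n₀ := by gcongr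
    _ ≤ (K * (B ^ m * M.length)) * l ^ n₀ := by gcongr
    _ = K * B ^ m * l ^ n₀ * M.length := by ring

lemma Opt.cycLength_bounds (hN : 2 ≤ N) (hφ : FI φ) (h : R.Opt w l)
    (β : FreeGroup (Fin N) ≃* FreeGroup (Fin N)) {α : ConjClasses (FreeGroup (Fin N))}
    (hα : ∀ k, 0 < k → act φ k α ≠ α) :
    ∃ c C : ℝ, 0 < c ∧ ∃ n₀, ∀ n, n₀ ≤ n → c * l ^ n ≤ cycLength β (act φ n α) ∧
      cycLength β (act φ n α) ≤ C * l ^ n := by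
  have hne := h.ne
  have : Nonempty V := ⟨R.o (hne.some, true)⟩
  obtain ⟨c, hc, n₀, hn₀⟩ := h.growth hN hφ hα
  obtain ⟨C₁, hC₁⟩ := R.cycLength_le β
  obtain ⟨C₂, hC₂⟩ := R.length_le_cycLength β
  obtain ⟨K, hK0, hK⟩ := h.length_bounds
  obtain ⟨L, hL⟩ := R.exists_reps α
  refine ⟨c * (C₂ + 1 : ℝ)⁻¹, C₁ * (K * L.length), by positivity, n₀, fun n hn => ⟨?_, ?_⟩⟩
  · obtain ⟨M, h1, -, h2⟩ := (hL.it n).exists_cycRed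
    have h3 : (M.length : ℝ) ≤ C₂ * cycLength β (act φ n α) := by exact_mod_cast hC₂ _ _ h1 h2
    have h4 := hn₀ n hn M h2
    rw [mul_comm c, mul_assoc, inv_mul_le_iff₀ (by positivity)]
    have h5 : (0 : ℝ) ≤ cycLength β (act φ n α) := Nat.cast_nonneg _
    linarith
  · have h3 : (cycLength β (act φ n α) : ℝ) ≤ C₁ * (R.it n L).length := by
      exact_mod_cast hC₁ _ _ (hL.it n)
    refine h3.trans ?_
    rw [mul_assoc]
    exact mul_le_mul_of_nonneg_left (length_it_le_mul (fun n a => (hK n a).1) n L) (Nat.cast_nonneg _)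

end

end Rep

/-- A sequence comparable to `l ^ n` has root growth rate `l`. -/
lemma tendsto_rpow_of_bounds {x : ℕ → ℝ} {l c C : ℝ} (hl : 0 < l) (hc : 0 < c) (n₀ : ℕ)
    (h : ∀ n, n₀ ≤ n → c * l ^ n ≤ x n ∧ x n ≤ C * l ^ n) :
    Filter.Tendsto (fun n : ℕ => x n ^ (1 / (n : ℝ))) Filter.atTop (nhds l) := by
  have hC : 0 < C := by
    have := h n₀ le_rfl
    have h1 : 0 < l ^ n₀ := by positivity
    nlinarith [mul_pos hc h1, this.1.trans this.2]
  have key : ∀ d : ℝ, 0 < d →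
      Filter.Tendsto (fun n : ℕ => (d * l ^ n) ^ (1 / (n : ℝ))) Filter.atTop (nhds l) := by
    intro d hd
    have h1 : Filter.Tendsto (fun n : ℕ => d ^ (1 / (n : ℝ)) * l) Filter.atTop (nhds l) := by
      have h2 : Filter.Tendsto (fun n : ℕ => d ^ (1 / (n : ℝ))) Filter.atTop (nhds (d ^ (0 : ℝ))) :=
        ((Real.continuousAt_const_rpow hd.ne').tendsto).comp tendsto_one_div_atTop_nhds_zero_nat
      have h3 := h2.mul_const l
      rwa [Real.rpow_zero, one_mul] at h3
    refine h1.congr' ?_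
    filter_upwards [Filter.eventually_gt_atTop 0] with n hn
    rw [Real.mul_rpow hd.le (by positivity), one_div, Real.pow_rpow_inv_natCast hl.le hn.ne']
  refine tendsto_of_tendsto_of_tendsto_of_le_of_le' (key c hc) (key C hC) ?_ ?_
  · filter_upwards [Filter.eventually_ge_atTop n₀] with n hn
    exact Real.rpow_le_rpow (by positivity) (h n hn).1 (by positivity)
  · filter_upwards [Filter.eventually_ge_atTop n₀] with n hn
    exact Real.rpow_le_rpow (le_trans (by positivity) (h n hn).1) (h n hn).2 (by positivity)

/-- Automorphisms with the same outer class act in the same way on conjugacy classes. -/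
lemma act_eq_of_mk_eq {F : Type*} [Group F] {f g : MulAut F}
    (h : (QuotientGroup.mk f : Out F) = QuotientGroup.mk g) (n : ℕ) (α : ConjClasses F) :
    act f n α = act g n α := by
  obtain ⟨x, rfl⟩ := ConjClasses.exists_rep α
  have h1 : (QuotientGroup.mk (f ^ n) : MulAut F ⧸ Inn F) = QuotientGroup.mk (g ^ n) := by
    rw [QuotientGroup.mk_pow, QuotientGroup.mk_pow]
    exact congrArg (· ^ n) h
  obtain ⟨c, hc⟩ := QuotientGroup.eq.1 h1
  rw [act_mk, act_mk, ConjClasses.mk_eq_mk_iff_isConj, isConj_iff]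
  refine ⟨(f ^ n) c, ?_⟩
  have h2 : g ^ n = f ^ n * MulAut.conj c := by rw [hc]; group
  rw [h2, MulAut.mul_apply, MulAut.conj_apply, _root_.map_mul, _root_.map_mul, _root_.map_inv]

lemma _root_.FullyIrreducible.fi {N : ℕ} {f : MulAut (FreeGroupN N)}
    (h : FullyIrreducible (QuotientGroup.mk f : Out (FreeGroupN N))) : FI f :=
  fun k hk A hA h1 h2 g => h k hk (f ^ k) rfl A hA h1 h2 g

end TrainTrack

/-- For `N ≥ 2` and `φ ∈ Out(F_N)` fully irreducible, there is a real `λ > 1` such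
that for every free basis `X` of `F_N` and every non-`φ`-periodic conjugacy class `α`,
`(‖φ^n(α)‖_X)^(1/n) → λ`; i.e. the stretch factor is well defined and `> 1`. -/
theorem stretch_factor_well_defined :
    ∀ N : ℕ, 2 ≤ N →
      ∀ φ : Out (FreeGroupN N), FullyIrreducible φ →
        ∃ lam : ℝ, 1 < lam ∧ HasStretchFactor φ lam := by
  intro N hN φ hφ
  obtain ⟨f₀, rfl⟩ := QuotientGroup.mk_surjective φ
  have hf₀ := hφ.fi
  obtain ⟨V, E, _, R, u, l, hR⟩ := TrainTrack.exists_opt hN hf₀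
  have hl := hR.one_lt hN hf₀
  refine ⟨l, hl, fun f hf β α hα => ?_⟩
  have h1 : ∀ k, 0 < k → TrainTrack.act f₀ k α ≠ α := fun k hk h =>
    hα ⟨k, hk, (TrainTrack.act_eq_of_mk_eq hf k α).trans h⟩
  obtain ⟨c, C, hc, n₀, hb⟩ := hR.cycLength_bounds hN hf₀ β h1
  refine TrainTrack.tendsto_rpow_of_bounds (C := C) (one_pos.trans hl) hc n₀ fun n hn => ?_
  have h2 := hb n hn
  rwa [← TrainTrack.act_eq_of_mk_eq hf n α] at h2
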